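/- Let 𝕂 be ℝ or ℂ and let Φ = (Φ_1,…,Φ_n) : (𝕂,0) → (𝕂^n,0) be an analytic germ with Φ_1(t)=t^p for a positive integer p. Write the Taylor series of Φ as Φ(t) = Σ_{1≤k<N} a_k t^{n_k} with a_k ∈ 𝕂^n∖{0} and 1 ≤ n_1 < n_2 < ⋯ (so {n_1, n_2, …} is the support of the power series of Φ), and assume gcd(n_1, n_2, …) = 1. Let 𝔐 be an R-admissible weight matrix. If f : (ℝ^d,0) → (𝕂,0) is a continuous function germ such that Φ∘f is of class E^{{𝔐}}, then f is of class E^{{𝔐}}. -/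

import Mathlib

open Set Filter Topology Metric
open scoped ENNReal NNReal Topology

noncomputable section

namespace JorisPaper

/-- The sequence `m` with `m_k = M_k / k!`. -/
def lc (M : ℕ → ℝ) (k : ℕ) : ℝ := M k / (Nat.factorial k : ℝ)

/-- A weight sequence: positive, log-convex, `M_0 = 1 ≤ M_1`, `M_k^{1/k} → ∞`. -/
structure IsWeightSeq (M : ℕ → ℝ) : Prop where
  pos : ∀ k, 0 < M k
  first : M 0 = 1
  one_le : 1 ≤ M 1
  logconvex : ∀ k, 1 ≤ k → M k ^ 2 ≤ M (k - 1) * M (k + 1)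
  root : Filter.Tendsto (fun k : ℕ => M k ^ ((1 : ℝ) / (k : ℝ))) atTop atTop

/-- `m_k^{1/k} → ∞`. -/
def RootsTendsto (m : ℕ → ℝ) : Prop :=
  Filter.Tendsto (fun k : ℕ => m k ^ ((1 : ℝ) / (k : ℝ))) atTop atTop

/-- `h_m(t) = inf_k m_k t^k` for `t > 0`, and `0` for `t ≤ 0`. -/
def hfn (m : ℕ → ℝ) (t : ℝ) : ℝ := if t ≤ 0 then 0 else ⨅ k : ℕ, m k * t ^ k

/-- `Γ̄_m(t) = min {k | h_m(t) = m_k t^k}`. -/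
def GammaUpper (m : ℕ → ℝ) (t : ℝ) : ℕ := sInf {k : ℕ | hfn m t = m k * t ^ k}

/-- `Γ̲_m(t) = min {k | m_{k+1}/m_k ≥ 1/t}`. -/
def GammaLower (m : ℕ → ℝ) (t : ℝ) : ℕ := sInf {k : ℕ | 1 / t ≤ m (k + 1) / m k}

/-- `mg(M,N) = sup_{j+k ≥ 1} (M_{j+k}/(N_j N_k))^{1/(j+k)}`, as an extended real. -/
def mg (M N : ℕ → ℝ) : ℝ≥0∞ :=
  ⨆ (j : ℕ) (k : ℕ) (_ : 1 ≤ j + k),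
    ENNReal.ofReal ((M (j + k) / (N j * N k)) ^ (((j : ℝ) + (k : ℝ))⁻¹))

/-- A weight matrix: a totally ordered (pointwise) family of weight sequences. -/
structure IsWeightMatrix (W : Set (ℕ → ℝ)) : Prop where
  weight : ∀ M ∈ W, IsWeightSeq M
  ordered : ∀ M ∈ W, ∀ N ∈ W, (∀ k, M k ≤ N k) ∨ (∀ k, N k ≤ M k)

/-- R-admissible weight matrix. -/
structure RAdmissible (W : Set (ℕ → ℝ)) : Prop where
  matrix : IsWeightMatrix W
  roots : ∀ M ∈ W, RootsTendsto (lc M)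
  gamma : ∀ M ∈ W, ∃ N ∈ W, ∃ C : ℝ, 1 ≤ C ∧
    ∀ t : ℝ, 0 < t → GammaUpper (lc N) (C * t) ≤ GammaLower (lc M) t
  mgrowth : ∀ M ∈ W, ∃ N ∈ W, mg M N < ⊤

/-- B-admissible weight matrix. -/
structure BAdmissible (W : Set (ℕ → ℝ)) : Prop where
  matrix : IsWeightMatrix W
  roots : ∀ M ∈ W, RootsTendsto (lc M)
  gamma : ∀ M ∈ W, ∃ N ∈ W, ∃ C : ℝ, 1 ≤ C ∧
    ∀ t : ℝ, 0 < t → GammaUpper (lc M) (C * t) ≤ GammaLower (lc N) t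
  mgrowth : ∀ M ∈ W, ∃ N ∈ W, mg N M < ⊤

/-- `‖f‖^M_{K,ρ} < ∞` (derivatives taken within `U`). -/
def SeqBoundedOn {E F : Type*} [NormedAddCommGroup E] [NormedSpace ℝ E]
    [NormedAddCommGroup F] [NormedSpace ℝ F]
    (M : ℕ → ℝ) (ρ : ℝ) (f : E → F) (U K : Set E) : Prop :=
  ∃ C : ℝ, ∀ x ∈ K, ∀ k : ℕ, ‖iteratedFDerivWithin ℝ k f U x‖ ≤ C * ρ ^ k * M k

/-- `f ∈ B^M_ρ(V)`: smooth on `V` with global bounds `‖f‖^M_{V,ρ} < ∞`. -/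
def GlobalClass {E F : Type*} [NormedAddCommGroup E] [NormedSpace ℝ E]
    [NormedAddCommGroup F] [NormedSpace ℝ F]
    (M : ℕ → ℝ) (ρ : ℝ) (f : E → F) (V : Set E) : Prop :=
  ContDiffOn ℝ (⊤ : ℕ∞) f V ∧ SeqBoundedOn M ρ f V V

/-- The Roumieu class `E^{{W}}(U)`. -/
def Roumieu {E F : Type*} [NormedAddCommGroup E] [NormedSpace ℝ E]
    [NormedAddCommGroup F] [NormedSpace ℝ F]
    (W : Set (ℕ → ℝ)) (U : Set E) (f : E → F) : Prop :=
  ContDiffOn ℝ (⊤ : ℕ∞) f U ∧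
    ∀ K ⊆ U, IsCompact K → ∃ M ∈ W, ∃ ρ : ℝ, 0 < ρ ∧ SeqBoundedOn M ρ f U K

/-- The Beurling class `E^{(W)}(U)`. -/
def Beurling {E F : Type*} [NormedAddCommGroup E] [NormedSpace ℝ E]
    [NormedAddCommGroup F] [NormedSpace ℝ F]
    (W : Set (ℕ → ℝ)) (U : Set E) (f : E → F) : Prop :=
  ContDiffOn ℝ (⊤ : ℕ∞) f U ∧
    ∀ K ⊆ U, IsCompact K → ∀ M ∈ W, ∀ ρ : ℝ, 0 < ρ → SeqBoundedOn M ρ f U K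

/-- The open ellipse `Ω_ε` with vertices `±cosh ε` and co-vertices `±i sinh ε`. -/
def Omega (ε : ℝ) : Set ℂ :=
  {z : ℂ | (z.re / Real.cosh ε) ^ 2 + (z.im / Real.sinh ε) ^ 2 < 1}

/-- `V_U = ⋃_{x ∈ U} (x + 𝔹)`. -/
def VU {E : Type*} [NormedAddCommGroup E] [NormedSpace ℝ E] (U : Set E) : Set E :=
  ⋃ x ∈ U, Metric.closedBall x 1

/-- A weight function in the sense of Braun–Meise–Taylor. -/
structure IsWeightFunction (ω : ℝ → ℝ) : Prop where
  cont : ContinuousOn ω (Ici 0)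
  mono : MonotoneOn ω (Ici 0)
  nonneg : ∀ t, 0 ≤ t → 0 ≤ ω t
  bigO : (fun t => ω (2 * t)) =O[atTop] ω
  littleO : ω =o[atTop] (fun t => t)
  logLittleO : Real.log =o[atTop] ω
  convex : ConvexOn ℝ (Ici 0) (fun t => ω (Real.exp t))

/-- The Young conjugate `φ*_ω(s) = sup_{t ≥ 0} (s t - ω(e^t))`. -/
def youngConj (ω : ℝ → ℝ) (s : ℝ) : ℝ :=
  sSup {y : ℝ | ∃ t : ℝ, 0 ≤ t ∧ y = s * t - ω (Real.exp t)}

/-- The Roumieu class `E^{{ω}}(U)` for a weight function `ω`. -/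
def RoumieuW {E F : Type*} [NormedAddCommGroup E] [NormedSpace ℝ E]
    [NormedAddCommGroup F] [NormedSpace ℝ F]
    (ω : ℝ → ℝ) (U : Set E) (f : E → F) : Prop :=
  ContDiffOn ℝ (⊤ : ℕ∞) f U ∧
    ∀ K ⊆ U, IsCompact K → ∃ C : ℝ, 0 < C ∧ ∃ ρ : ℝ, 0 < ρ ∧
      ∀ x ∈ K, ∀ k : ℕ, ‖iteratedFDerivWithin ℝ k f U x‖ ≤
        C * Real.exp ((1 / ρ) * youngConj ω (ρ * k))

/-- The Beurling class `E^{(ω)}(U)` for a weight function `ω`. -/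
def BeurlingW {E F : Type*} [NormedAddCommGroup E] [NormedSpace ℝ E]
    [NormedAddCommGroup F] [NormedSpace ℝ F]
    (ω : ℝ → ℝ) (U : Set E) (f : E → F) : Prop :=
  ContDiffOn ℝ (⊤ : ℕ∞) f U ∧
    ∀ K ⊆ U, IsCompact K → ∀ ρ : ℝ, 0 < ρ → ∃ C : ℝ, 0 < C ∧
      ∀ x ∈ K, ∀ k : ℕ, ‖iteratedFDerivWithin ℝ k f U x‖ ≤
        C * Real.exp ((1 / ρ) * youngConj ω (ρ * k))

section TwoConstants

lemma two_constants_upper {u : ℂ → ℂ} {R ξ : ℝ} (hR : 0 < R)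
    (hu : DifferentiableOn ℂ u (ball 0 R)) (hξ : 0 < ξ) (hξ1 : ξ ≤ 1)
    (hb : ∀ z ∈ ball (0 : ℂ) R, ‖u z‖ ≤ 1)
    (hr : ∀ s : ℝ, |s| < R → ‖u s‖ ≤ ξ ^ 4) {z : ℂ} (hz : ‖z‖ ≤ R / 4) (hz0 : 0 < z.im) :
    ‖u z‖ ≤ ξ := by
  set r : ℝ := 4 * R / 5 with hrdef
  have hr0 : 0 < r := by positivity
  have hrR : r < R := by rw [hrdef]; linarith
  set L : ℝ := -4 * Real.log ξ with hL
  have hL0 : 0 ≤ L := by have := Real.log_nonpos hξ.le hξ1; rw [hL]; linarith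
  set e : ℂ → ℂ := fun w => (L : ℂ) * (1 - (w / r) ^ 2 + 2 * Complex.I * (w / r)) with he
  have here : ∀ w : ℂ, (e w).re = L * (1 - (w.re / r) ^ 2 + (w.im / r) ^ 2 - 2 * (w.im / r)) := by
    intro w
    have h1 : (w / r : ℂ).re = w.re / r := by simp
    have h2 : (w / r : ℂ).im = w.im / r := by simp
    rw [he, Complex.re_ofReal_mul]
    simp only [pow_two, Complex.add_re, Complex.sub_re, Complex.one_re,
      Complex.mul_re, h1, h2, Complex.I_re, Complex.I_im, Complex.mul_im, Complex.re_ofNat, Complex.im_ofNat]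
    ring
  set U : Set ℂ := {w | ‖w‖ < r} ∩ {w | 0 < w.im} with hU
  have hUo : IsOpen U := (isOpen_lt continuous_norm continuous_const).inter
    (isOpen_lt continuous_const Complex.continuous_im)
  have hUb : Bornology.IsBounded U := (isBounded_ball (x := (0 : ℂ)) (r := r)).subset (by
    rintro w ⟨hw, -⟩; simpa using hw)
  have hcl : closure U ⊆ {w | ‖w‖ ≤ r} ∩ {w | 0 ≤ w.im} :=
    closure_minimal (fun w hw => ⟨(show ‖w‖ < r from hw.1).le, (show 0 < w.im from hw.2).le⟩)
      ((isClosed_le continuous_norm continuous_const).inter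
        (isClosed_le continuous_const Complex.continuous_im))
  have hclb : closure U ⊆ ball 0 R := fun w hw => by
    have := (hcl hw).1
    simp only [mem_ofPred_eq] at this
    simpa using lt_of_le_of_lt this hrR
  have hed : Differentiable ℂ e := by
    simp only [he]; fun_prop
  have hd : DiffContOnCl ℂ (fun w => u w * Complex.exp (e w)) U := by
    have : DifferentiableOn ℂ (fun w => u w * Complex.exp (e w)) (ball 0 R) :=
      hu.mul (hed.cexp.differentiableOn)
    exact (this.mono hclb).diffContOnCl
  have hfr : ∀ w ∈ frontier U, ‖u w * Complex.exp (e w)‖ ≤ 1 := by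
    intro w hw
    rw [hUo.frontier_eq] at hw
    obtain ⟨hw1, hw2⟩ := hw
    have hwb : ‖u w‖ ≤ 1 := hb w (hclb hw1)
    have h1 : ‖w‖ ≤ r := (hcl hw1).1
    have h2 : 0 ≤ w.im := (hcl hw1).2
    rw [norm_mul, Complex.norm_exp, here]
    by_cases hi : w.im = 0
    · have hww : w = (w.re : ℂ) := by apply Complex.ext <;> simp [hi]
      have hu4 : ‖u w‖ ≤ ξ ^ 4 := by
        rw [hww]; apply hr
        have := Complex.abs_re_le_norm w
        linarith
      have : Real.exp (L * (1 - (w.re / r) ^ 2 + (w.im / r) ^ 2 - 2 * (w.im / r))) ≤ (ξ ^ 4)⁻¹ := by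
        rw [hi]
        calc _ ≤ Real.exp L := by
              apply Real.exp_le_exp.mpr
              have := sq_nonneg (w.re / r)
              simp only [zero_div]
              nlinarith
          _ = (ξ ^ 4)⁻¹ := by
              rw [hL, show -4 * Real.log ξ = -(4 * Real.log ξ) by ring, Real.exp_neg,
                show (4 : ℝ) * Real.log ξ = ((4 : ℕ) : ℝ) * Real.log ξ by norm_num, Real.exp_nat_mul,
                Real.exp_log hξ]
      calc _ ≤ ξ ^ 4 * (ξ ^ 4)⁻¹ := by gcongr
        _ = 1 := mul_inv_cancel₀ (by positivity)
    · have hi' : 0 < w.im := lt_of_le_of_ne h2 (Ne.symm hi)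
      have hwr : ‖w‖ = r := by
        by_contra hne
        exact hw2 ⟨lt_of_le_of_ne h1 hne, hi'⟩
      have hsq : (w.re / r) ^ 2 + (w.im / r) ^ 2 = 1 := by
        have : w.re ^ 2 + w.im ^ 2 = r ^ 2 := by
          rw [← hwr, Complex.sq_norm, Complex.normSq_apply]; ring
        field_simp; linarith
      have hy0 : 0 ≤ w.im / r := by positivity
      have hy1 : w.im / r ≤ 1 := by nlinarith [sq_nonneg (w.re / r)]
      have : Real.exp (L * (1 - (w.re / r) ^ 2 + (w.im / r) ^ 2 - 2 * (w.im / r))) ≤ 1 := by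
        apply Real.exp_le_one_iff.mpr
        apply mul_nonpos_of_nonneg_of_nonpos hL0
        nlinarith
      exact mul_le_one₀ hwb (Real.exp_pos _).le this
  have hzU : z ∈ U := ⟨by simp only [mem_ofPred_eq]; rw [hrdef]; linarith, hz0⟩
  have key := Complex.norm_le_of_forall_mem_frontier_norm_le hUb hd hfr (subset_closure hzU)
  rw [norm_mul, Complex.norm_exp, here] at key
  have hw : 1 / 4 ≤ 1 - (z.re / r) ^ 2 + (z.im / r) ^ 2 - 2 * (z.im / r) := by
    have h1 : |z.re| ≤ R / 4 := (Complex.abs_re_le_norm z).trans hz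
    have h2 : z.im ≤ R / 4 := ((le_abs_self _).trans (Complex.abs_im_le_norm z)).trans hz
    have h3 : |z.re / r| ≤ 5 / 16 := by
      rw [abs_div, abs_of_pos hr0, div_le_iff₀ hr0, hrdef]; linarith
    have h4 : z.im / r ≤ 5 / 16 := by
      rw [div_le_iff₀ hr0, hrdef]; linarith
    have h5 : (z.re / r) ^ 2 ≤ (5 / 16) ^ 2 := sq_le_sq' (by linarith [neg_abs_le (z.re / r)])
      (by linarith [le_abs_self (z.re / r)])
    nlinarith [sq_nonneg (z.im / r)]
  have hexp : ξ⁻¹ ≤ Real.exp (L * (1 - (z.re / r) ^ 2 + (z.im / r) ^ 2 - 2 * (z.im / r))) := by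
    calc ξ⁻¹ = Real.exp (L * (1 / 4)) := by
          rw [hL, show -4 * Real.log ξ * (1 / 4) = -Real.log ξ by ring, Real.exp_neg, Real.exp_log hξ]
      _ ≤ _ := by gcongr
  have : ‖u z‖ * ξ⁻¹ ≤ 1 := le_trans (by gcongr) key
  rwa [← div_eq_mul_inv, div_le_one hξ] at this

/-- A two-constants theorem: a bounded holomorphic function on a disc that is small on the real
diameter is small on a smaller concentric disc. -/
lemma two_constants {u : ℂ → ℂ} {R ξ : ℝ} (hR : 0 < R)
    (hu : DifferentiableOn ℂ u (ball 0 R)) (hξ : 0 < ξ) (hξ1 : ξ ≤ 1)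
    (hb : ∀ z ∈ ball (0 : ℂ) R, ‖u z‖ ≤ 1)
    (hr : ∀ s : ℝ, |s| < R → ‖u s‖ ≤ ξ ^ 4) {z : ℂ} (hz : ‖z‖ ≤ R / 4) :
    ‖u z‖ ≤ ξ := by
  rcases lt_trichotomy z.im 0 with h | h | h
  · have := two_constants_upper (u := fun w => u (-w)) (z := -z) hR
      (hu.comp differentiable_neg.differentiableOn (fun w hw => by simpa using hw)) hξ hξ1
      (fun w hw => hb _ (by simpa using hw)) (fun s hs => by
        have := hr (-s) (by simpa using hs)
        simpa using this) (by simpa using hz) (by simpa using h)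
    simpa using this
  · have hww : z = (z.re : ℂ) := by apply Complex.ext <;> simp [h]
    rw [hww]
    calc _ ≤ ξ ^ 4 := hr _ (by have := Complex.abs_re_le_norm z; linarith)
      _ ≤ ξ := pow_le_of_le_one hξ.le hξ1 (by norm_num)
  · exact two_constants_upper hR hu hξ hξ1 hb hr hz h

end TwoConstants

section CauchyTransform

open MeasureTheory

/-- The Wirtinger derivative `∂v/∂z̄`. -/
def dbar (v : ℂ → ℂ) (w : ℂ) : ℂ := (fderiv ℝ v w 1 + Complex.I * fderiv ℝ v w Complex.I) / 2

lemma real_clm_apply (L : ℂ →L[ℝ] ℂ) (z : ℂ) : L z = z.re * L 1 + z.im * L Complex.I := by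
  conv_lhs => rw [← Complex.re_add_im z]
  rw [map_add, show (z.re : ℂ) = z.re • (1 : ℂ) by simp,
    show (z.im : ℂ) * Complex.I = z.im • Complex.I by simp, map_smul, map_smul]
  simp

lemma wirtinger_rotate (L : ℂ →L[ℝ] ℂ) (γ : ℂ) (hγ : ‖γ‖ = 1) :
    (L 1 + Complex.I * L Complex.I) / γ = L γ + Complex.I * L (Complex.I * γ) := by
  have h0 : γ ≠ 0 := by intro h; simp [h] at hγ
  have h1 : (γ.re : ℂ) ^ 2 + (γ.im : ℂ) ^ 2 = 1 := by
    have : γ.re ^ 2 + γ.im ^ 2 = 1 := by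
      have := Complex.sq_norm γ
      rw [hγ, Complex.normSq_apply] at this
      nlinarith
    exact_mod_cast this
  rw [div_eq_iff h0, real_clm_apply L γ, real_clm_apply L (Complex.I * γ)]
  simp only [Complex.mul_re, Complex.mul_im, Complex.I_re, Complex.I_im, zero_mul, zero_sub, one_mul,
    zero_add, Complex.ofReal_neg]
  conv_rhs => rw [← Complex.re_add_im γ]
  simp only [Complex.add_re, Complex.add_im, Complex.ofReal_re, Complex.ofReal_im, Complex.mul_re,
    Complex.mul_im, Complex.I_re, Complex.I_im, mul_zero, mul_one, add_zero, zero_add, sub_self]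
  linear_combination (-(L 1) - Complex.I * L Complex.I) * h1 +
    ((γ.im : ℂ) ^ 2 * L 1 - (γ.re : ℂ) * γ.im * L Complex.I) * Complex.I_sq

lemma cauchy_pompeiu_zero {v : ℂ → ℂ} (hv : ContDiff ℝ 1 v) (hc : HasCompactSupport v) :
    ∫ w, dbar v w / w = -Real.pi * v 0 := by
  set γ : ℝ → ℂ := fun θ => Complex.exp (θ * Complex.I) with hγ
  have hγd : ∀ θ, HasDerivAt γ (Complex.I * γ θ) θ := by
    intro θ
    have h1 : HasDerivAt (fun x : ℝ => (x : ℂ) * Complex.I) Complex.I θ := by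
      simpa using (Complex.ofRealCLM.hasDerivAt (x := θ)).mul_const Complex.I
    simpa [hγ, mul_comm] using h1.cexp
  have hγc : Continuous γ := by fun_prop
  have hγn : ∀ θ, ‖γ θ‖ = 1 := fun θ => Complex.norm_exp_ofReal_mul_I θ
  obtain ⟨R, hR0, hR⟩ : ∃ R > 0, ∀ w : ℂ, R < ‖w‖ → v w = 0 := by
    obtain ⟨R, hR0, hR⟩ := hc.isBounded.subset_ball_lt 0 0
    refine ⟨R, hR0, fun w hw => ?_⟩
    by_contra h
    have := hR (subset_tsupport v h)
    simp at this; linarith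
  have hRf : ∀ w : ℂ, R < ‖w‖ → fderiv ℝ v w = 0 := by
    intro w hw
    have : v =ᶠ[𝓝 w] fun _ => 0 := by
      filter_upwards [(isOpen_lt continuous_const continuous_norm).mem_nhds hw] with y hy
      exact hR y hy
    rw [this.fderiv_eq]; simp
  have hfc : Continuous (fderiv ℝ v) := hv.continuous_fderiv (by norm_num)
  have hvd : Differentiable ℝ v := hv.differentiable (by norm_num)
  set A : ℝ × ℝ → ℂ := fun p => fderiv ℝ v (p.1 * γ p.2) (γ p.2) with hA
  set B : ℝ × ℝ → ℂ := fun p => fderiv ℝ v (p.1 * γ p.2) (Complex.I * γ p.2) with hB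
  have hwc : Continuous fun p : ℝ × ℝ => (p.1 : ℂ) * γ p.2 := by fun_prop
  have hAc : Continuous A := (hfc.comp hwc).clm_apply (by fun_prop)
  have hBc : Continuous B := (hfc.comp hwc).clm_apply (by fun_prop)
  have hsupp : ∀ p : ℝ × ℝ, R < |p.1| → fderiv ℝ v (p.1 * γ p.2) = 0 := by
    intro p hp
    apply hRf
    rw [norm_mul, hγn, mul_one]; simpa using hp
  have hInt : ∀ g : ℝ × ℝ → ℂ, Continuous g → (∀ p : ℝ × ℝ, R < |p.1| → g p = 0) →
      IntegrableOn g (Ioi (0 : ℝ) ×ˢ Ioo (-Real.pi) Real.pi) := by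
    intro g hg h0
    have h1 : IntegrableOn g (Icc (-R) R ×ˢ Icc (-Real.pi) Real.pi) :=
      hg.continuousOn.integrableOn_compact (isCompact_Icc.prod isCompact_Icc)
    refine h1.of_forall_sdiff_eq_zero (measurableSet_Ioi.prod measurableSet_Ioo) ?_
    rintro ⟨r, θ⟩ ⟨⟨hr, hθ⟩, h2⟩
    apply h0
    by_contra h3
    push Not at h3
    exact h2 ⟨abs_le.mp h3, Ioo_subset_Icc_self hθ⟩
  have hAi := hInt A hAc (fun p hp => by simp [hA, hsupp p hp])
  have hBi := hInt B hBc (fun p hp => by simp [hB, hsupp p hp])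
  have hAint : ∫ p in Ioi (0 : ℝ) ×ˢ Ioo (-Real.pi) Real.pi, A p = -(2 * Real.pi) * v 0 := by
    rw [Measure.volume_eq_prod, ← Measure.prod_restrict, integral_prod_symm]
    · have : ∀ θ, ∫ r in Ioi (0 : ℝ), A (r, θ) = - v 0 := by
        intro θ
        have hd : ∀ r : ℝ, HasDerivAt (fun r : ℝ => v (r * γ θ)) (A (r, θ)) r := by
          intro r
          have h1 : HasDerivAt (fun r : ℝ => (r : ℂ) * γ θ) (γ θ) r := by
            simpa using (Complex.ofRealCLM.hasDerivAt (x := r)).mul_const (γ θ)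
          exact (hvd _).hasFDerivAt.comp_hasDerivAt r h1
        have hcs : HasCompactSupport (fun r : ℝ => v (r * γ θ)) := by
          refine HasCompactSupport.intro (isCompact_Icc (a := -R) (b := R)) ?_
          intro r hr
          apply hR
          rw [norm_mul, hγn, mul_one]
          by_contra h3
          push Not at h3
          exact hr (abs_le.mp (by simpa using h3))
        have h2 := HasCompactSupport.integral_Ioi_deriv_eq
          (f := fun r : ℝ => v (r * γ θ)) (hv.comp
          (Complex.ofRealCLM.contDiff.mul contDiff_const)) hcs 0
        rw [← integral_congr_ae (Eventually.of_forall fun r => (hd r).deriv)]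
        simpa using h2
      simp_rw [this]
      rw [integral_const, measureReal_restrict_apply_univ, Real.volume_real_Ioo_of_le (by linarith [Real.pi_pos]),
        Complex.real_smul]
      push_cast
      ring
    · rw [Measure.prod_restrict, ← Measure.volume_eq_prod]; exact hAi
  have hBint : ∫ p in Ioi (0 : ℝ) ×ˢ Ioo (-Real.pi) Real.pi, B p = 0 := by
    rw [Measure.volume_eq_prod, setIntegral_prod _ (by rw [← Measure.volume_eq_prod]; exact hBi)]
    apply setIntegral_eq_zero_of_forall_eq_zero
    intro r hr
    have hr0 : (r : ℂ) ≠ 0 := by exact_mod_cast (ne_of_gt hr)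
    have hd : ∀ θ : ℝ, HasDerivAt (fun θ : ℝ => v (r * γ θ)) (r * B (r, θ)) θ := by
      intro θ
      have h1 : HasDerivAt (fun θ : ℝ => (r : ℂ) * γ θ) (r * (Complex.I * γ θ)) θ :=
        (hγd θ).const_mul (r : ℂ)
      have h2 := (hvd _).hasFDerivAt.comp_hasDerivAt θ h1
      have h3 : (fderiv ℝ v (r * γ θ)) (r * (Complex.I * γ θ)) = r * B (r, θ) := by
        have := map_smul (fderiv ℝ v (r * γ θ)) r (Complex.I * γ θ)
        simpa [hB] using this
      rw [h3] at h2; exact h2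
    have h4 := intervalIntegral.integral_eq_sub_of_hasDerivAt (a := -Real.pi) (b := Real.pi)
      (fun θ _ => hd θ) ((by fun_prop : Continuous fun θ : ℝ => (r : ℂ) * B (r, θ)).intervalIntegrable _ _)
    have h5 : γ Real.pi = γ (-Real.pi) := by
      simp [hγ, Complex.exp_neg]
    rw [h5, sub_self, intervalIntegral.integral_const_mul, mul_eq_zero] at h4
    have h6 := h4.resolve_left hr0
    rwa [intervalIntegral.integral_of_le (by linarith [Real.pi_pos]), integral_Ioc_eq_integral_Ioo] at h6
  rw [← Complex.integral_comp_polarCoord_symm]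
  have : ∀ p ∈ polarCoord.target, p.1 • (dbar v (Complex.polarCoord.symm p) / Complex.polarCoord.symm p)
      = (A p + Complex.I * B p) / 2 := by
    intro p hp
    have hp0 : 0 < p.1 := hp.1
    have hp0' : (p.1 : ℂ) ≠ 0 := by exact_mod_cast hp0.ne'
    have e1 : Complex.polarCoord.symm p = p.1 * γ p.2 := by
      rw [Complex.polarCoord_symm_apply, hγ]
      simp [Complex.exp_mul_I]
    rw [e1, dbar]
    have := wirtinger_rotate (fderiv ℝ v (p.1 * γ p.2)) (γ p.2) (hγn _)
    rw [hA, hB]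
    simp only
    rw [← this, Complex.real_smul]
    have : γ p.2 ≠ 0 := Complex.exp_ne_zero _
    field_simp
  rw [setIntegral_congr_fun (by exact measurableSet_Ioi.prod measurableSet_Ioo) this, polarCoord_target]
  rw [integral_div, integral_add hAi (hBi.const_mul _), integral_const_mul, hAint, hBint]
  ring

lemma fderiv_translate (v : ℂ → ℂ) (z w : ℂ) :
    fderiv ℝ (fun w => v (w + z)) w = fderiv ℝ v (w + z) := by
  rw [fderiv_comp_add_right]

/-- The Cauchy–Pompeiu formula for compactly supported functions. -/
lemma cauchy_pompeiu {v : ℂ → ℂ} (hv : ContDiff ℝ 1 v) (hc : HasCompactSupport v) (z : ℂ) :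
    ∫ w, dbar v w / (w - z) = -Real.pi * v z := by
  have h := cauchy_pompeiu_zero (v := fun w => v (w + z)) (hv.comp (by fun_prop))
    (hc.comp_homeomorph (Homeomorph.addRight z))
  rw [← integral_add_right_eq_self _ z]
  simpa [dbar, fderiv_translate] using h

/-- The integral of a derivative of a compactly supported function vanishes. -/
lemma integral_fderiv_apply_eq_zero {𝕜 : Type*} [RCLike 𝕜] {v : ℂ → 𝕜} (hv : ContDiff ℝ 1 v)
    (hc : HasCompactSupport v) (e : ℂ) : ∫ w, fderiv ℝ v w e = 0 := by
  have hfc : Continuous (fun w => fderiv ℝ v w e) :=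
    (hv.continuous_fderiv (by norm_num)).clm_apply continuous_const
  have hfs : HasCompactSupport (fun w => fderiv ℝ v w e) := hc.fderiv_apply (𝕜 := ℝ) e
  have := integral_mul_fderiv_eq_neg_fderiv_mul_of_integrable (μ := volume) (f := fun _ : ℂ => (1 : 𝕜))
    (g := v) (v := e) (by simp)
    (by simpa using hfc.integrable_of_hasCompactSupport hfs)
    (by simpa using hv.continuous.integrable_of_hasCompactSupport hc)
    (fun x _ => by fun_prop) (fun x _ => hv.differentiable (by norm_num) x)
  simpa using this

/-- A smooth cutoff times a function that is smooth near the support of the cutoff is smooth. -/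
lemma contDiff_mul_of_tsupport {𝕜 : Type*} [RCLike 𝕜] {n : WithTop ℕ∞} {χ g : ℂ → 𝕜} {U : Set ℂ}
    (hU : IsOpen U) (hχ : ContDiff ℝ n χ) (hg : ContDiffOn ℝ n g U) (hs : tsupport χ ⊆ U) :
    ContDiff ℝ n (fun w => χ w * g w) := by
  rw [contDiff_iff_contDiffAt]
  intro w
  by_cases hw : w ∈ tsupport χ
  · exact hχ.contDiffAt.mul (hg.contDiffAt (hU.mem_nhds (hs hw)))
  · have : (fun w => χ w * g w) =ᶠ[𝓝 w] fun _ => 0 := by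
      filter_upwards [notMem_tsupport_iff_eventuallyEq.mp hw] with y hy
      simp [hy]
    exact contDiffAt_const.congr_of_eventuallyEq this

end CauchyTransform

section AreaBounds

open MeasureTheory

lemma fderiv_mul_of_tsupport {𝕜 : Type*} [RCLike 𝕜] {χ g : ℂ → 𝕜} {U : Set ℂ}
    (hU : IsOpen U) (hχ : Differentiable ℝ χ) (hg : DifferentiableOn ℝ g U) (hs : tsupport χ ⊆ U)
    (w e : ℂ) : fderiv ℝ (fun w => χ w * g w) w e = χ w * fderiv ℝ g w e + fderiv ℝ χ w e * g w := by
  by_cases hw : w ∈ tsupport χ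
  · rw [fderiv_fun_mul (hχ w) (hg.differentiableAt (hU.mem_nhds (hs hw)))]
    simp [mul_comm]
  · have h0 := notMem_tsupport_iff_eventuallyEq.mp hw
    have : (fun w => χ w * g w) =ᶠ[𝓝 w] fun _ => 0 := by
      filter_upwards [h0] with y hy
      simp [hy]
    rw [this.fderiv_eq, h0.fderiv_eq, h0.self_of_nhds]
    simp

/-- Integrating by parts twice against a cutoff function. -/
lemma integral_mul_fderiv_fderiv {χ P : ℂ → ℝ} {U : Set ℂ} (hU : IsOpen U)
    (hχ : ContDiff ℝ 2 χ) (hc : HasCompactSupport χ) (hs : tsupport χ ⊆ U)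
    (hP : ContDiffOn ℝ 2 P U) (e : ℂ) :
    Integrable (fun w => χ w * fderiv ℝ (fun w => fderiv ℝ P w e) w e) ∧
    ∫ w, χ w * fderiv ℝ (fun w => fderiv ℝ P w e) w e =
      ∫ w, P w * fderiv ℝ (fun w => fderiv ℝ χ w e) w e := by
  have hχ1 : ContDiff ℝ 1 χ := hχ.of_le (by norm_num)
  have hχ' : ContDiff ℝ 1 (fun w => fderiv ℝ χ w e) :=
    (hχ.fderiv_right (m := 1) (by norm_num)).clm_apply contDiff_const
  have hP1 : ContDiffOn ℝ 1 P U := hP.of_le (by norm_num)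
  have hP' : ContDiffOn ℝ 1 (fun w => fderiv ℝ P w e) U :=
    (hP.fderiv_of_isOpen (m := 1) hU (by norm_num)).clm_apply contDiffOn_const
  have hP'' : ContDiffOn ℝ 0 (fun w => fderiv ℝ (fun w => fderiv ℝ P w e) w e) U :=
    (hP'.fderiv_of_isOpen (m := 0) hU (by norm_num)).clm_apply contDiffOn_const
  have hs' : tsupport (fun w => fderiv ℝ χ w e) ⊆ U :=
    (tsupport_fderiv_apply_subset ℝ e).trans hs
  have hs'' : tsupport (fun w => fderiv ℝ (fun w => fderiv ℝ χ w e) w e) ⊆ U :=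
    (tsupport_fderiv_apply_subset ℝ e).trans hs'
  have hc' : HasCompactSupport (fun w => fderiv ℝ χ w e) := hc.fderiv_apply (𝕜 := ℝ) e
  have hc'' : HasCompactSupport (fun w => fderiv ℝ (fun w => fderiv ℝ χ w e) w e) :=
    hc'.fderiv_apply (𝕜 := ℝ) e
  have hχ'' : ContDiff ℝ 0 (fun w => fderiv ℝ (fun w => fderiv ℝ χ w e) w e) :=
    (hχ'.fderiv_right (m := 0) (by norm_num)).clm_apply contDiff_const
  have i1 := integral_fderiv_apply_eq_zero (contDiff_mul_of_tsupport hU hχ1 hP' hs) hc.mul_right e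
  have i2 := integral_fderiv_apply_eq_zero (contDiff_mul_of_tsupport hU hχ' hP1 hs') hc'.mul_right e
  simp_rw [fderiv_mul_of_tsupport hU (hχ1.differentiable (by norm_num))
    (hP'.differentiableOn (by norm_num)) hs] at i1
  simp_rw [fderiv_mul_of_tsupport hU (hχ'.differentiable (by norm_num))
    (hP1.differentiableOn (by norm_num)) hs'] at i2
  have I1 : Integrable (fun w => χ w * fderiv ℝ (fun w => fderiv ℝ P w e) w e) :=
    (contDiff_mul_of_tsupport hU (hχ.of_le (by norm_num)) hP'' hs).continuous.integrable_of_hasCompactSupport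
      hc.mul_right
  have I2 : Integrable (fun w => fderiv ℝ χ w e * fderiv ℝ P w e) :=
    (contDiff_mul_of_tsupport hU hχ' hP' hs').continuous.integrable_of_hasCompactSupport hc'.mul_right
  have I3 : Integrable (fun w => fderiv ℝ (fun w => fderiv ℝ χ w e) w e * P w) :=
    (contDiff_mul_of_tsupport hU hχ'' (hP.of_le (by norm_num)) hs'').continuous.integrable_of_hasCompactSupport
      hc''.mul_right
  rw [integral_add I1 I2] at i1
  rw [integral_add I2 I3] at i2
  refine ⟨I1, ?_⟩
  simp_rw [mul_comm (P _)]
  linarith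

lemma fderiv_apply_of_hasDerivAt {F : Type*} [NormedAddCommGroup F] [NormedSpace ℝ F]
    {P : ℂ → F} {w e : ℂ} {y : F} (hd : DifferentiableAt ℝ P w)
    (h : HasDerivAt (fun t : ℝ => P (w + t * e)) y 0) : fderiv ℝ P w e = y := by
  rw [← hd.lineDeriv_eq_fderiv, lineDeriv]
  simpa using h.deriv

lemma hasDerivAt_line {G : ℂ → ℂ} {w : ℂ} (hd : DifferentiableAt ℂ G w) (e : ℂ) :
    HasDerivAt (fun t : ℝ => G (w + t * e)) (deriv G w * e) 0 := by
  have h1 : HasDerivAt (fun t : ℝ => w + (t : ℂ) * e) e 0 := by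
    simpa using ((Complex.ofRealCLM.hasDerivAt (x := 0)).mul_const e).const_add w
  have h2 : HasDerivAt G (deriv G w) (w + ((0 : ℝ) : ℂ) * e) := by simpa using hd.hasDerivAt
  exact h2.comp 0 h1

lemma hasDerivAt_line_re {G : ℂ → ℂ} {w : ℂ} (hd : DifferentiableAt ℂ G w) (e : ℂ) :
    HasDerivAt (fun t : ℝ => (G (w + t * e)).re) (deriv G w * e).re 0 :=
  Complex.reCLM.hasFDerivAt.comp_hasDerivAt 0 (hasDerivAt_line hd e)

lemma hasDerivAt_line_im {G : ℂ → ℂ} {w : ℂ} (hd : DifferentiableAt ℂ G w) (e : ℂ) :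
    HasDerivAt (fun t : ℝ => (G (w + t * e)).im) (deriv G w * e).im 0 :=
  Complex.imCLM.hasFDerivAt.comp_hasDerivAt 0 (hasDerivAt_line hd e)

/-- The function `|G|² + τ²`. -/
def regSq (G : ℂ → ℂ) (τ : ℝ) (w : ℂ) : ℝ := (G w).re ^ 2 + (G w).im ^ 2 + τ ^ 2

lemma regSq_eq (G : ℂ → ℂ) (τ : ℝ) (w : ℂ) : regSq G τ w = ‖G w‖ ^ 2 + τ ^ 2 := by
  rw [Complex.sq_norm, Complex.normSq_apply, regSq]; ring

lemma regSq_pos (G : ℂ → ℂ) {τ : ℝ} (hτ : 0 < τ) (w : ℂ) : 0 < regSq G τ w := by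
  rw [regSq]; positivity

lemma contDiffOn_real_of_differentiableOn {G : ℂ → ℂ} {U : Set ℂ} (hU : IsOpen U)
    (hG : DifferentiableOn ℂ G U) {n : WithTop ℕ∞} : ContDiffOn ℝ n G U :=
  (hG.contDiffOn hU).restrict_scalars ℝ

lemma contDiffOn_regSq {G : ℂ → ℂ} {U : Set ℂ} (hU : IsOpen U)
    (hG : DifferentiableOn ℂ G U) (τ : ℝ) {n : WithTop ℕ∞} : ContDiffOn ℝ n (regSq G τ) U := by
  have h := contDiffOn_real_of_differentiableOn hU hG (n := n)
  have h1 : ContDiffOn ℝ n (fun w => (G w).re) U := Complex.reCLM.contDiff.comp_contDiffOn h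
  have h2 : ContDiffOn ℝ n (fun w => (G w).im) U := Complex.imCLM.contDiff.comp_contDiffOn h
  exact ((h1.pow 2).add (h2.pow 2)).add contDiffOn_const

lemma laplacian_log_regSq {G : ℂ → ℂ} {U : Set ℂ} (hU : IsOpen U)
    (hG : DifferentiableOn ℂ G U) {τ : ℝ} (hτ : 0 < τ) {w : ℂ} (hw : w ∈ U) :
    fderiv ℝ (fun w => fderiv ℝ (fun w => Real.log (regSq G τ w)) w 1) w 1 +
    fderiv ℝ (fun w => fderiv ℝ (fun w => Real.log (regSq G τ w)) w Complex.I) w Complex.I =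
      4 * (‖deriv G w‖ * τ / regSq G τ w) ^ 2 := by
  have hP : ContDiffOn ℝ 2 (fun w => Real.log (regSq G τ w)) U :=
    (contDiffOn_regSq hU hG τ).log (fun w _ => (regSq_pos G hτ w).ne')
  have hG' : DifferentiableOn ℂ (deriv G) U := hG.deriv hU
  have hd : ∀ y ∈ U, DifferentiableAt ℂ G y := fun y hy => hG.differentiableAt (hU.mem_nhds hy)
  have hd' : ∀ y ∈ U, DifferentiableAt ℂ (deriv G) y := fun y hy => hG'.differentiableAt (hU.mem_nhds hy)
  set p : ℂ → ℂ → ℝ := fun e y =>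
    2 * ((G y).re * (deriv G y * e).re + (G y).im * (deriv G y * e).im) / regSq G τ y with hp
  have hQ : ∀ y ∈ U, ∀ e, HasDerivAt (fun t : ℝ => regSq G τ (y + t * e))
      (2 * ((G y).re * (deriv G y * e).re + (G y).im * (deriv G y * e).im)) 0 := by
    intro y hy e
    have h := (((hasDerivAt_line_re (hd y hy) e).pow 2).add
      ((hasDerivAt_line_im (hd y hy) e).pow 2)).add_const (τ ^ 2)
    refine (h.congr_deriv ?_)
    simp; ring
  have h1 : ∀ e, ∀ y ∈ U, fderiv ℝ (fun w => Real.log (regSq G τ w)) y e = p e y := by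
    intro e y hy
    apply fderiv_apply_of_hasDerivAt
    · exact (hP.differentiableOn (by norm_num)).differentiableAt (hU.mem_nhds hy)
    · have := (hQ y hy e).log (by simpa using (regSq_pos G hτ y).ne')
      simpa [hp] using this
  have h2 : ∀ e, fderiv ℝ (fun w => fderiv ℝ (fun w => Real.log (regSq G τ w)) w e) w e =
      (2 * (((deriv G w * e).re ^ 2 + (G w).re * (deriv (deriv G) w * e * e).re) +
        ((deriv G w * e).im ^ 2 + (G w).im * (deriv (deriv G) w * e * e).im)) * regSq G τ w -
       2 * ((G w).re * (deriv G w * e).re + (G w).im * (deriv G w * e).im) *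
        (2 * ((G w).re * (deriv G w * e).re + (G w).im * (deriv G w * e).im))) / regSq G τ w ^ 2 := by
    intro e
    have hev : (fun w => fderiv ℝ (fun w => Real.log (regSq G τ w)) w e) =ᶠ[𝓝 w] p e := by
      filter_upwards [hU.mem_nhds hw] with y hy using h1 e y hy
    have hdiff : DifferentiableAt ℝ (p e) w := by
      have : ContDiffOn ℝ 1 (fun w => fderiv ℝ (fun w => Real.log (regSq G τ w)) w e) U :=
        (hP.fderiv_of_isOpen (m := 1) hU (by norm_num)).clm_apply contDiffOn_const
      exact ((this.differentiableOn (by norm_num)).differentiableAt (hU.mem_nhds hw)).congr_of_eventuallyEq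
        hev.symm
    rw [hev.fderiv_eq]
    apply fderiv_apply_of_hasDerivAt hdiff
    have hG'e : DifferentiableAt ℂ (fun y => deriv G y * e) w := (hd' w hw).mul_const e
    have hde : deriv (fun y => deriv G y * e) w = deriv (deriv G) w * e := deriv_mul_const (hd' w hw) e
    have k1 := hasDerivAt_line_re hG'e e
    have k2 := hasDerivAt_line_im hG'e e
    rw [hde] at k1 k2
    have h := ((((hasDerivAt_line_re (hd w hw) e).mul k1).add
      ((hasDerivAt_line_im (hd w hw) e).mul k2)).const_mul 2).div (hQ w hw e)
      (by simpa using (regSq_pos G hτ w).ne')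
    refine h.congr_deriv ?_
    simp
    ring
  rw [h2, h2]
  have hpos := regSq_pos G hτ w
  simp only [mul_one, Complex.mul_re, Complex.mul_im, Complex.I_re, Complex.I_im, mul_zero, zero_sub,
    add_zero]
  have hn : ‖deriv G w‖ ^ 2 = (deriv G w).re ^ 2 + (deriv G w).im ^ 2 := by
    rw [Complex.sq_norm, Complex.normSq_apply]; ring
  rw [div_pow, mul_pow, hn]
  field_simp
  rw [regSq]
  ring

lemma abs_log_regSq_le {G : ℂ → ℂ} {τ : ℝ} (hτ : 0 < τ) (hτ1 : τ ≤ 1) {w : ℂ} (hw : ‖G w‖ ≤ 1) :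
    |Real.log (regSq G τ w)| ≤ 1 + 2 * Real.log τ⁻¹ := by
  have hl : 0 ≤ Real.log τ⁻¹ := Real.log_nonneg (by rw [one_le_inv₀ hτ]; exact hτ1)
  have h1 : τ ^ 2 ≤ regSq G τ w := by rw [regSq_eq]; nlinarith [sq_nonneg ‖G w‖]
  have h2 : regSq G τ w ≤ 2 := by rw [regSq_eq]; nlinarith [norm_nonneg (G w)]
  rw [abs_le]
  constructor
  · have := Real.log_le_log (by positivity) h1
    rw [Real.log_pow] at this
    rw [Real.log_inv] at hl ⊢
    push_cast at this
    linarith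
  · have := Real.log_le_log (regSq_pos G hτ w) h2
    have h3 : Real.log 2 < 1 := by linarith [Real.log_two_lt_d9]
    linarith

/-- The spherical area covered by a bounded holomorphic function grows at most logarithmically. -/
lemma exists_integral_area_le {χ : ℂ → ℝ} (hχ : ContDiff ℝ 2 χ) (hc : HasCompactSupport χ)
    (hs : tsupport χ ⊆ ball 0 1) :
    ∃ C : ℝ, 0 ≤ C ∧ ∀ G : ℂ → ℂ, DifferentiableOn ℂ G (ball 0 1) → (∀ z ∈ ball (0 : ℂ) 1, ‖G z‖ ≤ 1) →
      ∀ τ : ℝ, 0 < τ → τ ≤ 1 →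
      Integrable (fun w => χ w * (‖deriv G w‖ * τ / regSq G τ w) ^ 2) ∧
      ∫ w, χ w * (‖deriv G w‖ * τ / regSq G τ w) ^ 2 ≤ C * (1 + 2 * Real.log τ⁻¹) := by
  set D : ℂ → ℂ → ℝ := fun e w => fderiv ℝ (fun w => fderiv ℝ χ w e) w e with hD
  have hDc : ∀ e, HasCompactSupport (D e) := fun e => (hc.fderiv_apply (𝕜 := ℝ) e).fderiv_apply (𝕜 := ℝ) e
  have hDs : ∀ e, tsupport (D e) ⊆ ball 0 1 := fun e =>
    ((tsupport_fderiv_apply_subset ℝ e).trans (tsupport_fderiv_apply_subset ℝ e)).trans hs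
  have hDcont : ∀ e, Continuous (D e) := fun e => by
    have hχ' : ContDiff ℝ 1 (fun w => fderiv ℝ χ w e) :=
      (hχ.fderiv_right (m := 1) (by norm_num)).clm_apply contDiff_const
    exact (hχ'.continuous_fderiv (by norm_num)).clm_apply continuous_const
  have hDi : ∀ e, Integrable (D e) := fun e => (hDcont e).integrable_of_hasCompactSupport (hDc e)
  refine ⟨∫ w, (|D 1 w| + |D Complex.I w|), integral_nonneg (fun w => by positivity), ?_⟩
  intro G hG hG1 τ hτ hτ1
  set P : ℂ → ℝ := fun w => Real.log (regSq G τ w) with hPdef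
  have hP : ContDiffOn ℝ 2 P (ball 0 1) :=
    (contDiffOn_regSq isOpen_ball hG τ).log (fun w _ => (regSq_pos G hτ w).ne')
  have g1 := integral_mul_fderiv_fderiv isOpen_ball hχ hc hs hP 1
  have g2 := integral_mul_fderiv_fderiv isOpen_ball hχ hc hs hP Complex.I
  have hpt : ∀ w, χ w * fderiv ℝ (fun w => fderiv ℝ P w 1) w 1 +
      χ w * fderiv ℝ (fun w => fderiv ℝ P w Complex.I) w Complex.I =
      4 * (χ w * (‖deriv G w‖ * τ / regSq G τ w) ^ 2) := by
    intro w
    by_cases hw : w ∈ tsupport χ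
    · rw [← mul_add, laplacian_log_regSq isOpen_ball hG hτ (hs hw)]; ring
    · simp [image_eq_zero_of_notMem_tsupport hw]
  have hI : Integrable (fun w => 4 * (χ w * (‖deriv G w‖ * τ / regSq G τ w) ^ 2)) := by
    simp_rw [← hpt]; exact g1.1.add g2.1
  have hI' : Integrable (fun w => (χ w * (‖deriv G w‖ * τ / regSq G τ w) ^ 2)) := by
    have := hI.const_mul (1 / 4)
    refine this.congr (Eventually.of_forall fun w => ?_)
    simp only; ring
  refine ⟨hI', ?_⟩
  have hbound : ∀ e w, ‖P w * D e w‖ ≤ |D e w| * (1 + 2 * Real.log τ⁻¹) := by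
    intro e w
    by_cases hw : w ∈ tsupport (D e)
    · rw [norm_mul, mul_comm]
      gcongr
      · exact le_rfl
      · exact abs_log_regSq_le hτ hτ1 (hG1 w (hDs e hw))
    · simp [image_eq_zero_of_notMem_tsupport hw]
  have hb : ∀ e, ∫ w, P w * D e w ≤ ∫ w, |D e w| * (1 + 2 * Real.log τ⁻¹) := fun e =>
    (le_abs_self _).trans (norm_integral_le_of_norm_le ((hDi e).abs.mul_const _)
      (Eventually.of_forall (hbound e)))
  have e1 : ∫ w, 4 * (χ w * (‖deriv G w‖ * τ / regSq G τ w) ^ 2) =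
      (∫ w, P w * D 1 w) + ∫ w, P w * D Complex.I w := by
    simp_rw [← hpt]; rw [integral_add g1.1 g2.1, g1.2, g2.2]
  rw [integral_const_mul] at e1
  rw [integral_add (hDi 1).abs (hDi Complex.I).abs]
  have b1 := hb 1
  have b2 := hb Complex.I
  rw [integral_mul_const] at b1 b2
  have hl : 0 ≤ Real.log τ⁻¹ := Real.log_nonneg (by rw [one_le_inv₀ hτ]; exact hτ1)
  have p1 : 0 ≤ ∫ w, |D 1 w| := integral_nonneg fun w => abs_nonneg _
  have p2 : 0 ≤ ∫ w, |D Complex.I w| := integral_nonneg fun w => abs_nonneg _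
  have p3 : 0 ≤ (∫ w, |D 1 w|) * (1 + 2 * Real.log τ⁻¹) := by positivity
  have p4 : 0 ≤ (∫ w, |D Complex.I w|) * (1 + 2 * Real.log τ⁻¹) := by positivity
  rw [add_mul]
  linarith

end AreaBounds

section Quotients

open MeasureTheory

lemma norm_pow_sub_pow_le (a b : ℂ) {M : ℝ} (ha : ‖a‖ ≤ M) (hb : ‖b‖ ≤ M) (n : ℕ) :
    ‖a ^ n - b ^ n‖ ≤ n * M ^ (n - 1) * ‖a - b‖ := by
  have hM : 0 ≤ M := (norm_nonneg a).trans ha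
  rw [← (Commute.all a b).geom_sum₂_mul n, norm_mul]
  gcongr
  refine (norm_sum_le _ _).trans ?_
  calc _ ≤ ∑ i ∈ Finset.range n, M ^ (n - 1) := by
        apply Finset.sum_le_sum
        intro i hi
        have : i ≤ n - 1 := by have := Finset.mem_range.mp hi; omega
        rw [norm_mul, norm_pow, norm_pow]
        calc _ ≤ M ^ i * M ^ (n - 1 - i) := by gcongr
          _ = M ^ (n - 1) := by rw [← pow_add]; congr 1; omega
    _ = _ := by simp

/-- The regularized quotient `Ḡ H / (|G|² + τ²)`. -/
def regQuot (G H : ℂ → ℂ) (τ : ℝ) (w : ℂ) : ℂ := star (G w) * H w / (regSq G τ w : ℂ)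

lemma contDiffOn_regQuot {G H : ℂ → ℂ} {U : Set ℂ} (hU : IsOpen U)
    (hG : DifferentiableOn ℂ G U) (hH : DifferentiableOn ℂ H U) {τ : ℝ} (hτ : 0 < τ)
    {n : WithTop ℕ∞} : ContDiffOn ℝ n (regQuot G H τ) U := by
  have hQ : ContDiffOn ℝ n (fun w => (regSq G τ w : ℂ)) U :=
    Complex.ofRealCLM.contDiff.comp_contDiffOn (contDiffOn_regSq hU hG τ)
  have hGc : ContDiffOn ℝ n (fun w => star (G w)) U :=
    Complex.conjCLE.contDiff.comp_contDiffOn (contDiffOn_real_of_differentiableOn hU hG)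
  have hQi : ContDiffOn ℝ n (fun w => (regSq G τ w : ℂ)⁻¹) U :=
    hQ.inv (fun w _ => by exact_mod_cast (regSq_pos G hτ w).ne')
  exact (hGc.mul (contDiffOn_real_of_differentiableOn hU hH)).mul hQi

lemma dbar_regQuot {G H : ℂ → ℂ} {U : Set ℂ} (hU : IsOpen U)
    (hG : DifferentiableOn ℂ G U) (hH : DifferentiableOn ℂ H U) {τ : ℝ} (hτ : 0 < τ)
    {w : ℂ} (hw : w ∈ U) :
    dbar (regQuot G H τ) w = star (deriv G w) * H w * τ ^ 2 / (regSq G τ w : ℂ) ^ 2 := by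
  have hGd : DifferentiableAt ℂ G w := hG.differentiableAt (hU.mem_nhds hw)
  have hHd : DifferentiableAt ℂ H w := hH.differentiableAt (hU.mem_nhds hw)
  have hS : DifferentiableAt ℝ (regQuot G H τ) w :=
    ((contDiffOn_regQuot hU hG hH hτ (n := 1)).differentiableOn (by norm_num)).differentiableAt
      (hU.mem_nhds hw)
  have hQ0 : (regSq G τ w : ℂ) ≠ 0 := by exact_mod_cast (regSq_pos G hτ w).ne'
  have hQe : ∀ y, (regSq G τ y : ℂ) = star (G y) * G y + (τ : ℂ) ^ 2 := by
    intro y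
    rw [regSq_eq]
    push_cast
    rw [← Complex.conj_mul']; rfl
  have hcomp : ∀ e, fderiv ℝ (regQuot G H τ) w e =
      ((star (deriv G w * e) * H w + star (G w) * (deriv H w * e)) * regSq G τ w -
        star (G w) * H w * (star (deriv G w * e) * G w + star (G w) * (deriv G w * e)))
        / (regSq G τ w : ℂ) ^ 2 := by
    intro e
    apply fderiv_apply_of_hasDerivAt hS
    have k1 : HasDerivAt (fun t : ℝ => star (G (w + t * e))) (star (deriv G w * e)) 0 :=
      (hasDerivAt_line hGd e).star
    have k2 := hasDerivAt_line hGd e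
    have k3 := hasDerivAt_line hHd e
    have k4 : HasDerivAt (fun t : ℝ => (regSq G τ (w + t * e) : ℂ))
        (star (deriv G w * e) * G w + star (G w) * (deriv G w * e)) 0 := by
      simp_rw [hQe]
      refine ((k1.mul k2).add_const _).congr_deriv ?_
      simp
    refine ((k1.mul k3).div k4 (by simpa using hQ0)).congr_deriv ?_
    simp
  rw [dbar, hcomp, hcomp]
  simp only [mul_one, star_mul', Complex.star_def, Complex.conj_I]
  have := hQe w
  rw [Complex.star_def] at this
  field_simp
  rw [this]
  have hI := Complex.I_sq
  ring_nf
  simp only [hI]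
  ring

/-- The Cauchy transform is holomorphic off the support of the density. -/
lemma cauchyTransform_differentiableOn {a : ℂ → ℂ} (ha : Integrable a) {r : ℝ} (hr : 0 < r)
    (h0 : ∀ w ∈ ball (0 : ℂ) r, a w = 0) :
    DifferentiableOn ℂ (fun z => ∫ w, a w / (w - z)) (ball 0 (r / 2)) ∧
    ∀ z ∈ ball (0 : ℂ) (r / 2), Integrable (fun w => a w / (w - z)) ∧
      ‖∫ w, a w / (w - z)‖ ≤ (2 / r) * ∫ w, ‖a w‖ := by
  have hdist : ∀ w, a w ≠ 0 → ∀ z ∈ ball (0 : ℂ) (r / 2), r / 2 ≤ ‖w - z‖ := by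
    intro w hw z hz
    have h1 : r ≤ ‖w‖ := by
      by_contra h; push Not at h; exact hw (h0 w (by simpa using h))
    have h2 : ‖z‖ < r / 2 := by simpa using hz
    have := norm_sub_norm_le w z
    linarith
  have hmeas : ∀ z : ℂ, ∀ k : ℕ, AEStronglyMeasurable (fun w => a w / (w - z) ^ k) := by
    intro z k
    exact (ha.aestronglyMeasurable.aemeasurable.div (by fun_prop)).aestronglyMeasurable
  have hbd : ∀ k : ℕ, ∀ w, ∀ z ∈ ball (0 : ℂ) (r / 2), ‖a w / (w - z) ^ k‖ ≤ (2 / r) ^ k * ‖a w‖ := by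
    intro k w z hz
    by_cases hw : a w = 0
    · simp [hw]
    · have := hdist w hw z hz
      have hpos : 0 < ‖w - z‖ := by linarith
      rw [norm_div, norm_pow, div_le_iff₀ (by positivity)]
      have h2 : 1 ≤ (2 / r) * ‖w - z‖ := by
        rw [div_mul_eq_mul_div, one_le_div hr]; linarith
      calc ‖a w‖ = ‖a w‖ * 1 := (mul_one _).symm
        _ ≤ ‖a w‖ * ((2 / r) * ‖w - z‖) ^ k := by gcongr; exact one_le_pow₀ h2
        _ = _ := by rw [mul_pow]; ring
  have hInt : ∀ z ∈ ball (0 : ℂ) (r / 2), Integrable (fun w => a w / (w - z)) := by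
    intro z hz
    refine (ha.norm.const_mul (2 / r)).mono' (by simpa using hmeas z 1) (Eventually.of_forall fun w => ?_)
    simpa using hbd 1 w z hz
  refine ⟨?_, fun z hz => ⟨hInt z hz, ?_⟩⟩
  · intro z hz
    have := hasDerivAt_integral_of_dominated_loc_of_deriv_le (μ := volume)
      (F := fun z w => a w / (w - z)) (F' := fun z w => a w / (w - z) ^ 2) (x₀ := z)
      (bound := fun w => (2 / r) ^ 2 * ‖a w‖) (isOpen_ball.mem_nhds hz)
      (Eventually.of_forall fun z => by simpa using hmeas z 1) (hInt z hz) (hmeas z 2)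
      (Eventually.of_forall fun w z hz => hbd 2 w z hz) (ha.norm.const_mul _)
      (Eventually.of_forall fun w y hy => by
        by_cases hw : a w = 0
        · simp only [hw, zero_div]; exact hasDerivAt_const _ _
        · have hne : w - y ≠ 0 := by
            intro h
            have := hdist w hw y hy
            rw [h, norm_zero] at this; linarith
          have h1 : HasDerivAt (fun y => w - y) (-1) y := by simpa using (hasDerivAt_id y).const_sub w
          have := (hasDerivAt_const y (a w)).div h1 hne
          refine this.congr_deriv ?_
          simp)
    exact this.2.differentiableAt.differentiableWithinAt
  · rw [← integral_const_mul]
    refine norm_integral_le_of_norm_le (ha.norm.const_mul _) (Eventually.of_forall fun w => ?_)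
    simpa using hbd 1 w z hz

lemma le_and_mul_le_of_pow_le {N : ℕ} (hN : 1 ≤ N) {h q τ σ C : ℝ} (hh : 0 ≤ h) (hσ : 0 ≤ σ)
    (hτ : τ = σ ^ N) (hτq : τ ≤ q) (hq2 : q ≤ 2) (hC : 1 ≤ C) (hle : h ^ N ≤ C * q ^ (N + 1)) :
    h ≤ 2 * C * q ∧ h * τ ≤ C * σ * q ^ 2 := by
  have hτ0 : 0 ≤ τ := by rw [hτ]; positivity
  have hq0 : 0 ≤ q := hτ0.trans hτq
  have hN0 : N ≠ 0 := by omega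
  constructor
  · rw [← pow_le_pow_iff_left₀ hh (by positivity) hN0]
    calc h ^ N ≤ C * q ^ (N + 1) := hle
      _ = C * q * q ^ N := by ring
      _ ≤ (2 * C) * q ^ N := mul_le_mul_of_nonneg_right (by nlinarith) (by positivity)
      _ ≤ (2 * C) ^ N * q ^ N := by gcongr; exact le_self_pow₀ (by linarith) hN0
      _ = _ := by rw [← mul_pow]
  · rw [← pow_le_pow_iff_left₀ (by positivity) (by positivity) hN0]
    obtain ⟨n, rfl⟩ : ∃ n, N = n + 1 := ⟨N - 1, by omega⟩
    calc (h * τ) ^ (n + 1) = h ^ (n + 1) * (τ ^ n * τ) := by rw [mul_pow, pow_succ τ]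
      _ ≤ (C * q ^ (n + 1 + 1)) * (q ^ n * τ) := by gcongr
      _ = C * τ * (q ^ 2) ^ (n + 1) := by ring
      _ ≤ C ^ (n + 1) * τ * (q ^ 2) ^ (n + 1) := by gcongr; exact le_self_pow₀ hC hN0
      _ = _ := by rw [mul_pow, mul_pow, hτ]

lemma norm_regQuot_sub_le {N : ℕ} (hN : 1 ≤ N) {g h φ : ℂ} {τ σ ε : ℝ} (hσ : 0 < σ) (hσ1 : σ ≤ 1)
    (hτ : τ = σ ^ N) (hε0 : 0 ≤ ε) (hε : ε ≤ τ ^ 2) (hg1 : ‖g‖ ≤ 1) (hg : ‖g - φ ^ N‖ ≤ ε)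
    (hh : ‖h - φ ^ (N + 1)‖ ≤ ε) :
    ‖star g * h / ((‖g‖ ^ 2 + τ ^ 2 : ℝ) : ℂ) - φ‖ ≤ 4 * σ := by
  have hτ0 : 0 < τ := by rw [hτ]; positivity
  have hN0 : N ≠ 0 := by omega
  have hτσ : τ ≤ σ := by rw [hτ]; exact pow_le_of_le_one hσ.le hσ1 hN0
  have hτ1 : τ ≤ 1 := hτσ.trans hσ1
  have hετ : ε ≤ τ := hε.trans (pow_le_of_le_one hτ0.le hτ1 (by norm_num))
  set Q : ℝ := ‖g‖ ^ 2 + τ ^ 2 with hQ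
  have hQ0 : 0 < Q := by positivity
  have hφN : ‖φ‖ ^ N ≤ ‖g‖ + ε := by
    rw [← norm_pow]
    have := norm_sub_norm_le (φ ^ N) g
    rw [norm_sub_rev] at this
    linarith
  have hφ2 : ‖φ‖ ≤ 2 := by
    rw [← pow_le_pow_iff_left₀ (norm_nonneg _) (by norm_num) hN0]
    calc _ ≤ ‖g‖ + ε := hφN
      _ ≤ 2 := by linarith
      _ ≤ 2 ^ N := le_self_pow₀ (by norm_num) hN0
  have h1 : ‖g * φ - h‖ ≤ 3 * ε := by
    have : g * φ - h = (g - φ ^ N) * φ - (h - φ ^ (N + 1)) := by ring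
    rw [this]
    refine (norm_sub_le _ _).trans ?_
    rw [norm_mul]
    have := mul_le_mul hg hφ2 (norm_nonneg _) hε0
    linarith
  have h2 : ‖φ‖ * τ ^ 2 ≤ 2 * σ * Q := by
    rw [← pow_le_pow_iff_left₀ (by positivity) (by positivity) hN0]
    obtain ⟨n, rfl⟩ : ∃ n, N = n + 1 := ⟨N - 1, by omega⟩
    have a1 : (‖g‖ + τ) * τ ≤ 2 * Q := by rw [hQ]; nlinarith [sq_nonneg (‖g‖ - τ)]
    have a2 : τ ^ 2 ≤ Q := by rw [hQ]; nlinarith [sq_nonneg ‖g‖]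
    calc (‖φ‖ * τ ^ 2) ^ (n + 1) = ‖φ‖ ^ (n + 1) * (τ * (τ ^ 2) ^ n * τ) := by rw [mul_pow]; ring
      _ ≤ (‖g‖ + τ) * (τ * (τ ^ 2) ^ n * τ) := by gcongr; linarith
      _ = ((‖g‖ + τ) * τ) * (τ ^ 2) ^ n * τ := by ring
      _ ≤ (2 * Q) * Q ^ n * τ := by gcongr
      _ = 2 * τ * Q ^ (n + 1) := by ring
      _ ≤ 2 ^ (n + 1) * τ * Q ^ (n + 1) := by gcongr; exact le_self_pow₀ (by norm_num) hN0
      _ = _ := by rw [mul_pow, mul_pow, hτ]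
  have h3 : ‖g‖ * (3 * ε) ≤ 2 * σ * Q := by
    have a1 : ‖g‖ * τ ≤ Q / 2 := by rw [hQ]; nlinarith [sq_nonneg (‖g‖ - τ)]
    calc ‖g‖ * (3 * ε) ≤ ‖g‖ * (3 * τ ^ 2) := by gcongr
      _ = (‖g‖ * τ) * (3 * τ) := by ring
      _ ≤ (Q / 2) * (3 * σ) := by gcongr
      _ ≤ _ := by nlinarith [mul_pos hσ hQ0]
  have hQc : (Q : ℂ) ≠ 0 := by exact_mod_cast hQ0.ne'
  have hQe : (Q : ℂ) = star g * g + (τ : ℂ) ^ 2 := by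
    rw [hQ]; push_cast; rw [← Complex.conj_mul']; rfl
  have e1 : star g * h / (Q : ℂ) - φ = -(φ * (τ : ℂ) ^ 2 + star g * (g * φ - h)) / Q := by
    field_simp
    rw [hQe]; ring
  rw [e1, norm_div, norm_neg, Complex.norm_real, Real.norm_of_nonneg hQ0.le, div_le_iff₀ hQ0]
  refine (norm_add_le _ _).trans ?_
  rw [norm_mul, norm_mul, norm_star, norm_pow, Complex.norm_real, Real.norm_of_nonneg hτ0.le]
  have : ‖g‖ * ‖g * φ - h‖ ≤ ‖g‖ * (3 * ε) := by gcongr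
  linarith

lemma div_le_sq_add_rpow {g x τ κ : ℝ} (hgτ : g ≤ 2 / τ) (hx : 0 ≤ x) (hτ : 0 < τ)
    (hκ : 0 < κ) (hκ1 : κ < 1) : g / x ≤ g ^ 2 + 2 * τ ^ (-κ) * x ^ (-(2 - κ)) := by
  rcases hx.eq_or_lt with rfl | hx
  · simp only [div_zero]; positivity
  rcases le_or_gt τ x with h | h
  · have h1 : g / x ≤ g ^ 2 + (x⁻¹) ^ 2 := by
      rw [div_eq_mul_inv]; nlinarith [sq_nonneg (g - x⁻¹), sq_nonneg g, sq_nonneg x⁻¹]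
    have h2 : (x⁻¹) ^ 2 = x ^ (-κ) * x ^ (-(2 - κ)) := by
      rw [← Real.rpow_add hx, show -κ + -(2 - κ) = -((2 : ℕ) : ℝ) by push_cast; ring, Real.rpow_neg hx.le,
        Real.rpow_natCast, inv_pow]
    have h3 : x ^ (-κ) ≤ τ ^ (-κ) := Real.rpow_le_rpow_of_nonpos hτ h (by linarith)
    have h4 : x ^ (-κ) * x ^ (-(2 - κ)) ≤ τ ^ (-κ) * x ^ (-(2 - κ)) := by gcongr
    have h5 : 0 ≤ τ ^ (-κ) * x ^ (-(2 - κ)) := by positivity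
    linarith
  · have h1 : g / x ≤ 2 / τ / x := by gcongr
    have h2 : 2 / τ / x = 2 * (τ ^ (-κ) * τ ^ (-(1 - κ)) * x ^ (-(1 : ℝ))) := by
      rw [← Real.rpow_add hτ, show -κ + -(1 - κ) = -1 by ring, Real.rpow_neg_one, Real.rpow_neg_one]
      field_simp
    have h3 : τ ^ (-(1 - κ)) ≤ x ^ (-(1 - κ)) := Real.rpow_le_rpow_of_nonpos hx h.le (by linarith)
    have h4 : x ^ (-(2 - κ)) = x ^ (-(1 - κ)) * x ^ (-(1 : ℝ)) := by
      rw [← Real.rpow_add hx]; congr 1; ring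
    have h5 : τ ^ (-κ) * τ ^ (-(1 - κ)) * x ^ (-(1 : ℝ)) ≤ τ ^ (-κ) * x ^ (-(1 - κ)) * x ^ (-(1 : ℝ)) := by
      gcongr
    rw [h4]
    nlinarith [sq_nonneg g]

end Quotients

section HolomorphicRoots

open MeasureTheory

lemma contDiffOn_dbar {v : ℂ → ℂ} {U : Set ℂ} (hU : IsOpen U) (hv : ContDiffOn ℝ 1 v U) :
    ContDiffOn ℝ 0 (dbar v) U := by
  have h : ∀ e, ContDiffOn ℝ 0 (fun w => fderiv ℝ v w e) U := fun e =>
    (hv.fderiv_of_isOpen (m := 0) hU (by norm_num)).clm_apply contDiffOn_const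
  exact ((h 1).add (contDiffOn_const.mul (h Complex.I))).div_const 2

lemma exists_holomorphic_near_regQuot {N : ℕ} (hN : 1 ≤ N) :
    ∃ C : ℝ, 1 ≤ C ∧ ∀ (ξ C₁ : ℝ) (G H : ℂ → ℂ), 0 < ξ → ξ ≤ 1 → 1 ≤ C₁ →
      DifferentiableOn ℂ G (ball 0 1) → DifferentiableOn ℂ H (ball 0 1) →
      (∀ z ∈ ball (0 : ℂ) 1, ‖G z‖ ≤ 1) →
      (∀ w ∈ ball (0 : ℂ) (1 / 4), ‖regQuot G H ((ξ ^ 2) ^ N) w‖ ≤ C₁ ∧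
        ‖H w‖ * (ξ ^ 2) ^ N ≤ C₁ * ξ ^ 2 * regSq G ((ξ ^ 2) ^ N) w) →
      ∃ F : ℂ → ℂ, DifferentiableOn ℂ F (ball 0 (1 / 16)) ∧
        ∀ z ∈ ball (0 : ℂ) (1 / 16), ‖F z‖ ≤ C * C₁ ∧
          ‖F z - regQuot G H ((ξ ^ 2) ^ N) z‖ ≤ C * C₁ * ξ := by
  let χ : ContDiffBump (0 : ℂ) := ⟨1 / 8, 3 / 16, by norm_num, by norm_num⟩
  have hχs : tsupport χ ⊆ ball 0 (1 / 4) := by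
    rw [χ.tsupport_eq]; exact closedBall_subset_ball (by change (3 / 16 : ℝ) < 1 / 4; norm_num)
  have hχsub : ball (0 : ℂ) (1 / 4) ⊆ ball 0 1 := ball_subset_ball (by norm_num)
  obtain ⟨CA, hCA0, hCA⟩ := exists_integral_area_le (χ.contDiff) χ.hasCompactSupport (hχs.trans hχsub)
  set X : ℂ → ℂ := fun w => (χ w : ℂ) with hX
  have hXc : ∀ n : WithTop ℕ∞, n ≤ (⊤ : ℕ∞) → ContDiff ℝ n X := fun n hn =>
    Complex.ofRealCLM.contDiff.comp (χ.contDiff (n := (⊤ : ℕ∞)) |>.of_le hn)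
  have hX1 : ContDiff ℝ 1 X := hXc 1 (by norm_cast)
  have hXts : tsupport X ⊆ tsupport χ := tsupport_comp_subset Complex.ofReal_zero χ
  have hXcs : HasCompactSupport X := χ.hasCompactSupport.comp_left Complex.ofReal_zero
  have hdX : ContDiff ℝ 0 (dbar X) := contDiffOn_univ.mp (contDiffOn_dbar isOpen_univ hX1.contDiffOn)
  have hdXsupp : Function.support (dbar X) ⊆ tsupport χ := by
    intro w hw
    by_contra h
    have h0 : X =ᶠ[𝓝 w] 0 := notMem_tsupport_iff_eventuallyEq.mp (fun h' => h (hXts h'))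
    apply hw
    simp [dbar, h0.fderiv_eq]
  have hdXts : tsupport (dbar X) ⊆ tsupport χ := closure_minimal hdXsupp (isClosed_tsupport _)
  have hdXcs : HasCompactSupport (dbar X) := HasCompactSupport.of_support_subset_isCompact
    χ.hasCompactSupport hdXsupp
  have hdX0 : ∀ w ∈ ball (0 : ℂ) (1 / 8), dbar X w = 0 := by
    intro w hw
    have h1 : X =ᶠ[𝓝 w] fun _ => 1 := by
      filter_upwards [χ.eventuallyEq_one_of_mem_ball hw] with y hy
      simp [hX, hy]
    simp [dbar, h1.fderiv_eq]
  set D₀ : ℝ := ∫ w, ‖dbar X w‖ with hD₀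
  have hD₀0 : 0 ≤ D₀ := integral_nonneg fun _ => norm_nonneg _
  have hdXi : Integrable (dbar X) := hdX.continuous.integrable_of_hasCompactSupport hdXcs
  set κ : ℝ := 1 / (2 * N) with hκ
  have hNr : (1 : ℝ) ≤ N := by exact_mod_cast hN
  have hκ0 : 0 < κ := by positivity
  have hκ1 : κ < 1 := by rw [hκ, div_lt_one (by positivity)]; linarith
  set k : ℂ → ℝ := (ball (0 : ℂ) 1).indicator (fun x => ‖x‖ ^ (-(2 - κ))) with hk
  have hki : Integrable k := by
    rw [hk, integrable_indicator_iff measurableSet_ball]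
    refine integrableOn_ball_of_norm_le_rpow (C := 1) (α := 2 - κ) (by simp) (by simp [hκ0]) ?_ ?_
    · refine Eventually.of_forall fun x => ?_
      rw [one_mul, Real.norm_of_nonneg (by positivity)]
    · exact (measurable_norm.pow_const _).aestronglyMeasurable
  set I₀ : ℝ := ∫ x, k x with hI₀
  have hk0 : ∀ x, 0 ≤ k x := fun x => indicator_nonneg (fun y _ => by positivity) x
  have hI₀0 : 0 ≤ I₀ := integral_nonneg hk0
  refine ⟨1 + 16 * D₀ + (CA * (1 + 4 * N) + 2 * I₀), by
    have : 0 ≤ CA * (1 + 4 * N) := by positivity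
    linarith, ?_⟩
  intro ξ C₁ G H hξ hξ1 hC₁ hG hH hG1 hS
  set σ : ℝ := ξ ^ 2 with hσ
  set τ : ℝ := σ ^ N with hτ
  have hσ0 : 0 < σ := by positivity
  have hσ1 : σ ≤ 1 := pow_le_one₀ hξ.le hξ1
  have hτ0 : 0 < τ := by positivity
  have hτ1 : τ ≤ 1 := pow_le_one₀ hσ0.le hσ1
  have hτκ : τ ^ (-κ) = ξ⁻¹ := by
    rw [hτ, hσ, ← pow_mul, ← Real.rpow_natCast, ← Real.rpow_mul hξ.le, hκ, ← Real.rpow_neg_one]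
    congr 1; push_cast; field_simp
  set S : ℂ → ℂ := regQuot G H τ with hSdef
  have hScd : ContDiffOn ℝ 1 S (ball 0 1) := contDiffOn_regQuot isOpen_ball hG hH hτ0
  set a : ℂ → ℂ := fun w => dbar X w * S w with ha
  have hab : ∀ w, ‖a w‖ ≤ C₁ * ‖dbar X w‖ := by
    intro w
    by_cases hw : dbar X w = 0
    · simp [ha, hw]
    · rw [ha, norm_mul, mul_comm]
      gcongr
      exact (hS w (hχs (hdXsupp hw))).1
  have hai : Integrable a :=
    (contDiff_mul_of_tsupport isOpen_ball hdX (hScd.of_le (by norm_num))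
      (hdXts.trans (hχs.trans hχsub))).continuous.integrable_of_hasCompactSupport hdXcs.mul_right
  have hanorm : ∫ w, ‖a w‖ ≤ C₁ * D₀ := by
    rw [hD₀, ← integral_const_mul]
    exact integral_mono hai.norm (hdXi.norm.const_mul _) hab
  obtain ⟨hFd, hFb⟩ := cauchyTransform_differentiableOn hai (r := 1 / 8) (by norm_num)
    (fun w hw => by simp [ha, hdX0 w hw])
  have hr : (1 / 8 : ℝ) / 2 = 1 / 16 := by norm_num
  rw [hr] at hFd hFb
  have hpi : (1 : ℝ) ≤ Real.pi := by linarith [Real.pi_gt_three]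
  have hpi0 : (0 : ℝ) < Real.pi := Real.pi_pos
  have hpic : (Real.pi : ℂ) ≠ 0 := by exact_mod_cast Real.pi_ne_zero
  refine ⟨fun z => (-(Real.pi : ℂ))⁻¹ * ∫ w, a w / (w - z), hFd.const_mul _, ?_⟩
  intro z hz
  have hninv : ‖(-(Real.pi : ℂ))⁻¹‖ ≤ 1 := by
    rw [norm_inv, norm_neg, Complex.norm_real, Real.norm_of_nonneg hpi0.le]
    exact inv_le_one_of_one_le₀ hpi
  have hrest : 0 ≤ CA * (1 + 4 * N) + 2 * I₀ := by positivity
  constructor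
  · rw [norm_mul]
    calc _ ≤ 1 * (2 / (1 / 8) * ∫ w, ‖a w‖) := by gcongr; exact (hFb z hz).2
      _ ≤ 1 * (2 / (1 / 8) * (C₁ * D₀)) := by gcongr
      _ = (16 * D₀) * C₁ := by ring
      _ ≤ _ := by gcongr; linarith
  · have hzb : ‖z‖ < 1 / 16 := by simpa using hz
    set b : ℂ → ℂ := fun w => X w * dbar S w with hb
    have hbc : Continuous b := (contDiff_mul_of_tsupport isOpen_ball (hX1.of_le (by norm_num))
      (contDiffOn_dbar isOpen_ball hScd) (hXts.trans (hχs.trans hχsub))).continuous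
    set g : ℂ → ℝ := fun w => ‖deriv G w‖ * τ / regSq G τ w with hg
    have hbb : ∀ w, ‖b w / (w - z)‖ ≤
        C₁ * σ * (χ w * (g w) ^ 2 + 2 * ξ⁻¹ * k (w - z)) := by
      intro w
      by_cases hw : w ∈ tsupport χ
      · have hwq : w ∈ ball (0 : ℂ) (1 / 4) := hχs hw
        have hw1 := hχsub hwq
        have hQ := regSq_pos G hτ0 w
        have hwn : ‖w‖ < 1 / 4 := by simpa using hwq
        have hd2 : ‖deriv G w‖ ≤ 2 := by
          have hsub : closedBall w (1 / 2) ⊆ ball (0 : ℂ) 1 := by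
            intro y hy
            have h1 : ‖y - w‖ ≤ 1 / 2 := by simpa [dist_eq_norm] using hy
            have := norm_sub_norm_le y w
            simp only [mem_ball_zero_iff]; linarith
          have := Complex.norm_deriv_le_of_forall_mem_sphere_norm_le (c := w) (R := 1 / 2) (C := 1)
            (f := G) (by norm_num) ((hG.mono (by
              rw [closure_ball _ (by norm_num)]; exact hsub)).diffContOnCl)
            (fun y hy => hG1 y (hsub (sphere_subset_closedBall hy)))
          norm_num at this; exact this
        have hg0 : 0 ≤ g w := by rw [hg]; positivity
        have hg2 : g w ≤ 2 / τ := by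
          rw [hg]
          simp only
          rw [div_le_div_iff₀ hQ hτ0]
          have : τ ^ 2 ≤ regSq G τ w := by rw [regSq_eq]; nlinarith [sq_nonneg ‖G w‖]
          nlinarith [sq_nonneg τ, norm_nonneg (deriv G w)]
        have hdS : ‖dbar S w‖ ≤ C₁ * σ * g w := by
          rw [hSdef, dbar_regQuot isOpen_ball hG hH hτ0 hw1]
          rw [norm_div, norm_mul, norm_mul, norm_star, norm_pow, norm_pow, Complex.norm_real,
            Complex.norm_real, Real.norm_of_nonneg hτ0.le, Real.norm_of_nonneg hQ.le,
            div_le_iff₀ (by positivity)]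
          have h2 := (hS w hwq).2
          calc ‖deriv G w‖ * ‖H w‖ * τ ^ 2 = ‖deriv G w‖ * τ * (‖H w‖ * τ) := by ring
            _ ≤ ‖deriv G w‖ * τ * (C₁ * σ * regSq G τ w) := by gcongr
            _ = C₁ * σ * g w * regSq G τ w ^ 2 := by rw [hg]; field_simp
        have hx1 : ‖w - z‖ < 1 := by have := norm_sub_le w z; linarith
        have hkx : k (w - z) = ‖w - z‖ ^ (-(2 - κ)) :=
          indicator_of_mem (by simpa using hx1) _
        have hmain := div_le_sq_add_rpow hg2 (norm_nonneg (w - z)) hτ0 hκ0 hκ1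
        rw [hτκ, ← hkx] at hmain
        have hχ0 : 0 ≤ χ w := χ.nonneg
        have hχ1 : χ w ≤ 1 := χ.le_one
        rw [hb, norm_div, norm_mul, hX, Complex.norm_real, Real.norm_of_nonneg hχ0]
        calc χ w * ‖dbar S w‖ / ‖w - z‖ ≤ χ w * (C₁ * σ * g w) / ‖w - z‖ := by gcongr
          _ = C₁ * σ * (χ w * (g w / ‖w - z‖)) := by ring
          _ ≤ C₁ * σ * (χ w * ((g w) ^ 2 + 2 * ξ⁻¹ * k (w - z))) := by gcongr
          _ ≤ _ := by
            rw [mul_add]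
            have h := mul_le_of_le_one_left
              (show 0 ≤ 2 * ξ⁻¹ * k (w - z) by have := hk0 (w - z); positivity) hχ1
            exact mul_le_mul_of_nonneg_left (by linarith) (by positivity)
      · have h0 : χ w = 0 := image_eq_zero_of_notMem_tsupport hw
        have : b w = 0 := by simp [hb, hX, h0]
        rw [this, zero_div, norm_zero, h0]
        have := hk0 (w - z)
        positivity
    obtain ⟨hgi, hgb⟩ := hCA G hG hG1 τ hτ0 hτ1
    have hkzi : Integrable (fun w => k (w - z)) := hki.comp_sub_right z
    have hbound_int : Integrable (fun w => C₁ * σ * (χ w * (g w) ^ 2 + 2 * ξ⁻¹ * k (w - z))) :=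
      (hgi.add (hkzi.const_mul _)).const_mul _
    have hbzi : Integrable (fun w => b w / (w - z)) :=
      hbound_int.mono' ((hbc.measurable.div (by fun_prop)).aestronglyMeasurable)
        (Eventually.of_forall hbb)
    have hbz : ‖∫ w, b w / (w - z)‖ ≤ (CA * (1 + 4 * N) + 2 * I₀) * C₁ * ξ := by
      refine (norm_integral_le_of_norm_le hbound_int (Eventually.of_forall hbb)).trans ?_
      rw [integral_const_mul, integral_add hgi (hkzi.const_mul _), integral_const_mul,
        integral_sub_right_eq_self k z, ← hI₀]
      have hlog : Real.log τ⁻¹ ≤ 2 * N * ξ⁻¹ := by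
        have : Real.log τ⁻¹ = 2 * N * Real.log ξ⁻¹ := by
          rw [hτ, hσ, ← pow_mul, ← inv_pow, Real.log_pow]; push_cast; ring
        rw [this]
        gcongr
        have := Real.log_le_sub_one_of_pos (inv_pos.mpr hξ)
        linarith
      have hξi : 1 ≤ ξ⁻¹ := (one_le_inv₀ hξ).mpr hξ1
      calc _ ≤ C₁ * σ * (CA * (ξ⁻¹ + 2 * (2 * N * ξ⁻¹)) + 2 * ξ⁻¹ * I₀) := by
            gcongr
            refine hgb.trans ?_
            gcongr
        _ = (CA * (1 + 4 * N) + 2 * I₀) * C₁ * ξ := by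
            rw [hσ]; field_simp; ring
    have hcp := cauchy_pompeiu (v := fun w => X w * S w)
      (contDiff_mul_of_tsupport isOpen_ball hX1 hScd (hXts.trans (hχs.trans hχsub)))
      hXcs.mul_right z
    have hXz : X z = 1 := by
      have : z ∈ closedBall (0 : ℂ) χ.rIn := by
        simp only [mem_closedBall_zero_iff]; change ‖z‖ ≤ 1 / 8; linarith
      simp [hX, χ.one_of_mem_closedBall this]
    have hsplit : ∀ w, dbar (fun w => X w * S w) w / (w - z) = a w / (w - z) + b w / (w - z) := by
      intro w
      have hm := fderiv_mul_of_tsupport isOpen_ball (hX1.differentiable (by norm_num))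
        (hScd.differentiableOn (by norm_num)) (hXts.trans (hχs.trans hχsub)) w
      simp only [dbar, ha, hb, hm]
      ring
    simp_rw [hsplit] at hcp
    rw [integral_add (hFb z hz).1 hbzi, hXz, one_mul] at hcp
    have hfin : (-(Real.pi : ℂ))⁻¹ * (∫ w, a w / (w - z)) - S z =
        -((-(Real.pi : ℂ))⁻¹ * ∫ w, b w / (w - z)) := by
      have : S z = (-(Real.pi : ℂ))⁻¹ * ((∫ w, a w / (w - z)) + ∫ w, b w / (w - z)) := by
        rw [hcp]; field_simp
      rw [this]; ring
    rw [hfin, norm_neg, norm_mul]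
    calc _ ≤ 1 * ((CA * (1 + 4 * N) + 2 * I₀) * C₁ * ξ) := by gcongr
      _ = (CA * (1 + 4 * N) + 2 * I₀) * C₁ * ξ := one_mul _
      _ ≤ _ := mul_le_mul_of_nonneg_right
        (mul_le_mul_of_nonneg_right (by linarith) (by linarith)) hξ.le

/-- If `φ ^ N` and `φ ^ (N + 1)` are approximated on the real line by bounded holomorphic functions,
then so is `φ`, on a smaller disc and with a quantitative loss. -/
theorem exists_holomorphic_of_pow {N : ℕ} (hN : 1 ≤ N) :
    ∃ C : ℝ, 1 ≤ C ∧ ∀ (ξ : ℝ) (φ : ℝ → ℂ) (G H : ℂ → ℂ), 0 < ξ → ξ ≤ 1 →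
      DifferentiableOn ℂ G (ball 0 1) → DifferentiableOn ℂ H (ball 0 1) →
      (∀ z ∈ ball (0 : ℂ) 1, ‖G z‖ ≤ 1) → (∀ z ∈ ball (0 : ℂ) 1, ‖H z‖ ≤ 1) →
      (∀ s : ℝ, |s| < 1 → ‖G s - φ s ^ N‖ ≤ ξ ^ (8 * N * (N + 1))) →
      (∀ s : ℝ, |s| < 1 → ‖H s - φ s ^ (N + 1)‖ ≤ ξ ^ (8 * N * (N + 1))) →
      ∃ F : ℂ → ℂ, DifferentiableOn ℂ F (ball 0 (1 / 16)) ∧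
        (∀ z ∈ ball (0 : ℂ) (1 / 16), ‖F z‖ ≤ C) ∧
        ∀ s : ℝ, |s| < 1 / 16 → ‖F s - φ s‖ ≤ C * ξ := by
  obtain ⟨C, hC, hmain⟩ := exists_holomorphic_near_regQuot hN
  set Cu : ℝ := 2 * ((N + 1) * 2 ^ N) with hCu
  have hCu2 : 2 ≤ Cu := by
    have h1 : (1 : ℝ) ≤ 2 ^ N := one_le_pow₀ (by norm_num)
    have h2 : (1 : ℝ) ≤ N + 1 := by linarith [Nat.cast_nonneg (α := ℝ) N]
    have := mul_le_mul h2 h1 (by norm_num) (by linarith)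
    rw [hCu]; linarith
  set C₁ : ℝ := 2 * (1 + Cu) with hC₁
  refine ⟨C * (C₁ * 2) + 4, by nlinarith, ?_⟩
  intro ξ φ G H hξ hξ1 hG hH hG1 hH1 hGr hHr
  set σ : ℝ := ξ ^ 2 with hσ
  set τ : ℝ := σ ^ N with hτ
  set ε : ℝ := ξ ^ (8 * N * (N + 1)) with hε
  have hσ0 : 0 < σ := by positivity
  have hσ1 : σ ≤ 1 := pow_le_one₀ hξ.le hξ1
  have hτ0 : 0 < τ := by positivity
  have hτ1 : τ ≤ 1 := pow_le_one₀ hσ0.le hσ1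
  have hετ : ε = (τ ^ (N + 1)) ^ 4 := by
    rw [hε, hτ, hσ, ← pow_mul, ← pow_mul, ← pow_mul]; congr 1; ring
  have hε0 : 0 ≤ ε := by positivity
  have hετ2 : ε ≤ τ ^ 2 := by
    rw [hετ, ← pow_mul]; exact pow_le_pow_of_le_one hτ0.le hτ1 (by nlinarith)
  have hε1 : ε ≤ 1 := hετ2.trans (pow_le_one₀ hτ0.le hτ1)
  have hu : ∀ w : ℂ, ‖w‖ ≤ 1 / 4 → ‖H w ^ N - G w ^ (N + 1)‖ ≤ Cu * τ ^ (N + 1) := by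
    intro w hw
    have h := two_constants (u := fun z => (Cu : ℂ)⁻¹ * (H z ^ N - G z ^ (N + 1))) (R := 1)
      (ξ := τ ^ (N + 1)) one_pos (((hH.pow N).sub (hG.pow (N + 1))).const_mul _) (by positivity)
      (pow_le_one₀ hτ0.le hτ1) ?_ ?_ hw
    · rw [norm_mul, norm_inv, Complex.norm_real, Real.norm_of_nonneg (by linarith),
        inv_mul_le_iff₀ (by linarith)] at h
      exact h
    · intro z hz
      rw [norm_mul, norm_inv, Complex.norm_real, Real.norm_of_nonneg (by linarith),
        inv_mul_le_iff₀ (by linarith)]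
      have h1 : ‖H z ^ N‖ ≤ 1 := by rw [norm_pow]; exact pow_le_one₀ (norm_nonneg _) (hH1 z hz)
      have h2 : ‖G z ^ (N + 1)‖ ≤ 1 := by rw [norm_pow]; exact pow_le_one₀ (norm_nonneg _) (hG1 z hz)
      have := norm_sub_le (H z ^ N) (G z ^ (N + 1))
      linarith
    · intro s hs
      rw [← hετ, norm_mul, norm_inv, Complex.norm_real, Real.norm_of_nonneg (by linarith),
        inv_mul_le_iff₀ (by linarith)]
      have hsb : (s : ℂ) ∈ ball (0 : ℂ) 1 := by simpa using hs
      have n1 : ‖φ s ^ N‖ ≤ 2 := by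
        have := norm_sub_norm_le (φ s ^ N) (G s)
        rw [norm_sub_rev] at this
        linarith [hGr s hs, hG1 _ hsb]
      have n2 : ‖φ s ^ (N + 1)‖ ≤ 2 := by
        have := norm_sub_norm_le (φ s ^ (N + 1)) (H s)
        rw [norm_sub_rev] at this
        linarith [hHr s hs, hH1 _ hsb]
      have a1 := norm_pow_sub_pow_le (H s) (φ s ^ (N + 1)) ((hH1 _ hsb).trans (by norm_num)) n2 N
      have a2 := norm_pow_sub_pow_le (G s) (φ s ^ N) ((hG1 _ hsb).trans (by norm_num)) n1 (N + 1)
      have e : H s ^ N - G s ^ (N + 1) =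
          (H s ^ N - (φ s ^ (N + 1)) ^ N) - (G s ^ (N + 1) - (φ s ^ N) ^ (N + 1)) := by
        rw [← pow_mul, ← pow_mul, mul_comm N (N + 1)]; ring
      rw [e]
      refine (norm_sub_le _ _).trans ?_
      have b1 : N * (2 : ℝ) ^ (N - 1) * ‖H s - φ s ^ (N + 1)‖ ≤ (N + 1) * 2 ^ N * ε := by
        gcongr
        · linarith
        · norm_num
        · omega
        · exact hHr s hs
      have b2 : ((N + 1 : ℕ) : ℝ) * (2 : ℝ) ^ (N + 1 - 1) * ‖G s - φ s ^ N‖ ≤ (N + 1) * 2 ^ N * ε := by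
        rw [Nat.add_sub_cancel]; push_cast
        gcongr
        exact hGr s hs
      rw [hCu]; linarith
  have hbd : ∀ w ∈ ball (0 : ℂ) (1 / 4), ‖regQuot G H τ w‖ ≤ C₁ * 2 ∧
      ‖H w‖ * τ ≤ C₁ * 2 * σ * regSq G τ w := by
    intro w hw
    have hw4 : ‖w‖ ≤ 1 / 4 := by simpa using (mem_ball.mp hw).le
    have hw1 : w ∈ ball (0 : ℂ) 1 := ball_subset_ball (by norm_num) hw
    have hQ := regSq_pos G hτ0 w
    set q : ℝ := Real.sqrt (regSq G τ w) with hq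
    have hq2 : q ^ 2 = regSq G τ w := Real.sq_sqrt hQ.le
    have hq0 : 0 < q := Real.sqrt_pos.mpr hQ
    have hτq : τ ≤ q := Real.le_sqrt_of_sq_le (by rw [regSq_eq]; nlinarith [sq_nonneg ‖G w‖])
    have hGq : ‖G w‖ ≤ q := Real.le_sqrt_of_sq_le (by rw [regSq_eq]; nlinarith [sq_nonneg τ])
    have hqle : q ≤ 2 := by
      rw [hq, Real.sqrt_le_left (by norm_num), regSq_eq]
      nlinarith [hG1 w hw1, norm_nonneg (G w)]
    have hle : ‖H w‖ ^ N ≤ C₁ * q ^ (N + 1) := by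
      have h1 : ‖H w‖ ^ N ≤ ‖G w‖ ^ (N + 1) + Cu * τ ^ (N + 1) := by
        rw [← norm_pow, ← norm_pow]
        have := norm_sub_norm_le (H w ^ N) (G w ^ (N + 1))
        linarith [hu w hw4]
      calc _ ≤ ‖G w‖ ^ (N + 1) + Cu * τ ^ (N + 1) := h1
        _ ≤ q ^ (N + 1) + Cu * q ^ (N + 1) := by gcongr
        _ ≤ C₁ * q ^ (N + 1) := by
          have : 0 ≤ q ^ (N + 1) := by positivity
          rw [hC₁]; nlinarith
    obtain ⟨r1, r2⟩ := le_and_mul_le_of_pow_le hN (norm_nonneg (H w)) hσ0.le hτ hτq hqle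
      (by rw [hC₁]; linarith) hle
    constructor
    · rw [regQuot, norm_div, norm_mul, norm_star, Complex.norm_real, Real.norm_of_nonneg hQ.le,
        div_le_iff₀ hQ, ← hq2]
      calc ‖G w‖ * ‖H w‖ ≤ q * (2 * C₁ * q) := by gcongr
        _ = _ := by ring
    · rw [← hq2]
      refine r2.trans ?_
      have : 0 ≤ C₁ * σ * q ^ 2 := by rw [hC₁]; positivity
      nlinarith
  have hC₁1 : 1 ≤ C₁ := by rw [hC₁]; linarith
  obtain ⟨F, hFd, hF⟩ := hmain ξ (C₁ * 2) G H hξ hξ1 (by linarith) hG hH hG1 hbd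
  refine ⟨F, hFd, fun z hz => (hF z hz).1.trans (by linarith), fun s hs => ?_⟩
  have h1 := (hF (s : ℂ) (by simpa using hs)).2
  have hs1 : |s| < 1 := by linarith
  have h2 := norm_regQuot_sub_le hN hσ0 hσ1 hτ hε0 hετ2 (hG1 s (by simpa using hs1)) (hGr s hs1) (hHr s hs1)
  rw [← regSq_eq] at h2
  have hσξ : σ ≤ ξ := by rw [hσ]; nlinarith
  have h3 := norm_sub_le_norm_sub_add_norm_sub (F s) (regQuot G H τ s) (φ s)
  have h4 : ‖regQuot G H τ s - φ s‖ ≤ 4 * σ := h2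
  change ‖F s - regQuot G H τ s‖ ≤ C * (C₁ * 2) * ξ at h1
  linarith

end HolomorphicRoots

section WeightRatios

lemma lc_pos {M : ℕ → ℝ} (hM : IsWeightSeq M) (k : ℕ) : 0 < lc M k :=
  div_pos (hM.pos k) (by positivity)

lemma lc_zero {M : ℕ → ℝ} (hM : IsWeightSeq M) : lc M 0 = 1 := by simp [lc, hM.first]

lemma RootsTendsto.eventually_pow_le {m : ℕ → ℝ} (h : RootsTendsto m) (hm : ∀ k, 0 < m k)
    {T : ℝ} (hT : 0 < T) : ∃ K : ℕ, ∀ k, K ≤ k → T ^ k ≤ m k := by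
  obtain ⟨K, hK⟩ := eventually_atTop.mp (tendsto_atTop.mp h T)
  refine ⟨K + 1, fun k hk => ?_⟩
  have hk0 : (k : ℝ) ≠ 0 := by exact_mod_cast (show k ≠ 0 by omega)
  have h1 := hK k (by omega)
  calc T ^ k ≤ (m k ^ ((1 : ℝ) / k)) ^ k := by gcongr
    _ = m k := by
      rw [← Real.rpow_natCast, ← Real.rpow_mul (hm k).le, one_div_mul_cancel hk0, Real.rpow_one]

lemma hfn_GammaUpper {n : ℕ → ℝ} (h : RootsTendsto n) (hn : ∀ k, 0 < n k) (hn0 : n 0 = 1)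
    {t : ℝ} (ht : 0 < t) (j : ℕ) :
    n (GammaUpper n t) * t ^ GammaUpper n t ≤ n j * t ^ j := by
  obtain ⟨K, hK⟩ := h.eventually_pow_le hn (inv_pos.mpr ht)
  have hlarge : ∀ k, K ≤ k → n 0 * t ^ 0 ≤ n k * t ^ k := by
    intro k hk
    have := hK k hk
    rw [inv_pow, inv_le_iff_one_le_mul₀ (by positivity)] at this
    simpa [hn0] using this
  obtain ⟨i, -, hi⟩ := Finset.exists_min_image (Finset.range (K + 1)) (fun k => n k * t ^ k)
    ⟨0, by simp⟩
  have hmin : ∀ k, n i * t ^ i ≤ n k * t ^ k := by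
    intro k
    rcases lt_or_ge k (K + 1) with hk | hk
    · exact hi k (by simpa using hk)
    · exact (hi 0 (by simp)).trans (hlarge k (by omega))
  have hbdd : BddBelow (range fun k : ℕ => n k * t ^ k) := by
    refine ⟨0, ?_⟩
    rintro _ ⟨k, rfl⟩
    have := hn k
    positivity
  have hne : {k : ℕ | hfn n t = n k * t ^ k}.Nonempty := by
    refine ⟨i, ?_⟩
    change hfn n t = _
    rw [hfn, if_neg (by linarith)]
    exact le_antisymm (ciInf_le hbdd i) (le_ciInf hmin)
  have hmem : hfn n t = n (GammaUpper n t) * t ^ GammaUpper n t := Nat.sInf_mem hne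
  rw [← hmem, hfn, if_neg (by linarith)]
  exact ciInf_le hbdd j

/-- The running maximum of the quotients `m_{k+1} / m_k`. -/
def ratioMax (m : ℕ → ℝ) : ℕ → ℝ := fun j => partialSups (fun i => m (i + 1) / m i) j

lemma ratioMax_mono (m : ℕ → ℝ) : Monotone (ratioMax m) :=
  (partialSups fun i => m (i + 1) / m i).monotone

lemma le_ratioMax (m : ℕ → ℝ) (j : ℕ) : m (j + 1) / m j ≤ ratioMax m j :=
  le_partialSups (fun i => m (i + 1) / m i) j

lemma exists_ratioMax_eq (m : ℕ → ℝ) (j : ℕ) : ∃ i ≤ j, ratioMax m j = m (i + 1) / m i := by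
  induction j with
  | zero => exact ⟨0, le_rfl, by simp [ratioMax]⟩
  | succ j ih =>
    obtain ⟨i, hi, h⟩ := ih
    have e : ratioMax m (j + 1) = ratioMax m j ⊔ m (j + 1 + 1) / m (j + 1) := by
      simp [ratioMax, partialSups_add_one]
    rcases le_total (ratioMax m j) (m (j + 1 + 1) / m (j + 1)) with hl | hl
    · exact ⟨j + 1, le_rfl, by rw [e, sup_eq_right.mpr hl]⟩
    · exact ⟨i, by omega, by rw [e, sup_eq_left.mpr hl, h]⟩

lemma ratioMax_pos {m : ℕ → ℝ} (hm : ∀ k, 0 < m k) (j : ℕ) : 0 < ratioMax m j :=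
  (div_pos (hm _) (hm _)).trans_le (le_ratioMax m j)

lemma le_prod_ratioMax {m : ℕ → ℝ} (hm : ∀ k, 0 < m k) (hm0 : m 0 = 1) (j : ℕ) :
    m j ≤ ∏ i ∈ Finset.range j, ratioMax m i := by
  induction j with
  | zero => simp [hm0]
  | succ j ih =>
    rw [Finset.prod_range_succ]
    calc m (j + 1) = m j * (m (j + 1) / m j) := by field_simp [(hm j).ne']
      _ ≤ _ := mul_le_mul ih (le_ratioMax m j) (div_pos (hm _) (hm _)).le
        ((hm j).le.trans ih)

lemma prod_ratioMax_le {m n : ℕ → ℝ} (hm : ∀ k, 0 < m k) (hn : ∀ k, 0 < n k) (hn0 : n 0 = 1)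
    (hr : RootsTendsto n) {C : ℝ} (hC : 1 ≤ C)
    (h : ∀ t : ℝ, 0 < t → GammaUpper n (C * t) ≤ GammaLower m t) (j : ℕ) :
    ∏ i ∈ Finset.range j, ratioMax m i ≤ C ^ j * n j := by
  induction j using Nat.strong_induction_on with
  | _ j ih =>
    rcases j with _ | j
    · simp [hn0]
    · set μ := ratioMax m j with hμ
      have hμ0 : 0 < μ := ratioMax_pos hm j
      obtain ⟨i, hij, hi⟩ := exists_ratioMax_eq m j
      have hlow : GammaLower m (1 / μ) ≤ i := Nat.sInf_le (by
        change 1 / (1 / μ) ≤ _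
        rw [one_div_one_div, hμ, hi])
      set k := GammaUpper n (C * (1 / μ)) with hk
      have hkj : k ≤ j := (h _ (by positivity)).trans (hlow.trans hij)
      have hmin := hfn_GammaUpper hr hn hn0 (t := C * (1 / μ)) (by positivity) (j + 1)
      rw [← hk] at hmin
      have hsplit : ∏ i ∈ Finset.range (j + 1), ratioMax m i ≤
          (∏ i ∈ Finset.range k, ratioMax m i) * μ ^ (j + 1 - k) := by
        rw [← Finset.prod_range_mul_prod_Ico _ (show k ≤ j + 1 by omega)]
        gcongr
        · exact Finset.prod_nonneg fun i _ => (ratioMax_pos hm i).le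
        · refine (Finset.prod_le_prod (fun i _ => (ratioMax_pos hm i).le)
            (g := fun _ => μ) fun i hi => ratioMax_mono m ?_).trans ?_
          · simp at hi; omega
          · simp
      have hsp : (C * (1 / μ)) ^ (j + 1) = (C * (1 / μ)) ^ k * (C * (1 / μ)) ^ (j + 1 - k) := by
        rw [← pow_add]; congr 1; omega
      have hn' : n k ≤ n (j + 1) * (C * (1 / μ)) ^ (j + 1 - k) := by
        rw [hsp] at hmin
        refine le_of_mul_le_mul_right (a := (C * (1 / μ)) ^ k) ?_ (by positivity)
        linarith
      calc _ ≤ (∏ i ∈ Finset.range k, ratioMax m i) * μ ^ (j + 1 - k) := hsplit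
        _ ≤ C ^ k * n k * μ ^ (j + 1 - k) := by gcongr; exact ih k (by omega)
        _ ≤ C ^ k * (n (j + 1) * (C * (1 / μ)) ^ (j + 1 - k)) * μ ^ (j + 1 - k) := by gcongr
        _ = (C ^ k * C ^ (j + 1 - k)) * n (j + 1) := by
          rw [mul_pow, one_div, inv_pow]; field_simp
        _ = C ^ (j + 1) * n (j + 1) := by rw [← pow_add]; congr 2; omega

lemma exists_of_mg_lt_top {M N : ℕ → ℝ} (hM : IsWeightSeq M) (hN : IsWeightSeq N)
    (h : mg M N < ⊤) : ∃ C : ℝ, 1 ≤ C ∧ ∀ j k, M (j + k) ≤ C ^ (j + k) * (N j * N k) := by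
  refine ⟨max 1 (mg M N).toReal, le_max_left _ _, fun j k => ?_⟩
  rcases Nat.eq_zero_or_pos (j + k) with h0 | h0
  · obtain ⟨rfl, rfl⟩ : j = 0 ∧ k = 0 := by omega
    simp [hM.first, hN.first]
  · have h1 : ENNReal.ofReal ((M (j + k) / (N j * N k)) ^ (((j : ℝ) + (k : ℝ))⁻¹)) ≤ mg M N :=
      le_iSup₂_of_le j k (le_iSup_of_le h0 le_rfl)
    have hpos : 0 < M (j + k) / (N j * N k) := div_pos (hM.pos _) (mul_pos (hN.pos _) (hN.pos _))
    have h2 : (M (j + k) / (N j * N k)) ^ (((j : ℝ) + (k : ℝ))⁻¹) ≤ (mg M N).toReal :=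
      (ENNReal.ofReal_le_iff_le_toReal h.ne).mp h1
    have hne : ((j : ℝ) + k) ≠ 0 := by exact_mod_cast h0.ne'
    rw [← div_le_iff₀ (mul_pos (hN.pos _) (hN.pos _))]
    calc M (j + k) / (N j * N k)
        = ((M (j + k) / (N j * N k)) ^ (((j : ℝ) + (k : ℝ))⁻¹)) ^ (j + k) := by
          rw [← Real.rpow_natCast, ← Real.rpow_mul hpos.le]; push_cast
          rw [inv_mul_cancel₀ hne, Real.rpow_one]
      _ ≤ _ := by gcongr; exact h2.trans (le_max_right _ _)

lemma factorial_pow_le (q k : ℕ) : k.factorial ^ q ≤ (q * k).factorial := by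
  induction q with
  | zero => simp
  | succ q ih =>
    rw [pow_succ, Nat.succ_mul]
    exact (Nat.mul_le_mul_right _ ih).trans
      (Nat.le_of_dvd (Nat.factorial_pos _) (Nat.factorial_mul_factorial_dvd_factorial_add _ _))

lemma RAdmissible.exists_pow_le {W : Set (ℕ → ℝ)} (hW : RAdmissible W) (i : ℕ) :
    ∀ M ∈ W, ∃ L ∈ W, ∃ C : ℝ, 1 ≤ C ∧ ∀ k, M (2 ^ i * k) ≤ (C ^ k * L k) ^ (2 ^ i) := by
  induction i with
  | zero => exact fun M hM => ⟨M, hM, 1, le_rfl, fun k => by simp⟩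
  | succ i ih =>
    intro M hM
    obtain ⟨N, hN, hmg⟩ := hW.mgrowth M hM
    obtain ⟨C', hC', h'⟩ := exists_of_mg_lt_top (hW.matrix.weight M hM) (hW.matrix.weight N hN) hmg
    obtain ⟨L, hL, C, hC, h⟩ := ih N hN
    refine ⟨L, hL, C' * C, one_le_mul_of_one_le_of_one_le hC' hC, fun k => ?_⟩
    have h1 := h' (2 ^ i * k) (2 ^ i * k)
    have hNk := (hW.matrix.weight N hN).pos (2 ^ i * k)
    calc M (2 ^ (i + 1) * k) = M (2 ^ i * k + 2 ^ i * k) := by congr 1; ring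
      _ ≤ C' ^ (2 ^ i * k + 2 ^ i * k) * (N (2 ^ i * k) * N (2 ^ i * k)) := h1
      _ ≤ C' ^ (2 ^ i * k + 2 ^ i * k) * ((C ^ k * L k) ^ (2 ^ i) * (C ^ k * L k) ^ (2 ^ i)) := by
        have := h k
        have h0 := hNk.le.trans this
        gcongr
      _ = ((C' * C) ^ k * L k) ^ (2 ^ (i + 1)) := by
        rw [mul_pow C' C k, mul_assoc, mul_pow (C' ^ k), ← pow_mul, ← pow_add]; ring_nf

/-- A monotone quotient sequence dominating `M`, together with the bounds of its product sequence
by members of the weight matrix. -/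
theorem RAdmissible.exists_ratio {W : Set (ℕ → ℝ)} (hW : RAdmissible W) {M : ℕ → ℝ} (hM : M ∈ W) :
    ∃ r : ℕ → ℝ, Monotone r ∧ (∀ j, 0 < r j) ∧ (∀ T : ℝ, ∃ j, T ≤ r j) ∧
      (∀ k, M k ≤ k.factorial * ∏ i ∈ Finset.range k, r i) ∧
      ∀ i : ℕ, ∃ L ∈ W, ∃ C : ℝ, 1 ≤ C ∧ ∀ k : ℕ,
        (∏ l ∈ Finset.range (2 ^ i * (k + 1)), r l ≤
          (C ^ (k + 1) * L k / k.factorial) ^ (2 ^ i)) ∧ (k.factorial : ℝ) ≤ C * L k := by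
  have hMw := hW.matrix.weight M hM
  have hle := le_prod_ratioMax (lc_pos hMw) (lc_zero hMw)
  refine ⟨ratioMax (lc M), ratioMax_mono _, ratioMax_pos (lc_pos hMw), ?_, ?_, ?_⟩
  · intro T
    by_contra! hcon
    have hT0 : 0 < T := (ratioMax_pos (lc_pos hMw) 0).trans (hcon 0)
    obtain ⟨K, hK⟩ := (hW.roots M hM).eventually_pow_le (lc_pos hMw) (T := T + 1) (by linarith)
    have h1 := hK (K + 1) (by omega)
    have h2 : ∏ i ∈ Finset.range (K + 1), ratioMax (lc M) i ≤ T ^ (K + 1) := by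
      refine (Finset.prod_le_prod (fun i _ => (ratioMax_pos (lc_pos hMw) i).le)
        (g := fun _ => T) fun i _ => (hcon i).le).trans ?_
      simp
    have h3 : T ^ (K + 1) < (T + 1) ^ (K + 1) := by gcongr; linarith
    linarith [hle (K + 1)]
  · intro k
    have := hle k
    rw [lc, div_le_iff₀ (by positivity)] at this
    linarith
  · intro i
    obtain ⟨N, hN, C₀, hC₀, hγ⟩ := hW.gamma M hM
    have hNw := hW.matrix.weight N hN
    have hup := prod_ratioMax_le (lc_pos hMw) (lc_pos hNw) (lc_zero hNw) (hW.roots N hN) hC₀ hγ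
    obtain ⟨L, hL, C₁, hC₁, h₁⟩ := hW.exists_pow_le i N hN
    obtain ⟨L', hL', hmg⟩ := hW.mgrowth L hL
    have hLw := hW.matrix.weight L hL
    have hLw' := hW.matrix.weight L' hL'
    obtain ⟨C₂, hC₂, h₂⟩ := exists_of_mg_lt_top hLw hLw' hmg
    obtain ⟨K, hK⟩ := (hW.roots L' hL').eventually_pow_le (lc_pos hLw') one_pos
    set S : ℝ := ∑ k ∈ Finset.range K, k.factorial / L' k with hS
    have hSt : ∀ k ∈ Finset.range K, 0 ≤ (k.factorial : ℝ) / L' k := fun k _ =>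
      div_nonneg (by positivity) (hLw'.pos k).le
    have hS0 : 0 ≤ S := Finset.sum_nonneg hSt
    have hD : 1 ≤ C₀ * C₁ * C₂ * L' 1 :=
      one_le_mul_of_one_le_of_one_le (one_le_mul_of_one_le_of_one_le
        (one_le_mul_of_one_le_of_one_le hC₀ hC₁) hC₂) hLw'.one_le
    refine ⟨L', hL', C₀ * C₁ * C₂ * L' 1 + S, by linarith, fun k => ⟨?_, ?_⟩⟩
    · set q := 2 ^ i with hq
      have hf : ((k.factorial : ℝ)) ^ q ≤ (q * (k + 1)).factorial := by
        have := factorial_pow_le q (k + 1)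
        have h2 : k.factorial ^ q ≤ (q * (k + 1)).factorial :=
          (Nat.pow_le_pow_left (Nat.factorial_le (by omega)) q).trans this
        exact_mod_cast h2
      have hLpos := hLw.pos (k + 1)
      have hLk := hLw'.pos k
      have hL1 := hLw'.one_le
      have hLk1 : L (k + 1) ≤ C₂ ^ (k + 1) * (L' k * L' 1) := h₂ k 1
      calc _ ≤ C₀ ^ (q * (k + 1)) * lc N (q * (k + 1)) := hup _
        _ ≤ C₀ ^ (q * (k + 1)) * ((C₁ ^ (k + 1) * L (k + 1)) ^ q / (k.factorial : ℝ) ^ q) := by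
          rw [lc]
          have := h₁ (k + 1)
          have h0 := hNw.pos (q * (k + 1))
          gcongr
        _ = (C₀ ^ (k + 1) * (C₁ ^ (k + 1) * L (k + 1)) / k.factorial) ^ q := by
          rw [mul_comm q, pow_mul, div_pow, mul_pow (C₀ ^ (k + 1)), mul_div_assoc]
        _ ≤ (C₀ ^ (k + 1) * (C₁ ^ (k + 1) * (C₂ ^ (k + 1) * (L' k * L' 1))) / k.factorial) ^ q := by
          gcongr
        _ = ((C₀ * C₁ * C₂) ^ (k + 1) * L' 1 ^ 1 * L' k / k.factorial) ^ q := by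
          rw [mul_pow, mul_pow]; ring
        _ ≤ ((C₀ * C₁ * C₂) ^ (k + 1) * L' 1 ^ (k + 1) * L' k / k.factorial) ^ q := by
          gcongr
          omega
        _ ≤ _ := by
          rw [← mul_pow]
          gcongr
          linarith
    · have hLk := hLw'.pos k
      rcases lt_or_ge k K with hk | hk
      · have := Finset.single_le_sum hSt (Finset.mem_range.mpr hk)
        rw [← hS, div_le_iff₀ hLk] at this
        nlinarith
      · have := hK k hk
        rw [one_pow, lc, le_div_iff₀ (by positivity)] at this
        nlinarith

end WeightRatios

section TaylorApproximation

lemma exists_switch_index {r : ℕ → ℝ} (hr : Monotone r) (hu : ∀ T : ℝ, ∃ j, T ≤ r j) {t : ℝ}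
    (ht : 0 < t) : ∃ k : ℕ, (∀ i < k, r i * t ≤ 1) ∧ ∀ i, k ≤ i → 1 ≤ r i * t := by
  classical
  have hex : ∃ j, 1 ≤ r j * t := by
    obtain ⟨j, hj⟩ := hu (1 / t)
    exact ⟨j, by rwa [div_le_iff₀ ht] at hj⟩
  refine ⟨Nat.find hex, fun i hi => (not_le.mp (Nat.find_min hex hi)).le, fun i hi => ?_⟩
  have h1 := Nat.find_spec hex
  have h2 := hr hi
  nlinarith

lemma prod_switch_le {r : ℕ → ℝ} (hp : ∀ j, 0 < r j) {t : ℝ} (ht : 0 < t) {k : ℕ}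
    (h1 : ∀ i < k, r i * t ≤ 1) (h2 : ∀ i, k ≤ i → 1 ≤ r i * t) (j : ℕ) :
    ∏ i ∈ Finset.range k, (r i * t) ≤ ∏ i ∈ Finset.range j, (r i * t) := by
  have h0 : ∀ i, 0 ≤ r i * t := fun i => (mul_pos (hp i) ht).le
  rcases le_total j k with h | h
  · rw [← Finset.prod_range_mul_prod_Ico _ h]
    refine mul_le_of_le_one_right (Finset.prod_nonneg fun i _ => h0 i) ?_
    exact Finset.prod_le_one (fun i _ => h0 i) fun i hi => h1 i (Finset.mem_Ico.mp hi).2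
  · rw [← Finset.prod_range_mul_prod_Ico _ h]
    refine le_mul_of_one_le_right (Finset.prod_nonneg fun i _ => h0 i) ?_
    calc (1 : ℝ) = ∏ i ∈ Finset.Ico k j, (1 : ℝ) := by simp
      _ ≤ _ := Finset.prod_le_prod (fun _ _ => zero_le_one) fun i hi => h2 i (Finset.mem_Ico.mp hi).1

lemma norm_sub_taylor_sum_le_of_nonneg {h : ℝ → ℂ} (hh : ContDiff ℝ (⊤ : ℕ∞) h) {k : ℕ} {B : ℝ}
    (hb : ∀ s, |s| ≤ 1 → ‖iteratedDeriv k h s‖ ≤ B) {s : ℝ} (hs0 : 0 ≤ s) (hs : s ≤ 1) :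
    ‖h s - ∑ j ∈ Finset.range k, (iteratedDeriv j h 0 / j.factorial) * (s : ℂ) ^ j‖ ≤
      B * 2 ^ k / k.factorial := by
  have hB : 0 ≤ B := (norm_nonneg _).trans (hb 0 (by simp))
  rcases k with _ | n
  · simpa using hb s (by rwa [abs_of_nonneg hs0])
  · have hu := uniqueDiffOn_Icc (zero_lt_one' ℝ)
    have hd : ∀ j, ∀ y ∈ Icc (0 : ℝ) 1, iteratedDerivWithin j h (Icc 0 1) y = iteratedDeriv j h y :=
      fun j y hy => iteratedDerivWithin_eq_iteratedDeriv hu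
        (hh.contDiffAt.of_le (by exact_mod_cast le_top)) hy
    have hmain := taylor_mean_remainder_bound (n := n) (C := B) zero_le_one
      (hh.of_le (by exact_mod_cast le_top)).contDiffOn
      (show s ∈ Icc (0 : ℝ) 1 from ⟨hs0, hs⟩) (fun y hy => by
        rw [hd _ y hy]; exact hb y (by rw [abs_of_nonneg hy.1]; exact hy.2))
    rw [taylor_within_apply] at hmain
    have e : ∑ j ∈ Finset.range (n + 1), (iteratedDeriv j h 0 / j.factorial) * (s : ℂ) ^ j =
        ∑ j ∈ Finset.range (n + 1), ((j.factorial : ℝ)⁻¹ * (s - 0) ^ j) •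
          iteratedDerivWithin j h (Icc 0 1) 0 := by
      refine Finset.sum_congr rfl fun j _ => ?_
      rw [hd j 0 (by simp), Complex.real_smul]; push_cast
      rw [sub_zero]; ring
    rw [e]
    refine hmain.trans ?_
    rw [sub_zero, div_le_div_iff₀ (by positivity) (by positivity), Nat.factorial_succ]
    have h1 : s ^ (n + 1) ≤ 1 := pow_le_one₀ hs0 hs
    have h2 : ((n + 1 : ℕ) : ℝ) ≤ 2 ^ (n + 1) := by exact_mod_cast (Nat.lt_two_pow_self).le
    push_cast at h2 ⊢
    calc B * s ^ (n + 1) * ((n + 1) * n.factorial)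
        ≤ B * 1 * (2 ^ (n + 1) * n.factorial) := by gcongr
      _ = _ := by ring

lemma norm_sub_taylor_sum_le {h : ℝ → ℂ} (hh : ContDiff ℝ (⊤ : ℕ∞) h) {k : ℕ} {B : ℝ}
    (hb : ∀ s, |s| ≤ 1 → ‖iteratedDeriv k h s‖ ≤ B) {s : ℝ} (hs : |s| ≤ 1) :
    ‖h s - ∑ j ∈ Finset.range k, (iteratedDeriv j h 0 / j.factorial) * (s : ℂ) ^ j‖ ≤
      B * 2 ^ k / k.factorial := by
  rw [abs_le] at hs
  rcases le_total 0 s with h0 | h0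
  · exact norm_sub_taylor_sum_le_of_nonneg hh hb h0 hs.2
  · have := norm_sub_taylor_sum_le_of_nonneg (h := fun x => h (-x)) (k := k) (B := B)
      (hh.comp contDiff_neg) (fun y hy => by
        rw [iteratedDeriv_comp_neg, norm_smul]
        simpa using hb (-y) (by simpa using hy)) (s := -s) (by linarith) (by linarith)
    simp only [iteratedDeriv_comp_neg, neg_neg, neg_zero] at this
    convert this using 4 with j
    push_cast
    rw [neg_pow (s : ℂ), Complex.real_smul]
    push_cast
    have h1 : ((-1 : ℂ)) ^ j * (-1) ^ j = 1 := by rw [← mul_pow]; simp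
    linear_combination (-(iteratedDeriv j h 0 / j.factorial * (s : ℂ) ^ j)) * h1

/-- Taylor polynomials of near-optimal degree approximate ultradifferentiable functions. -/
lemma exists_taylor_approx {r : ℕ → ℝ} (hp : ∀ j, 0 < r j) {t : ℝ} (ht : 0 < t) {k : ℕ}
    (h1 : ∀ i < k, r i * t ≤ 1) {C : ℝ} (hC : 0 ≤ C) {h : ℝ → ℂ}
    (hh : ContDiff ℝ (⊤ : ℕ∞) h)
    (hb : ∀ j, ∀ s, |s| ≤ 1 → ‖iteratedDeriv j h s‖ ≤
      C * j.factorial * (∏ i ∈ Finset.range j, r i) * (t / 2) ^ j) :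
    ∃ G : ℂ → ℂ, Differentiable ℂ G ∧ (∀ z ∈ ball (0 : ℂ) 1, ‖G z‖ ≤ ‖h 0‖ + C * r 0 * t) ∧
      ∀ s : ℝ, |s| < 1 → ‖G s - h s‖ ≤ C * ∏ i ∈ Finset.range k, (r i * t) := by
  have hprod : ∀ j, ∏ i ∈ Finset.range j, (r i * t) = (∏ i ∈ Finset.range j, r i) * t ^ j := by
    intro j; rw [Finset.prod_mul_distrib]; simp
  refine ⟨fun z => ∑ j ∈ Finset.range k, (iteratedDeriv j h 0 / j.factorial) * z ^ j, by fun_prop,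
    ?_, ?_⟩
  · intro z hz
    have hz1 : ‖z‖ ≤ 1 := by simpa using (mem_ball.mp hz).le
    rcases k with _ | k
    · simp
      have := hp 0
      positivity
    · beta_reduce
      rw [Finset.sum_range_succ']
      refine (norm_add_le _ _).trans ?_
      rw [add_comm]
      gcongr
      · simp
      · refine (norm_sum_le _ _).trans ?_
        have hterm : ∀ j ∈ Finset.range k, ‖iteratedDeriv (j + 1) h 0 / ((j + 1).factorial : ℂ) *
            z ^ (j + 1)‖ ≤ C * r 0 * t * ((1 / 2) * (1 / 2) ^ j) := by
          intro j hj
          have hj : j < k := by simpa using hj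
          rw [norm_mul, norm_div, norm_pow]
          have hle : ∏ i ∈ Finset.range (j + 1), (r i * t) ≤ r 0 * t := by
            rw [Finset.prod_range_succ']
            refine mul_le_of_le_one_left (mul_pos (hp 0) ht).le ?_
            exact Finset.prod_le_one (fun i _ => (mul_pos (hp _) ht).le) fun i hi =>
              h1 _ (by simp at hi; omega)
          calc _ ≤ (C * (j + 1).factorial * (∏ i ∈ Finset.range (j + 1), r i) * (t / 2) ^ (j + 1)) /
                ‖((j + 1).factorial : ℂ)‖ * 1 := by
                have hbj := hb (j + 1) 0 (by simp)
                have hb0 := (norm_nonneg _).trans hbj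
                gcongr
                exact pow_le_one₀ (norm_nonneg _) hz1
            _ = C * (∏ i ∈ Finset.range (j + 1), (r i * t)) * ((1 / 2) * (1 / 2) ^ j) := by
                rw [hprod, Complex.norm_natCast, div_pow, ← pow_succ', div_pow, one_pow]
                field_simp
            _ ≤ C * (r 0 * t) * ((1 / 2) * (1 / 2) ^ j) := by gcongr
            _ = _ := by ring
        refine (Finset.sum_le_sum hterm).trans ?_
        rw [← Finset.mul_sum, ← Finset.mul_sum]
        have hg : ∑ j ∈ Finset.range k, (1 / 2 : ℝ) ^ j ≤ 2 := by
          have := Summable.sum_le_tsum (Finset.range k) (fun _ _ => by positivity)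
            summable_geometric_two
          rwa [tsum_geometric_two] at this
        have h0 : 0 ≤ C * r 0 * t := by have := hp 0; positivity
        nlinarith
  · intro s hs
    rw [norm_sub_rev]
    refine (norm_sub_taylor_sum_le hh (hb k) hs.le).trans (le_of_eq ?_)
    rw [hprod, div_pow]
    field_simp

end TaylorApproximation

section InheritedApproximation

/-- `ψ` is approximated on `(-1, 1)` up to `η` by a holomorphic function on the unit disc bounded
by `B`. -/
def Approx (ψ : ℝ → ℂ) (B η : ℝ) : Prop :=
  ∃ G : ℂ → ℂ, DifferentiableOn ℂ G (ball 0 1) ∧ (∀ z ∈ ball (0 : ℂ) 1, ‖G z‖ ≤ B) ∧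
    ∀ s : ℝ, |s| < 1 → ‖G s - ψ s‖ ≤ η

lemma ofReal_mem_ball_one {s : ℝ} (hs : |s| < 1) : (s : ℂ) ∈ ball (0 : ℂ) 1 := by simpa using hs

lemma Approx.add {ψ₁ ψ₂ : ℝ → ℂ} {B₁ B₂ η₁ η₂ : ℝ} (h₁ : Approx ψ₁ B₁ η₁) (h₂ : Approx ψ₂ B₂ η₂) :
    Approx (fun s => ψ₁ s + ψ₂ s) (B₁ + B₂) (η₁ + η₂) := by
  obtain ⟨G₁, d₁, b₁, e₁⟩ := h₁
  obtain ⟨G₂, d₂, b₂, e₂⟩ := h₂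
  refine ⟨fun z => G₁ z + G₂ z, d₁.add d₂, fun z hz => (norm_add_le _ _).trans
    (add_le_add (b₁ z hz) (b₂ z hz)), fun s hs => ?_⟩
  rw [add_sub_add_comm]
  exact (norm_add_le _ _).trans (add_le_add (e₁ s hs) (e₂ s hs))

lemma Approx.neg {ψ : ℝ → ℂ} {B η : ℝ} (h : Approx ψ B η) : Approx (fun s => -ψ s) B η := by
  obtain ⟨G, d, b, e⟩ := h
  refine ⟨fun z => -G z, d.neg, fun z hz => by simpa using b z hz, fun s hs => ?_⟩
  rw [← neg_sub', norm_neg]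
  exact e s hs

lemma Approx.mul {ψ₁ ψ₂ : ℝ → ℂ} {B₁ B₂ η₁ η₂ : ℝ} (h₁ : Approx ψ₁ B₁ η₁) (h₂ : Approx ψ₂ B₂ η₂) :
    Approx (fun s => ψ₁ s * ψ₂ s) (B₁ * B₂) (B₁ * η₂ + η₁ * (B₂ + η₂)) := by
  obtain ⟨G₁, d₁, b₁, e₁⟩ := h₁
  obtain ⟨G₂, d₂, b₂, e₂⟩ := h₂
  refine ⟨fun z => G₁ z * G₂ z, d₁.mul d₂, fun z hz => ?_, fun s hs => ?_⟩
  · rw [norm_mul]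
    exact mul_le_mul (b₁ z hz) (b₂ z hz) (norm_nonneg _) ((norm_nonneg _).trans (b₁ z hz))
  · have hs' := ofReal_mem_ball_one hs
    have e : G₁ s * G₂ s - ψ₁ s * ψ₂ s = G₁ s * (G₂ s - ψ₂ s) + (G₁ s - ψ₁ s) * ψ₂ s := by ring
    have hψ : ‖ψ₂ s‖ ≤ B₂ + η₂ := by
      have := norm_sub_norm_le (ψ₂ s) (G₂ s)
      rw [norm_sub_rev] at this
      linarith [b₂ _ hs', e₂ s hs]
    rw [e]
    refine (norm_add_le _ _).trans (add_le_add ?_ ?_)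
    · rw [norm_mul]
      exact mul_le_mul (b₁ _ hs') (e₂ s hs) (norm_nonneg _) ((norm_nonneg _).trans (b₁ _ hs'))
    · rw [norm_mul]
      exact mul_le_mul (e₁ s hs) hψ (norm_nonneg _) ((norm_nonneg _).trans (e₁ s hs))

lemma Approx.mono {ψ : ℝ → ℂ} {B η B' η' : ℝ} (h : Approx ψ B η) (hB : B ≤ B') (hη : η ≤ η') :
    Approx ψ B' η' := by
  obtain ⟨G, d, b, e⟩ := h
  exact ⟨G, d, fun z hz => (b z hz).trans hB, fun s hs => (e s hs).trans hη⟩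

lemma Approx.congr {ψ ψ' : ℝ → ℂ} {B η : ℝ} (h : Approx ψ B η) (hc : ∀ s, |s| < 1 → ψ s = ψ' s) :
    Approx ψ' B η := by
  obtain ⟨G, d, b, e⟩ := h
  exact ⟨G, d, b, fun s hs => hc s hs ▸ e s hs⟩

/-- Germs `u` for which `u ∘ φ` inherits holomorphic approximability from the family `Φ i ∘ φ`. -/
def Inherits {ι : Type*} (Φ : ι → ℂ → ℂ) (u : ℂ → ℂ) : Prop :=
  ∃ B κ : ℝ, 0 ≤ B ∧ 0 < κ ∧ ∀ (φ : ℝ → ℂ) (η : ℝ), 0 ≤ η → η ≤ 1 →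
    (∀ s, |s| < 1 → ‖φ s‖ ≤ κ) → (∀ i, Approx (fun s => Φ i (φ s)) κ η) →
      Approx (fun s => u (φ s)) B (B * η)

namespace Inherits

variable {ι : Type*} {Φ : ι → ℂ → ℂ} {u v : ℂ → ℂ}

lemma of_index (i : ι) : Inherits Φ (Φ i) :=
  ⟨1, 1, zero_le_one, one_pos, fun φ η _ _ _ h => by simpa using h i⟩

lemma neg (hu : Inherits Φ u) : Inherits Φ (fun t => -u t) := by
  obtain ⟨B, κ, hB, hκ, h⟩ := hu
  exact ⟨B, κ, hB, hκ, fun φ η h0 h1 hφ hi => (h φ η h0 h1 hφ hi).neg⟩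

lemma add (hu : Inherits Φ u) (hv : Inherits Φ v) : Inherits Φ (fun t => u t + v t) := by
  obtain ⟨B, κ, hB, hκ, h⟩ := hu
  obtain ⟨B', κ', hB', hκ', h'⟩ := hv
  refine ⟨B + B', min κ κ', by positivity, lt_min hκ hκ', fun φ η h0 h1 hφ hi => ?_⟩
  rw [add_mul]
  exact (h φ η h0 h1 (fun s hs => (hφ s hs).trans (min_le_left _ _))
      fun i => (hi i).mono (min_le_left _ _) le_rfl).add
    (h' φ η h0 h1 (fun s hs => (hφ s hs).trans (min_le_right _ _))
      fun i => (hi i).mono (min_le_right _ _) le_rfl)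

lemma mul (hu : Inherits Φ u) (hv : Inherits Φ v) : Inherits Φ (fun t => u t * v t) := by
  obtain ⟨B, κ, hB, hκ, h⟩ := hu
  obtain ⟨B', κ', hB', hκ', h'⟩ := hv
  refine ⟨3 * (B * B'), min κ κ', by positivity, lt_min hκ hκ', fun φ η h0 h1 hφ hi => ?_⟩
  have hBB : 0 ≤ B * B' := by positivity
  refine ((h φ η h0 h1 (fun s hs => (hφ s hs).trans (min_le_left _ _))
      fun i => (hi i).mono (min_le_left _ _) le_rfl).mul
    (h' φ η h0 h1 (fun s hs => (hφ s hs).trans (min_le_right _ _))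
      fun i => (hi i).mono (min_le_right _ _) le_rfl)).mono (by linarith) ?_
  have h2 : η * η ≤ η := by nlinarith
  nlinarith

lemma congr (hu : Inherits Φ u) (h : u =ᶠ[𝓝 0] v) : Inherits Φ v := by
  obtain ⟨B, κ, hB, hκ, hu⟩ := hu
  obtain ⟨ε, hε, he⟩ := Metric.eventually_nhds_iff_ball.mp h
  refine ⟨B, min κ (ε / 2), hB, by positivity, fun φ η h0 h1 hφ hi => ?_⟩
  refine (hu φ η h0 h1 (fun s hs => (hφ s hs).trans (min_le_left _ _))
      fun i => (hi i).mono (min_le_left _ _) le_rfl).congr fun s hs => he _ ?_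
  have := (hφ s hs).trans (min_le_right _ _)
  simp only [mem_ball_zero_iff]
  linarith

lemma comp_analytic {c : ℂ → ℂ} (hc : AnalyticAt ℂ c 0) {p : ℕ} (hp : 1 ≤ p) {i : ι}
    (hi : ∀ᶠ t in 𝓝 (0 : ℂ), Φ i t = t ^ p) : Inherits Φ (fun t => c (t ^ p)) := by
  obtain ⟨L, S, hS, hL⟩ := (hc.contDiffAt (n := 1)).exists_lipschitzOnWith
  have hd : ∀ᶠ w in 𝓝 (0 : ℂ), DifferentiableAt ℂ c w :=
    hc.eventually_analyticAt.mono fun w hw => hw.differentiableAt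
  obtain ⟨ε, hε, he⟩ := Metric.eventually_nhds_iff_ball.mp (hd.and hS)
  obtain ⟨ε', hε', he'⟩ := Metric.eventually_nhds_iff_ball.mp hi
  set κ := min (min (ε / 2) (ε' / 2)) 1 with hκ
  have hκ0 : 0 < κ := by positivity
  have hκ1 : κ ≤ 1 := min_le_right _ _
  have hκε : κ < ε := by
    have : κ ≤ ε / 2 := (min_le_left _ _).trans (min_le_left _ _)
    linarith
  have hκε' : κ < ε' := by
    have : κ ≤ ε' / 2 := (min_le_left _ _).trans (min_le_right _ _)
    linarith
  have hlip : ∀ a b : ℂ, ‖a‖ ≤ κ → ‖b‖ ≤ κ → ‖c a - c b‖ ≤ L * ‖a - b‖ := by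
    intro a b ha hb
    rw [← dist_eq_norm, ← dist_eq_norm]
    exact hL.dist_le_mul a (he a (by simpa using ha.trans_lt hκε)).2 b
      (he b (by simpa using hb.trans_lt hκε)).2
  refine ⟨‖c 0‖ + L, κ, by positivity, hκ0, fun φ η h0 h1 hφ h => ?_⟩
  obtain ⟨G, d, b, e⟩ := h i
  refine ⟨fun z => c (G z), ?_, ?_, ?_⟩
  · intro z hz
    exact ((he (G z) (by simpa using (b z hz).trans_lt hκε)).1.comp_differentiableWithinAt z (d z hz))
  · intro z hz
    have h1 := hlip (G z) 0 (b z hz) (by simpa using hκ0.le)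
    have h2 := norm_sub_norm_le (c (G z)) (c 0)
    rw [sub_zero] at h1
    have h3 : L * ‖G z‖ ≤ L * 1 := by gcongr; exact (b z hz).trans hκ1
    linarith
  · intro s hs
    have hφs := hφ s hs
    have hp' : ‖φ s ^ p‖ ≤ κ := by
      rw [norm_pow]
      exact (pow_le_of_le_one (norm_nonneg _) (hφs.trans hκ1) (by omega)).trans hφs
    have h1 := hlip (G s) (φ s ^ p) (b _ (ofReal_mem_ball_one hs)) hp'
    have h2 := e s hs
    beta_reduce at h2
    rw [he' (φ s) (by simpa using hφs.trans_lt hκε')] at h2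
    calc _ ≤ L * ‖G s - φ s ^ p‖ := h1
      _ ≤ L * η := by gcongr
      _ ≤ _ := by nlinarith [norm_nonneg (c 0)]

end Inherits

lemma exists_analytic_comp_pow {s : ℂ → ℂ} (hs : AnalyticAt ℂ s 0) {p : ℕ} (hp : 1 ≤ p) {ζ : ℂ}
    (hζ : IsPrimitiveRoot ζ p) : ∃ c : ℂ → ℂ, AnalyticAt ℂ c 0 ∧
      ∀ᶠ t in 𝓝 (0 : ℂ), ∑ l ∈ Finset.range p, s (ζ ^ l * t) = c (t ^ p) := by
  obtain ⟨P, hP⟩ := hs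
  rw [hasFPowerSeriesAt_iff] at hP
  simp only [zero_add, smul_eq_mul] at hP
  have hsum : ∀ᶠ t in 𝓝 (0 : ℂ), HasSum (fun k => (t ^ p) ^ k * (p * P.coeff (p * k)))
      (∑ l ∈ Finset.range p, s (ζ ^ l * t)) := by
    have hall : ∀ᶠ t in 𝓝 (0 : ℂ), ∀ l ∈ Finset.range p,
        HasSum (fun n => (ζ ^ l * t) ^ n * P.coeff n) (s (ζ ^ l * t)) := by
      rw [Filter.eventually_all_finset]
      intro l _
      have : Tendsto (fun t : ℂ => ζ ^ l * t) (𝓝 0) (𝓝 0) := by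
        have : Continuous (fun t : ℂ => ζ ^ l * t) := by fun_prop
        simpa using this.tendsto 0
      exact this.eventually hP
    filter_upwards [hall] with t ht
    have h := hasSum_sum ht
    have hgeom : ∀ k : ℕ, ∑ l ∈ Finset.range p, (ζ ^ l * t) ^ k * P.coeff k =
        (∑ l ∈ Finset.range p, (ζ ^ k) ^ l) * (t ^ k * P.coeff k) := by
      intro k
      rw [Finset.sum_mul]
      refine Finset.sum_congr rfl fun l _ => ?_
      rw [mul_pow, ← pow_mul, ← pow_mul, mul_comm l k]; ring
    have hinj : Function.Injective fun k : ℕ => p * k := mul_right_injective₀ (show p ≠ 0 by omega)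
    rw [← hinj.hasSum_iff] at h
    · convert h using 1
      ext k
      simp only [Function.comp]
      rw [hgeom, pow_mul ζ, hζ.pow_eq_one]
      simp [← pow_mul]; ring
    · intro k hk
      rw [hgeom]
      have hne : ζ ^ k ≠ 1 := by
        intro h1
        obtain ⟨m, hm⟩ := hζ.dvd_of_pow_eq_one k h1
        exact hk ⟨m, hm.symm⟩
      have : ∑ l ∈ Finset.range p, (ζ ^ k) ^ l = 0 := by
        rw [geom_sum_eq hne, ← pow_mul, mul_comm, pow_mul, hζ.pow_eq_one]; simp
      rw [this, zero_mul]
  obtain ⟨ε, hε, he⟩ := Metric.eventually_nhds_iff_ball.mp hsum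
  refine ⟨fun w => ∑' k, w ^ k * (p * P.coeff (p * k)), ?_, ?_⟩
  · refine ⟨FormalMultilinearSeries.ofScalars ℂ fun k => p * P.coeff (p * k), ?_⟩
    rw [hasFPowerSeriesAt_iff]
    filter_upwards [ball_mem_nhds (0 : ℂ) (pow_pos hε p)] with w hw
    obtain ⟨t, rfl⟩ := IsAlgClosed.exists_pow_nat_eq w (show 0 < p by omega)
    have ht : t ∈ ball (0 : ℂ) ε := by
      rw [mem_ball_zero_iff, norm_pow] at hw
      rw [mem_ball_zero_iff]
      exact lt_of_pow_lt_pow_left₀ p hε.le hw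
    simpa [FormalMultilinearSeries.coeff_ofScalars] using (he t ht).summable.hasSum
  · filter_upwards [hsum] with t ht
    exact ht.tsum_eq.symm

lemma inherits_sum_prod {ι : Type*} {Φ : ι → ℂ → ℂ} {p : ℕ} (hp : 1 ≤ p) {ζ : ℂ}
    (hζ : IsPrimitiveRoot ζ p) {i₀ : ι} (h₀ : ∀ᶠ t in 𝓝 (0 : ℂ), Φ i₀ t = t ^ p)
    (i : ℕ → ι) (y : ℕ → ℂ → ℂ) (hy : ∀ j, AnalyticAt ℂ (y j) 0) (Z : Finset ℕ) :
    ∀ s : ℂ → ℂ, AnalyticAt ℂ s 0 → Inherits Φ (fun t => ∑ l ∈ Finset.range p,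
      s (ζ ^ l * t) * ∏ j ∈ Z, (Φ (i j) t - y j (ζ ^ l * t))) := by
  classical
  induction Z using Finset.induction_on with
  | empty =>
    intro s hs
    obtain ⟨c, hc, h⟩ := exists_analytic_comp_pow hs hp hζ
    refine (Inherits.comp_analytic hc hp h₀).congr ?_
    filter_upwards [h] with t ht
    simp [ht]
  | insert j Z hj ih =>
    intro s hs
    refine (((Inherits.of_index (i j)).mul (ih s hs)).add
      (ih (fun t => s t * y j t) (hs.mul (hy j))).neg).congr (.of_forall fun t => ?_)
    simp only
    rw [Finset.mul_sum, ← Finset.sum_neg_distrib, ← Finset.sum_add_distrib]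
    refine Finset.sum_congr rfl fun l _ => ?_
    rw [Finset.prod_insert hj]; ring

/-- If a family of germs containing `t ^ p` separates the `p`-th roots of unity, then all
sufficiently high powers inherit approximability from it. -/
theorem exists_inherits_pow {ι : Type*} {Φ : ι → ℂ → ℂ} (hΦ : ∀ i, AnalyticAt ℂ (Φ i) 0) {p : ℕ}
    (hp : 1 ≤ p) {i₀ : ι} (h₀ : ∀ᶠ t in 𝓝 (0 : ℂ), Φ i₀ t = t ^ p)
    (hsep : ∀ z : ℂ, z ^ p = 1 → z ≠ 1 → ∃ i, ¬ ∀ᶠ t in 𝓝 (0 : ℂ), Φ i (z * t) = Φ i t) :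
    ∃ N : ℕ, 1 ≤ N ∧ ∀ e, N ≤ e → Inherits Φ (fun t => t ^ e) := by
  have hζ := Complex.isPrimitiveRoot_exp p (by omega)
  set ζ := Complex.exp (2 * Real.pi * Complex.I / p) with hζdef
  have hz : ∀ j ∈ Finset.Ico 1 p, ∃ i, ¬ ∀ᶠ t in 𝓝 (0 : ℂ), Φ i (ζ ^ j * t) = Φ i t := by
    intro j hj
    rw [Finset.mem_Ico] at hj
    exact hsep _ (by rw [← pow_mul, mul_comm, pow_mul, hζ.pow_eq_one, one_pow])
      (hζ.pow_ne_one_of_pos_of_lt (by omega) hj.2)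
  have hz' : ∀ j, ∃ i, j ∈ Finset.Ico 1 p → ¬ ∀ᶠ t in 𝓝 (0 : ℂ), Φ i (ζ ^ j * t) = Φ i t := by
    intro j
    by_cases hj : j ∈ Finset.Ico 1 p
    · exact (hz j hj).imp fun i hi _ => hi
    · exact ⟨i₀, fun h => absurd h hj⟩
  choose i hi using hz'
  set y : ℕ → ℂ → ℂ := fun j t => Φ (i j) (ζ ^ j * t) with hydef
  have hy : ∀ j, AnalyticAt ℂ (y j) 0 := fun j =>
    AnalyticAt.fun_comp (by simpa using hΦ (i j)) (by fun_prop)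
  set D : ℂ → ℂ := fun t => ∏ j ∈ Finset.Ico 1 p, (Φ (i j) t - y j t) with hD
  have hDa : AnalyticAt ℂ D 0 := Finset.analyticAt_fun_prod _ fun j _ => (hΦ (i j)).sub (hy j)
  have hDne : ¬ ∀ᶠ t in 𝓝 (0 : ℂ), D t = 0 := by
    have hne : ∀ᶠ t in 𝓝[≠] (0 : ℂ), ∀ j ∈ Finset.Ico 1 p, Φ (i j) t - y j t ≠ 0 := by
      rw [Filter.eventually_all_finset]
      intro j hj
      rcases ((hΦ (i j)).sub (hy j)).eventually_eq_zero_or_eventually_ne_zero with h | h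
      · exact absurd (h.mono fun t ht => (sub_eq_zero.mp ht).symm) (hi j hj)
      · exact h
    intro hcon
    obtain ⟨t, ht, h0⟩ := (hne.and (hcon.filter_mono nhdsWithin_le_nhds)).exists
    exact Finset.prod_ne_zero_iff.mpr ht h0
  obtain ⟨a, w, hw, hw0, hDw⟩ := hDa.exists_eventuallyEq_pow_smul_nonzero_iff.mpr hDne
  refine ⟨a + 1, by omega, fun e he => ?_⟩
  set g : ℂ → ℂ := fun t => t ^ (e - a) / w t with hg
  have hga : AnalyticAt ℂ g 0 := (analyticAt_id.pow _).div hw hw0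
  refine (inherits_sum_prod hp hζ h₀ i y hy (Finset.Ico 1 p) g hga).congr ?_
  filter_upwards [hDw, hw.continuousAt.eventually_ne hw0] with t hDt hwt
  rw [Finset.sum_eq_single_of_mem 0 (Finset.mem_range.mpr hp)]
  · simp only [pow_zero, one_mul]
    change g t * D t = t ^ e
    rw [hDt, hg]
    simp only [sub_zero, smul_eq_mul]
    field_simp
    rw [← pow_add]; congr 1; omega
  · intro l hl hl0
    rw [Finset.mem_range] at hl
    rw [Finset.prod_eq_zero (i := p - l) (by rw [Finset.mem_Ico]; omega), mul_zero]
    simp only [hydef]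
    rw [← mul_assoc, ← pow_add, Nat.sub_add_cancel hl.le, hζ.pow_eq_one, one_mul, sub_self]

end InheritedApproximation

section FiniteDifferences

/-- Iterated forward differences are controlled by the derivative of the same order. -/
lemma norm_fwdDiff_iter_sub_le {s : ℝ} (hs : 0 ≤ s) {k : ℕ} :
    ∀ {h : ℕ → ℝ → ℂ} {a A : ℝ} {c : ℂ},
      (∀ j < k, ∀ x ∈ Icc a (a + k * s), HasDerivAt (h j) (h (j + 1) x) x) →
      (∀ x ∈ Icc a (a + k * s), ‖h k x - c‖ ≤ A) →
      ‖(fwdDiff s)^[k] (h 0) a - (s : ℂ) ^ k * c‖ ≤ A * s ^ k := by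
  induction k with
  | zero =>
    intro h a A c _ h2
    simpa using h2 a (by simp)
  | succ k ih =>
    intro h a A c h1 h2
    push_cast at h1 h2
    have hks : (0 : ℝ) ≤ k * s := by positivity
    have hi := ih (h := fun j => fwdDiff s (h j)) (a := a) (A := A * s) (c := s * c) ?_ ?_
    · rw [Function.iterate_succ_apply]
      rw [show (s : ℂ) ^ (k + 1) * c = (s : ℂ) ^ k * (s * c) by ring,
        show A * s ^ (k + 1) = A * s * s ^ k by ring]
      exact hi
    · intro j hj x hx
      refine HasDerivAt.sub ?_ (h1 j (by omega) x ⟨hx.1, by linarith [hx.2]⟩)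
      exact (h1 j (by omega) (x + s) ⟨by linarith [hx.1], by linarith [hx.2]⟩).comp_add_const x s
    · intro x hx
      have hmv := Convex.norm_image_sub_le_of_norm_hasDerivWithin_le (f := fun y => h k y - y * c)
        (f' := fun y => h (k + 1) y - c) (s := Icc x (x + s)) (x := x) (y := x + s) (C := A)
        (fun y hy => ?_) (fun y hy => h2 y ⟨by linarith [hx.1, hy.1], by linarith [hx.2, hy.2]⟩)
        (convex_Icc _ _) (by simp [hs]) (by simp [hs])
      · rw [add_sub_cancel_left, Real.norm_of_nonneg hs] at hmv
        have he : h k (x + s) - h k x - s * c =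
            (h k (x + s) - ((x + s : ℝ) : ℂ) * c) - (h k x - x * c) := by push_cast; ring
        change ‖h k (x + s) - h k x - s * c‖ ≤ A * s
        rw [he]
        exact hmv
      · have hd := h1 k (by omega) y ⟨by linarith [hx.1, hy.1], by linarith [hx.2, hy.2]⟩
        have hl : HasDerivAt (fun y : ℝ => (y : ℂ) * c) c y := by
          simpa using (Complex.ofRealCLM.hasDerivAt (x := y)).mul_const c
        exact (hd.sub hl).hasDerivWithinAt

lemma norm_fwdDiff_iter_le {f : ℝ → ℂ} {s a A : ℝ} {k : ℕ}
    (h : ∀ i : ℕ, i ≤ k → ‖f (a + i * s)‖ ≤ A) : ‖(fwdDiff s)^[k] f a‖ ≤ 2 ^ k * A := by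
  rw [fwdDiff_iter_eq_sum_shift]
  refine (norm_sum_le _ _).trans ?_
  calc _ ≤ ∑ i ∈ Finset.range (k + 1), (k.choose i : ℝ) * A := by
        refine Finset.sum_le_sum fun i hi => ?_
        rw [zsmul_eq_mul, norm_mul]
        have : ‖(((-1 : ℤ) ^ (k - i) * k.choose i : ℤ) : ℂ)‖ = k.choose i := by
          push_cast; simp
        rw [this, nsmul_eq_mul]
        gcongr
        exact h i (by simp at hi; omega)
    _ = 2 ^ k * A := by
        rw [← Finset.sum_mul]
        congr 1
        exact_mod_cast Nat.sum_range_choose k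

lemma norm_fwdDiff_iter_le_of_differentiableOn {u : ℂ → ℂ} {R A s : ℝ} {k : ℕ} (hR : 0 < R)
    (hu : DifferentiableOn ℂ u (ball 0 R)) (hA : ∀ z : ℂ, ‖z‖ < R → ‖u z‖ ≤ A) (hs : 0 ≤ s)
    (hks : k * s ≤ R / 4) :
    ‖(fwdDiff s)^[k] (fun x : ℝ => u x) 0‖ ≤ k.factorial * A / (R / 4) ^ k * s ^ k := by
  have ha : ∀ x : ℝ, x ∈ Icc 0 (0 + k * s) → (x : ℂ) ∈ ball (0 : ℂ) R := by
    intro x hx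
    rw [zero_add] at hx
    simp only [mem_ball_zero_iff, Complex.norm_real, Real.norm_of_nonneg hx.1]
    linarith [hx.2]
  have han : AnalyticOnNhd ℂ u (ball 0 R) := hu.analyticOnNhd isOpen_ball
  have h := norm_fwdDiff_iter_sub_le hs (k := k) (h := fun j x => iteratedDeriv j u x) (a := 0)
    (A := k.factorial * A / (R / 4) ^ k) (c := 0) ?_ ?_
  · simpa using h
  · intro j _ x hx
    have hd : DifferentiableAt ℂ (iteratedDeriv j u) x := by
      rw [iteratedDeriv_eq_iterate]
      exact ((han x (ha x hx)).iterated_deriv j).differentiableAt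
    have := hd.hasDerivAt.comp_ofReal
    rwa [← iteratedDeriv_succ] at this
  · intro x hx
    rw [sub_zero]
    have hx' := hx
    rw [zero_add] at hx'
    have hsub : closedBall (x : ℂ) (R / 4) ⊆ ball 0 R := by
      intro y hy
      have h1 : ‖y - x‖ ≤ R / 4 := by simpa [dist_eq_norm] using hy
      have h2 := norm_sub_norm_le y x
      rw [Complex.norm_real, Real.norm_of_nonneg hx'.1] at h2
      simp only [mem_ball_zero_iff]; linarith [hx'.2]
    refine Complex.norm_iteratedDeriv_le_of_forall_mem_sphere_norm_le k (by positivity)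
      ((hu.mono ?_).diffContOnCl) (fun y hy => hA y ?_)
    · rw [closure_ball _ (by positivity)]; exact hsub
    · simpa using hsub (sphere_subset_closedBall hy)

lemma pow_self_le_exp_mul_factorial (k : ℕ) : (k : ℝ) ^ k ≤ 3 ^ k * k.factorial := by
  have h := Real.pow_div_factorial_le_exp (k : ℝ) (by positivity) k
  rw [div_le_iff₀ (by positivity)] at h
  refine h.trans ?_
  gcongr
  rw [← mul_one (k : ℝ), Real.exp_nat_mul]
  gcongr
  linarith [Real.exp_one_lt_d9]

/-- A function which is well approximated by bounded holomorphic functions on all small discs has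
controlled finite differences. -/
theorem norm_fwdDiff_iter_le_of_approx {f : ℝ → ℂ} {k : ℕ} (hk : 1 ≤ k) {B A δ₀ : ℝ} (hB : 0 < B)
    (hA : 0 ≤ A) (hδ₀ : 0 < δ₀)
    (h : ∀ δ : ℝ, 0 < δ → δ ≤ δ₀ → ∃ F : ℂ → ℂ, DifferentiableOn ℂ F (ball 0 δ) ∧
      (∀ z ∈ ball (0 : ℂ) δ, ‖F z‖ ≤ B) ∧ ∃ e : ℝ, 0 < e ∧ e ≤ 1 ∧ e ≤ A * δ ^ (k + 1) ∧
        ∀ s : ℝ, |s| < δ → ‖F s - f s‖ ≤ B * e ^ 4)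
    {s : ℝ} (hs : 0 < s) (hks : k * s ≤ δ₀ / 32) :
    ‖(fwdDiff s)^[k] f 0‖ ≤ 6 * 400 ^ k * k.factorial * B * (A * δ₀ + (δ₀ ^ k)⁻¹) * s ^ k := by
  have hk0 : (0 : ℝ) < k := by exact_mod_cast hk
  have hδ : ∀ j : ℕ, 0 < δ₀ / 2 ^ j ∧ δ₀ / 2 ^ j ≤ δ₀ := fun j =>
    ⟨by positivity, div_le_self hδ₀.le (one_le_pow₀ (by norm_num))⟩
  choose F hFd hFb e he0 he1 heA hFe using fun j => h (δ₀ / 2 ^ j) (hδ j).1 (hδ j).2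
  -- the scale matching the step size
  have hex : ∃ J : ℕ, k * s ≤ δ₀ / 2 ^ J / 32 ∧ δ₀ / 2 ^ J / 64 < k * s := by
    have hex' : ∃ J : ℕ, δ₀ / 2 ^ J / 64 < k * s := by
      obtain ⟨J, hJ⟩ := pow_unbounded_of_one_lt (δ₀ / (k * s)) (one_lt_two : (1 : ℝ) < 2)
      refine ⟨J, ?_⟩
      rw [div_lt_iff₀ (by positivity)] at hJ
      rw [div_div, div_lt_iff₀ (by positivity)]
      nlinarith [mul_pos hk0 hs, pow_pos (two_pos : (0 : ℝ) < 2) J]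
    classical
    refine ⟨Nat.find hex', ?_, Nat.find_spec hex'⟩
    rcases hJ : Nat.find hex' with _ | J
    · simpa using hks
    · have := Nat.find_min hex' (m := J) (by omega)
      rw [not_lt] at this
      refine this.trans (le_of_eq ?_)
      rw [pow_succ]; field_simp; norm_num
  obtain ⟨J, hJ1, hJ2⟩ := hex
  have hbase := norm_fwdDiff_iter_le_of_differentiableOn (k := k) (u := F 0) (R := δ₀) (A := B)
    (s := s) hδ₀ (by simpa using hFd 0) (fun z hz => hFb 0 z (by simpa using hz)) hs.le (by linarith)
  have hstep : ∀ j < J, ‖(fwdDiff s)^[k] (fun x : ℝ => F (j + 1) x - F j x) 0‖ ≤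
      k.factorial * (2 * B * A) * 32 ^ k * (δ₀ / 2 ^ j) * s ^ k := by
    intro j hj
    set R := δ₀ / 2 ^ (j + 1) with hRdef
    have hR : 0 < R := (hδ _).1
    have hR2 : δ₀ / 2 ^ j = 2 * R := by rw [hRdef, pow_succ]; field_simp
    set ξ := max (e j) (e (j + 1)) with hξ
    have hξ0 : 0 < ξ := lt_max_of_lt_left (he0 j)
    have hξ1 : ξ ≤ 1 := max_le (he1 j) (he1 _)
    have hξA : ξ ≤ A * (2 * R) ^ (k + 1) := by
      refine max_le (hR2 ▸ heA j) ((heA (j + 1)).trans ?_)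
      rw [← hRdef]
      gcongr
      linarith
    have hsub : ball (0 : ℂ) R ⊆ ball 0 (δ₀ / 2 ^ j) := ball_subset_ball (by linarith)
    have hdiff : DifferentiableOn ℂ (fun z => F (j + 1) z - F j z) (ball 0 R) :=
      (hFd (j + 1)).sub ((hFd j).mono hsub)
    have hn : ∀ z : ℂ, ‖((2 * B : ℝ) : ℂ)⁻¹ * z‖ = (2 * B)⁻¹ * ‖z‖ := by
      intro z
      rw [norm_mul, norm_inv, Complex.norm_real, Real.norm_of_nonneg (by positivity)]
    have htc : ∀ z : ℂ, ‖z‖ < R / 4 → ‖F (j + 1) z - F j z‖ ≤ 2 * B * ξ := by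
      intro z hz
      have := two_constants (u := fun z => ((2 * B : ℝ) : ℂ)⁻¹ * (F (j + 1) z - F j z)) hR
        (hdiff.const_mul _) hξ0 hξ1 ?_ ?_ hz.le
      · rwa [hn, inv_mul_le_iff₀ (by positivity)] at this
      · intro z hz
        rw [hn, inv_mul_le_iff₀ (by positivity)]
        have h1 := norm_sub_le (F (j + 1) z) (F j z)
        linarith [hFb (j + 1) z hz, hFb j z (hsub hz)]
      · intro x hx
        rw [hn, inv_mul_le_iff₀ (by positivity)]
        have h1 := norm_sub_le_norm_sub_add_norm_sub (F (j + 1) x) (f x) (F j x)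
        have h2 := hFe (j + 1) x hx
        have h3 := hFe j x (by linarith)
        rw [norm_sub_rev] at h3
        have h4 : B * e (j + 1) ^ 4 ≤ B * ξ ^ 4 := by
          have := (he0 (j + 1)).le
          gcongr
          exact le_max_right _ _
        have h5 : B * e j ^ 4 ≤ B * ξ ^ 4 := by
          have := (he0 j).le
          gcongr
          exact le_max_left _ _
        linarith
    have hJR : δ₀ / 2 ^ J ≤ R := by
      rw [hRdef]; gcongr
      · norm_num
      · omega
    have := norm_fwdDiff_iter_le_of_differentiableOn (k := k)
      (u := fun z => F (j + 1) z - F j z) (R := R / 4) (A := 2 * B * ξ)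
      (s := s) (by positivity) (hdiff.mono (ball_subset_ball (by linarith))) htc hs.le
      (by linarith)
    refine this.trans ?_
    gcongr ?_ * _
    rw [hR2, div_le_iff₀ (by positivity)]
    calc k.factorial * (2 * B * ξ) ≤ k.factorial * (2 * B * (A * (2 * R) ^ (k + 1))) := by gcongr
      _ = k.factorial * (2 * B * A) * 32 ^ k * (2 * R) * (R / 4 / 4) ^ k := by
        have h32 : (32 : ℝ) ^ k * (R / 4 / 4) ^ k = (2 * R) ^ k := by
          rw [← mul_pow]; congr 1; ring
        rw [pow_succ, ← h32]; ring
  have hlast : ‖(fwdDiff s)^[k] (fun x : ℝ => f x - F J x) 0‖ ≤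
      2 ^ k * (B * (A * δ₀ * (64 * (k * s)) ^ k)) := by
    refine norm_fwdDiff_iter_le fun i hi => ?_
    have hi' : (i : ℝ) ≤ k := by exact_mod_cast hi
    have h1 : |0 + (i : ℝ) * s| < δ₀ / 2 ^ J := by
      rw [zero_add, abs_of_nonneg (by positivity)]
      have : (i : ℝ) * s ≤ k * s := by gcongr
      linarith [(hδ J).1]
    have h2 := hFe J _ h1
    rw [norm_sub_rev] at h2
    refine h2.trans ?_
    gcongr
    calc e J ^ 4 ≤ e J := pow_le_of_le_one (he0 J).le (he1 J) (by norm_num)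
      _ ≤ A * (δ₀ / 2 ^ J) ^ (k + 1) := heA J
      _ = A * (δ₀ / 2 ^ J) * (δ₀ / 2 ^ J) ^ k := by ring
      _ ≤ A * δ₀ * (64 * (k * s)) ^ k := by
        have := (hδ J).1
        gcongr
        · exact (hδ J).2
        · linarith
  have hdecomp : f = ((fun x : ℝ => F 0 x) + ∑ j ∈ Finset.range J,
      fun x : ℝ => F (j + 1) x - F j x) + fun x : ℝ => f x - F J x := by
    funext x
    simp only [Pi.add_apply, Finset.sum_apply]
    rw [Finset.sum_range_sub (fun j => F j (x : ℂ))]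
    ring
  have hsum : ∑ j ∈ Finset.range J, δ₀ / 2 ^ j ≤ 2 * δ₀ := by
    have := Summable.sum_le_tsum (Finset.range J) (fun _ _ => by positivity) summable_geometric_two
    rw [tsum_geometric_two] at this
    calc _ = δ₀ * ∑ j ∈ Finset.range J, (1 / 2 : ℝ) ^ j := by
          rw [Finset.mul_sum]; refine Finset.sum_congr rfl fun j _ => ?_
          rw [div_pow, one_pow]; ring
      _ ≤ δ₀ * 2 := by gcongr
      _ = _ := by ring
  rw [hdecomp, fwdDiff_iter_add, fwdDiff_iter_add, fwdDiff_iter_finsetSum]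
  simp only [Pi.add_apply, Finset.sum_apply]
  have hmid : ‖∑ j ∈ Finset.range J, (fwdDiff s)^[k] (fun x : ℝ => F (j + 1) x - F j x) 0‖ ≤
      k.factorial * (2 * B * A) * 32 ^ k * (2 * δ₀) * s ^ k := by
    refine (norm_sum_le _ _).trans ((Finset.sum_le_sum fun j hj =>
      hstep j (Finset.mem_range.mp hj)).trans ?_)
    rw [← Finset.sum_mul, ← Finset.mul_sum]
    gcongr
  refine (norm_add₃_le).trans ((add_le_add (add_le_add hbase hmid) hlast).trans ?_)
  have hq := pow_self_le_exp_mul_factorial k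
  have hA0 : 0 ≤ B * (A * δ₀) := by positivity
  have t1 : k.factorial * B / (δ₀ / 4) ^ k * s ^ k ≤
      400 ^ k * (k.factorial * B * (δ₀ ^ k)⁻¹ * s ^ k) := by
    have : k.factorial * B / (δ₀ / 4) ^ k * s ^ k =
        4 ^ k * (k.factorial * B * (δ₀ ^ k)⁻¹ * s ^ k) := by
      rw [div_pow]; field_simp
    rw [this]
    gcongr
    norm_num
  have t2 : k.factorial * (2 * B * A) * 32 ^ k * (2 * δ₀) * s ^ k ≤
      4 * (400 ^ k * (k.factorial * (B * (A * δ₀)) * s ^ k)) := by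
    have : k.factorial * (2 * B * A) * 32 ^ k * (2 * δ₀) * s ^ k =
        4 * (32 ^ k * (k.factorial * (B * (A * δ₀)) * s ^ k)) := by ring
    rw [this]
    gcongr
    norm_num
  have t3 : 2 ^ k * (B * (A * δ₀ * (64 * (k * s)) ^ k)) ≤
      400 ^ k * (k.factorial * (B * (A * δ₀)) * s ^ k) := by
    calc 2 ^ k * (B * (A * δ₀ * (64 * (k * s)) ^ k))
        = 2 ^ k * 64 ^ k * ((k : ℝ) ^ k * (B * (A * δ₀)) * s ^ k) := by
          rw [mul_pow, mul_pow]; ring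
      _ ≤ 2 ^ k * 64 ^ k * (3 ^ k * k.factorial * (B * (A * δ₀)) * s ^ k) := by gcongr
      _ = 384 ^ k * (k.factorial * (B * (A * δ₀)) * s ^ k) := by
          rw [show (384 : ℝ) = 2 * 64 * 3 by norm_num, mul_pow, mul_pow]; ring
      _ ≤ _ := by gcongr; norm_num
  have t4 : 0 ≤ 400 ^ k * (k.factorial * B * (δ₀ ^ k)⁻¹ * s ^ k) := by positivity
  have t5 : 0 ≤ 400 ^ k * (k.factorial * (B * (A * δ₀)) * s ^ k) := by positivity
  have : 6 * 400 ^ k * k.factorial * B * (A * δ₀ + (δ₀ ^ k)⁻¹) * s ^ k =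
      6 * (400 ^ k * (k.factorial * B * (δ₀ ^ k)⁻¹ * s ^ k)) +
      6 * (400 ^ k * (k.factorial * (B * (A * δ₀)) * s ^ k)) := by ring
  linarith

end FiniteDifferences

section Polarization

lemma sum_superset_neg_one_pow_card {k : ℕ} (s : Finset (Fin k)) :
    ∑ t ∈ Finset.univ.filter (fun t : Finset (Fin k) => s ⊆ t), (-1 : ℤ) ^ tᶜ.card =
      if s = Finset.univ then 1 else 0 := by
  have h := Finset.sum_powerset_neg_one_pow_card (x := sᶜ)
  simp only [Finset.compl_eq_empty_iff] at h
  rw [← h]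
  refine Finset.sum_bij (fun t _ => tᶜ) ?_ ?_ ?_ ?_
  · intro t ht
    simp only [Finset.mem_filter, Finset.mem_univ, true_and] at ht
    simpa using ht
  · intro a _ b _ hab
    exact compl_injective hab
  · intro b hb
    refine ⟨bᶜ, ?_, compl_compl b⟩
    simp only [Finset.mem_filter, Finset.mem_univ, true_and]
    rw [Finset.mem_powerset] at hb
    intro i hi
    rw [Finset.mem_compl]
    intro hib
    exact (Finset.mem_compl.mp (hb hib)) hi
  · intro a _; rfl

/-- The polarization identity. -/
lemma factorial_smul_eq_sum {E F : Type*} [AddCommGroup E] [Module ℝ E] [AddCommGroup F]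
    [Module ℝ F] {k : ℕ} (T : MultilinearMap ℝ (fun _ : Fin k => E) F)
    (hT : ∀ (σ : Equiv.Perm (Fin k)) (v : Fin k → E), T (fun i => v (σ i)) = T v)
    (v : Fin k → E) :
    k.factorial • T v = ∑ s : Finset (Fin k), (-1 : ℤ) ^ sᶜ.card • T (fun _ => ∑ i ∈ s, v i) := by
  have h1 : ∀ s : Finset (Fin k), T (fun _ => ∑ i ∈ s, v i) =
      ∑ g : Fin k → Fin k, if Finset.univ.image g ⊆ s then T (fun i => v (g i)) else 0 := by
    intro s
    rw [T.map_sum_finset (fun _ j => v j) (fun _ => s), ← Finset.sum_filter]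
    refine Finset.sum_congr ?_ fun _ _ => rfl
    ext g
    simp [Fintype.mem_piFinset, Finset.image_subset_iff]
  simp_rw [h1, Finset.smul_sum]
  rw [Finset.sum_comm]
  have h2 : ∀ g : Fin k → Fin k, ∑ s : Finset (Fin k), (-1 : ℤ) ^ sᶜ.card •
      (if Finset.univ.image g ⊆ s then T (fun i => v (g i)) else 0) =
      if Function.Surjective g then T (fun i => v (g i)) else 0 := by
    intro g
    have : ∀ s : Finset (Fin k), (-1 : ℤ) ^ sᶜ.card •
        (if Finset.univ.image g ⊆ s then T (fun i => v (g i)) else 0) =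
        if Finset.univ.image g ⊆ s then (-1 : ℤ) ^ sᶜ.card • T (fun i => v (g i)) else 0 := by
      intro s; split_ifs <;> simp
    simp_rw [this]
    rw [← Finset.sum_filter, ← Finset.sum_smul, sum_superset_neg_one_pow_card]
    by_cases hg : Function.Surjective g
    · rw [if_pos hg, if_pos (Finset.image_univ_of_surjective hg), one_smul]
    · rw [if_neg hg, if_neg, zero_smul]
      intro h
      refine hg fun b => ?_
      have := Finset.mem_univ b
      rw [← h, Finset.mem_image] at this
      obtain ⟨a, -, ha⟩ := this
      exact ⟨a, ha⟩
  simp_rw [h2]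
  rw [← Finset.sum_filter]
  have h3 : ∑ g ∈ Finset.univ.filter (fun g : Fin k → Fin k => Function.Surjective g),
      T (fun i => v (g i)) = ∑ σ : Equiv.Perm (Fin k), T (fun i => v (σ i)) := by
    refine (Finset.sum_bij (fun (σ : Equiv.Perm (Fin k)) _ => (σ : Fin k → Fin k)) ?_ ?_ ?_ ?_).symm
    · intro σ _
      simpa using σ.surjective
    · intro a _ b _ hab
      exact DFunLike.coe_injective hab
    · intro g hg
      simp only [Finset.mem_filter, Finset.mem_univ, true_and] at hg
      exact ⟨Equiv.ofBijective g ⟨Finite.injective_iff_surjective.mpr hg, hg⟩, by simp, rfl⟩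
    · intro σ _; rfl
  rw [h3]
  simp [hT, Fintype.card_perm]

lemma norm_le_of_forall_diagonal {E F : Type*} [NormedAddCommGroup E] [NormedSpace ℝ E]
    [NormedAddCommGroup F] [NormedSpace ℝ F] {k : ℕ}
    (T : ContinuousMultilinearMap ℝ (fun _ : Fin k => E) F)
    (hT : ∀ (σ : Equiv.Perm (Fin k)) (v : Fin k → E), T (fun i => v (σ i)) = T v)
    {A : ℝ} (hA : 0 ≤ A) (h : ∀ v : E, ‖v‖ ≤ 1 → ‖T (fun _ => v)‖ ≤ A) : ‖T‖ ≤ 6 ^ k * A := by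
  have hk := pow_self_le_exp_mul_factorial k
  have hdiag : ∀ (c : ℝ), 0 < c → ∀ v : E, ‖v‖ ≤ c → ‖T (fun _ => v)‖ ≤ c ^ k * A := by
    intro c hc v hv
    have h1 := h (c⁻¹ • v) (by
      rw [norm_smul, norm_inv, Real.norm_of_nonneg hc.le]
      exact inv_mul_le_one_of_le₀ hv hc.le)
    have h2 : T (fun _ : Fin k => v) = c ^ k • T (fun _ => c⁻¹ • v) := by
      have := T.map_smul_univ (fun _ => c) (fun _ => c⁻¹ • v)
      simp only [Finset.prod_const, Finset.card_univ, Fintype.card_fin] at this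
      rw [← this]
      congr 1
      funext i
      rw [smul_inv_smul₀ hc.ne']
    rw [h2, norm_smul, norm_pow, Real.norm_of_nonneg hc.le]
    gcongr
  -- vectors in the unit ball
  have hunit : ∀ v : Fin k → E, (∀ i, ‖v i‖ ≤ 1) → ‖T v‖ ≤ 6 ^ k * A := by
    intro v hv
    rcases Nat.eq_zero_or_pos k with rfl | hk0
    · have := h 0 (by simp)
      rw [Subsingleton.elim v (fun _ => 0)]
      simpa using this
    have hp := factorial_smul_eq_sum T.toMultilinearMap hT v
    have hb : ‖k.factorial • T v‖ ≤ 2 ^ k * (k ^ k * A) := by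
      have hp' : k.factorial • T v = ∑ s : Finset (Fin k), (-1 : ℤ) ^ sᶜ.card •
        T (fun _ => ∑ i ∈ s, v i) := hp
      rw [hp']
      refine (norm_sum_le _ _).trans ?_
      calc _ ≤ ∑ s : Finset (Fin k), (k : ℝ) ^ k * A := by
            refine Finset.sum_le_sum fun s _ => ?_
            have : ‖(-1 : ℤ) ^ sᶜ.card • T (fun _ => ∑ i ∈ s, v i)‖ =
                ‖T (fun _ => ∑ i ∈ s, v i)‖ := by
              rcases neg_one_pow_eq_or ℤ sᶜ.card with h | h <;> rw [h] <;> simp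
            rw [this]
            refine hdiag k (by exact_mod_cast hk0) _ ((norm_sum_le _ _).trans ?_)
            refine (Finset.sum_le_sum fun i _ => hv i).trans ?_
            simp only [Finset.sum_const, nsmul_eq_mul, mul_one]
            exact_mod_cast (Finset.card_le_univ s).trans (by simp)
        _ = _ := by simp
    rw [← Nat.cast_smul_eq_nsmul ℝ, norm_smul, Real.norm_of_nonneg (by positivity)] at hb
    have hf : (0 : ℝ) < k.factorial := by positivity
    refine le_of_mul_le_mul_left (hb.trans ?_) hf
    calc (2 : ℝ) ^ k * (k ^ k * A) ≤ 2 ^ k * (3 ^ k * k.factorial * A) := by gcongr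
      _ = k.factorial * (6 ^ k * A) := by
        rw [show (6 : ℝ) = 2 * 3 by norm_num, mul_pow]; ring
  refine ContinuousMultilinearMap.opNorm_le_bound (by positivity) fun v => ?_
  by_cases hz : ∃ i, v i = 0
  · obtain ⟨i, hi⟩ := hz
    rw [T.map_coord_zero i hi, norm_zero]
    positivity
  push Not at hz
  have h1 := hunit (fun i => ‖v i‖⁻¹ • v i) (fun i => by
    rw [norm_smul, norm_inv, norm_norm, inv_mul_cancel₀ (norm_ne_zero_iff.mpr (hz i))])
  have h2 := T.map_smul_univ (fun i => ‖v i‖) (fun i => ‖v i‖⁻¹ • v i)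
  have h3 : (fun i => ‖v i‖ • ‖v i‖⁻¹ • v i) = v := by
    funext i
    rw [smul_inv_smul₀ (norm_ne_zero_iff.mpr (hz i))]
  rw [h3] at h2
  rw [h2, norm_smul, norm_prod, mul_comm]
  simp only [norm_norm]
  gcongr

end Polarization

section LocallyUniformLimits

universe u

/-- Interpolation: the first derivative is controlled by the function and its second derivative. -/
lemma norm_fderiv_le_of_norm_le {E F : Type*} [NormedAddCommGroup E] [NormedSpace ℝ E]
    [NormedAddCommGroup F] [NormedSpace ℝ F] {w : E → F} (hw : ContDiff ℝ (⊤ : ℕ∞) w)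
    {x : E} {τ ε A : ℝ} (hτ : 0 < τ) (hA : 0 ≤ A)
    (h0 : ∀ y ∈ closedBall x τ, ‖w y‖ ≤ ε)
    (h2 : ∀ y ∈ closedBall x τ, ‖iteratedFDeriv ℝ 2 w y‖ ≤ A) :
    ‖fderiv ℝ w x‖ ≤ 2 * ε / τ + A * τ := by
  have hε : 0 ≤ ε := (norm_nonneg _).trans (h0 x (by simp [hτ.le]))
  have hdw : Differentiable ℝ w := hw.differentiable (by simp)
  have hd2 : Differentiable ℝ (fderiv ℝ w) :=
    (hw.fderiv_right (m := (⊤ : ℕ∞)) (by simp)).differentiable (by simp)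
  have hlip : ∀ y ∈ closedBall x τ, ‖fderiv ℝ w y - fderiv ℝ w x‖ ≤ A * τ := by
    intro y hy
    have := Convex.norm_image_sub_le_of_norm_fderiv_le (𝕜 := ℝ) (f := fderiv ℝ w)
      (C := A) (s := closedBall x τ) (x := x) (y := y) (fun z _ => hd2 z) (fun z hz => by
        have := h2 z hz
        rwa [← norm_iteratedFDeriv_fderiv, norm_iteratedFDeriv_one] at this)
      (convex_closedBall _ _) (by simp [hτ.le]) hy
    refine this.trans ?_
    gcongr
    simpa [dist_eq_norm] using hy
  refine ContinuousLinearMap.opNorm_le_of_unit_norm (by positivity) fun v hv => ?_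
  have hmem : x + τ • v ∈ closedBall x τ := by simp [norm_smul, hv, abs_of_pos hτ]
  have hm := Convex.norm_image_sub_le_of_norm_fderiv_le' (𝕜 := ℝ) (f := w) (C := A * τ)
    (φ := fderiv ℝ w x) (s := closedBall x τ) (x := x) (y := x + τ • v) (fun z _ => hdw z)
    hlip (convex_closedBall _ _) (by simp [hτ.le]) hmem
  rw [add_sub_cancel_left, norm_smul, hv, Real.norm_of_nonneg hτ.le, mul_one, map_smul] at hm
  have h1 : ‖τ • fderiv ℝ w x v‖ ≤ 2 * ε + A * τ * τ := by
    have e : τ • fderiv ℝ w x v =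
        w (x + τ • v) - w x - (w (x + τ • v) - w x - τ • fderiv ℝ w x v) := by abel
    rw [e]
    refine (norm_sub_le _ _).trans ?_
    have := norm_sub_le (w (x + τ • v)) (w x)
    linarith [h0 _ hmem, h0 x (by simp [hτ.le])]
  rw [norm_smul, Real.norm_of_nonneg hτ.le] at h1
  have h3 : ‖fderiv ℝ w x v‖ ≤ (2 * ε + A * τ * τ) / τ := by
    rw [le_div_iff₀ hτ]; linarith
  refine h3.trans (le_of_eq ?_)
  field_simp

/-- A locally uniform limit of smooth functions with uniformly bounded derivatives is smooth, with
the same bounds. -/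
theorem contDiffOn_of_tendstoUniformlyOn {E : Type u} [NormedAddCommGroup E] [NormedSpace ℝ E]
    {R : ℝ} (k : ℕ) : ∀ {F : Type u} [NormedAddCommGroup F] [NormedSpace ℝ F] [CompleteSpace F]
    {w : ℕ → E → F} {g : E → F} {A : ℕ → ℝ}, (∀ n, ContDiff ℝ (⊤ : ℕ∞) (w n)) →
    (∀ r < R, TendstoUniformlyOn w g atTop (ball 0 r)) →
    (∀ j, ∀ᶠ n in atTop, ∀ x ∈ ball (0 : E) R, ‖iteratedFDeriv ℝ j (w n) x‖ ≤ A j) →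
    ContDiffOn ℝ k g (ball 0 R) ∧ ∀ x ∈ ball (0 : E) R, ‖iteratedFDeriv ℝ k g x‖ ≤ A k := by
  have hball : ∀ x ∈ ball (0 : E) R, ∃ r, ‖x‖ < r ∧ r < R := fun x hx =>
    exists_between (by simpa using hx)
  induction k with
  | zero =>
    intro F _ _ _ w g A hw hu hb
    constructor
    · refine contDiffOn_zero.mpr fun x hx => ?_
      obtain ⟨r, hr1, hr2⟩ := hball x hx
      have hc : ContinuousOn g (ball 0 r) :=
        (hu r hr2).continuousOn (Frequently.of_forall fun n => (hw n).continuous.continuousOn)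
      exact (hc.continuousAt (isOpen_ball.mem_nhds (by simpa using hr1))).continuousWithinAt
    · intro x hx
      obtain ⟨r, hr1, hr2⟩ := hball x hx
      have hp := (hu r hr2).tendsto_at (x := x) (by simpa using hr1)
      rw [norm_iteratedFDeriv_zero]
      refine le_of_tendsto hp.norm ?_
      filter_upwards [hb 0] with n hn
      simpa using hn x hx
  | succ k ih =>
    intro F _ _ _ w g A hw hu hb
    have hA2 : ∀ x ∈ ball (0 : E) R, 0 ≤ A 2 := fun x hx => by
      obtain ⟨n, hn⟩ := (hb 2).exists
      exact (norm_nonneg _).trans (hn x hx)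
    have hcau : ∀ r < R, UniformCauchySeqOn (fun n => fderiv ℝ (w n)) atTop (ball 0 r) := by
      intro r hr
      rw [Metric.uniformCauchySeqOn_iff]
      intro ε hε
      rcases le_or_gt R 0 with hR0 | hR0
      · refine ⟨0, fun m _ n _ x hx => ?_⟩
        rw [ball_eq_empty.mpr (by linarith)] at hx
        exact hx.elim
      have hA0 : 0 ≤ A 2 := hA2 0 (by simpa using hR0)
      obtain ⟨τ, hτ0, hτ1, hτ2⟩ : ∃ τ : ℝ, 0 < τ ∧ 2 * A 2 * τ < ε / 2 ∧ τ < (R - r) / 2 := by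
        refine ⟨min (ε / (8 * (A 2 + 1))) ((R - r) / 4), by
          have : 0 < R - r := by linarith
          positivity, ?_, ?_⟩
        · calc 2 * A 2 * min (ε / (8 * (A 2 + 1))) ((R - r) / 4)
              ≤ 2 * A 2 * (ε / (8 * (A 2 + 1))) := by gcongr; exact min_le_left _ _
            _ < ε / 2 := by
              rw [← mul_div_assoc, div_lt_div_iff₀ (by positivity) (by norm_num)]
              nlinarith
        · exact lt_of_le_of_lt (min_le_right _ _) (by linarith)
      have hc := (hu ((R + r) / 2) (by linarith)).uniformCauchySeqOn
      rw [Metric.uniformCauchySeqOn_iff] at hc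
      obtain ⟨N, hN⟩ := hc (ε * τ / 8) (by positivity)
      obtain ⟨N', hN'⟩ := eventually_atTop.mp (hb 2)
      refine ⟨max N N', fun m hm n hn x hx => ?_⟩
      have hsub : ∀ y ∈ closedBall x τ, ‖y‖ < (R + r) / 2 := by
        intro y hy
        have h1 : ‖y - x‖ ≤ τ := by simpa [dist_eq_norm] using hy
        have h2 : ‖x‖ < r := by simpa using hx
        have h3 := norm_sub_norm_le y x
        linarith
      have key := norm_fderiv_le_of_norm_le (w := w m - w n) (x := x) (τ := τ)
        (ε := ε * τ / 8) (A := 2 * A 2) ((hw m).sub (hw n)) hτ0 (by positivity) ?_ ?_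
      · rw [dist_eq_norm, ← fderiv_sub ((hw m).differentiable (by simp) x)
          ((hw n).differentiable (by simp) x)]
        refine key.trans_lt ?_
        have : 2 * (ε * τ / 8) / τ = ε / 4 := by field_simp; norm_num
        rw [this]; linarith
      · intro y hy
        have := hN m (le_of_max_le_left hm) n (le_of_max_le_left hn) y (by simpa using hsub y hy)
        rw [dist_eq_norm] at this
        exact this.le
      · intro y hy
        have hyR : y ∈ ball (0 : E) R := by
          have := hsub y hy
          simp only [mem_ball_zero_iff]; linarith
        have hneg : ContDiffAt ℝ 2 (-w n) y := (contDiff_infty.mp (hw n) 2).neg.contDiffAt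
        rw [sub_eq_add_neg, iteratedFDeriv_add_apply
          (contDiff_infty.mp (hw m) 2).contDiffAt hneg, iteratedFDeriv_neg_apply]
        refine (norm_add_le _ _).trans ?_
        rw [norm_neg]
        linarith [hN' m (le_of_max_le_right hm) y hyR, hN' n (le_of_max_le_right hn) y hyR]
    have hlim : ∀ x ∈ ball (0 : E) R, ∃ L, Tendsto (fun n => fderiv ℝ (w n) x) atTop (𝓝 L) := by
      intro x hx
      obtain ⟨r, hr1, hr2⟩ := hball x hx
      exact cauchySeq_tendsto_of_complete ((hcau r hr2).cauchySeq (by simpa using hr1))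
    have hlim' : ∀ x : E, ∃ L, x ∈ ball (0 : E) R →
        Tendsto (fun n => fderiv ℝ (w n) x) atTop (𝓝 L) := fun x => by
      by_cases hx : x ∈ ball (0 : E) R
      · obtain ⟨L, hL⟩ := hlim x hx
        exact ⟨L, fun _ => hL⟩
      · exact ⟨0, fun h => absurd h hx⟩
    choose g' hg' using hlim'
    have hunif : ∀ r < R, TendstoUniformlyOn (fun n => fderiv ℝ (w n)) g' atTop (ball 0 r) :=
      fun r hr => (hcau r hr).tendstoUniformlyOn_of_tendsto fun x hx =>
        hg' x (ball_subset_ball hr.le hx)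
    have hder : ∀ x ∈ ball (0 : E) R, HasFDerivAt g (g' x) x := by
      intro x hx
      obtain ⟨r, hr1, hr2⟩ := hball x hx
      exact hasFDerivAt_of_tendstoUniformlyOn isOpen_ball (hunif r hr2)
        (fun n y _ => ((hw n).differentiable (by simp) y).hasFDerivAt)
        (fun y hy => (hu r hr2).tendsto_at hy) (by simpa using hr1)
    have ih' := ih (w := fun n => fderiv ℝ (w n)) (g := fderiv ℝ g) (A := fun j => A (j + 1))
      (fun n => (hw n).fderiv_right (by simp))
      (fun r hr => (hunif r hr).congr_right fun x hx =>
        (hder x (ball_subset_ball hr.le hx)).fderiv.symm)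
      (fun j => by
        filter_upwards [hb (j + 1)] with n hn x hx
        rw [norm_iteratedFDeriv_fderiv]
        exact hn x hx)
    constructor
    · push_cast
      rw [contDiffOn_succ_iff_fderiv_of_isOpen isOpen_ball]
      exact ⟨fun x hx => (hder x hx).differentiableAt.differentiableWithinAt, by simp, ih'.1⟩
    · intro x hx
      rw [← norm_iteratedFDeriv_fderiv]
      exact ih'.2 x hx

end LocallyUniformLimits

section SymmetryOfDerivatives

lemma fderiv_iteratedFDeriv_apply {E F : Type*} [NormedAddCommGroup E] [NormedSpace ℝ E]
    [NormedAddCommGroup F] [NormedSpace ℝ F] {w : E → F} (hw : ContDiff ℝ (⊤ : ℕ∞) w) {k : ℕ}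
    (x u : E) (v : Fin k → E) :
    fderiv ℝ (fun y => iteratedFDeriv ℝ k w y v) x u = fderiv ℝ (iteratedFDeriv ℝ k w) x u v := by
  have hd : DifferentiableAt ℝ (iteratedFDeriv ℝ k w) x :=
    hw.differentiable_iteratedFDeriv (by exact_mod_cast ENat.natCast_lt_top k) x
  have := ((ContinuousMultilinearMap.apply ℝ (fun _ : Fin k => E) F v).hasFDerivAt.comp x
    hd.hasFDerivAt).fderiv
  have e : (ContinuousMultilinearMap.apply ℝ (fun _ : Fin k => E) F v) ∘ iteratedFDeriv ℝ k w =
      fun y => iteratedFDeriv ℝ k w y v := rfl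
  rw [e] at this
  rw [this]
  rfl

lemma iteratedFDeriv_comp_swap {E F : Type*} [NormedAddCommGroup E] [NormedSpace ℝ E]
    [NormedAddCommGroup F] [NormedSpace ℝ F] {w : E → F} (hw : ContDiff ℝ (⊤ : ℕ∞) w) :
    ∀ {k : ℕ} (i : Fin k) (x : E) (v : Fin (k + 1) → E),
      iteratedFDeriv ℝ (k + 1) w x (v ∘ Equiv.swap i.castSucc i.succ) =
        iteratedFDeriv ℝ (k + 1) w x v := by
  intro k
  induction k with
  | zero => intro i; exact i.elim0
  | succ k ih =>
    intro i x v
    have hl : ∀ u : Fin (k + 2) → E, iteratedFDeriv ℝ (k + 1 + 1) w x u =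
        fderiv ℝ (fun y => iteratedFDeriv ℝ (k + 1) w y (Fin.tail u)) x (u 0) := by
      intro u
      rw [iteratedFDeriv_succ_apply_left, fderiv_iteratedFDeriv_apply hw]
    rw [hl, hl]
    refine Fin.cases ?_ (fun j => ?_) i
    · have hG : ContDiff ℝ (⊤ : ℕ∞) (fun y => iteratedFDeriv ℝ k w y (Fin.tail (Fin.tail v))) := by
        have h1 : ContDiff ℝ (⊤ : ℕ∞) (iteratedFDeriv ℝ k w) :=
          hw.iteratedFDeriv_right (m := (⊤ : ℕ∞)) (by exact_mod_cast le_top)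
        exact (ContinuousMultilinearMap.apply ℝ (fun _ : Fin k => E) F _).contDiff.comp h1
      set G := fun y => iteratedFDeriv ℝ k w y (Fin.tail (Fin.tail v)) with hGdef
      have hsymm : IsSymmSndFDerivAt ℝ G x :=
        (contDiff_infty.mp hG 2).contDiffAt.isSymmSndFDerivAt (by simp)
      have hG' : DifferentiableAt ℝ (fderiv ℝ G) x :=
        (hG.fderiv_right (m := (⊤ : ℕ∞)) (by simp)).differentiable (by simp) x
      have key : ∀ u : Fin (k + 2) → E, Fin.tail (Fin.tail u) = Fin.tail (Fin.tail v) →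
          fderiv ℝ (fun y => iteratedFDeriv ℝ (k + 1) w y (Fin.tail u)) x (u 0) =
            fderiv ℝ (fderiv ℝ G) x (u 0) (u 1) := by
        intro u hu
        have e : (fun y => iteratedFDeriv ℝ (k + 1) w y (Fin.tail u)) =
            fun y => fderiv ℝ G y (u 1) := by
          funext y
          rw [iteratedFDeriv_succ_apply_left, hu, ← fderiv_iteratedFDeriv_apply hw]
          rfl
        rw [e]
        have := (hG'.hasFDerivAt.clm_apply (hasFDerivAt_const (u 1) x)).fderiv
        rw [this]
        simp
      rw [key v rfl, key _ ?_, hsymm.eq]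
      · simp
      · funext j
        simp only [Fin.tail, Function.comp_apply]
        congr 1
    · have h0 : (v ∘ Equiv.swap j.succ.castSucc j.succ.succ) 0 = v 0 := by
        simp only [Function.comp_apply]
        congr 1
      have h1 : Fin.tail (v ∘ Equiv.swap j.succ.castSucc j.succ.succ) =
          Fin.tail v ∘ Equiv.swap j.castSucc j.succ := by
        funext l
        simp only [Fin.tail, Function.comp_apply]
        congr 1
        rw [← Fin.succ_castSucc, Equiv.swap_apply_def, Equiv.swap_apply_def]
        simp only [Fin.succ_inj]
        split_ifs <;> rfl
      rw [h0, h1]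
      simp only [ih]

lemma iteratedFDeriv_comp_perm {E F : Type*} [NormedAddCommGroup E] [NormedSpace ℝ E]
    [NormedAddCommGroup F] [NormedSpace ℝ F] {w : E → F} (hw : ContDiff ℝ (⊤ : ℕ∞) w)
    {k : ℕ} (σ : Equiv.Perm (Fin k)) (x : E) (v : Fin k → E) :
    iteratedFDeriv ℝ k w x (v ∘ σ) = iteratedFDeriv ℝ k w x v := by
  rcases k with _ | k
  · congr 1; exact Subsingleton.elim _ _
  have hσ : σ ∈ Submonoid.closure (Set.range fun i : Fin k => Equiv.swap i.castSucc i.succ) := by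
    rw [Equiv.Perm.mclosure_swap_castSucc_succ]; trivial
  induction hσ using Submonoid.closure_induction generalizing v with
  | mem σ h =>
    obtain ⟨i, rfl⟩ := h
    exact iteratedFDeriv_comp_swap hw i x v
  | one => rfl
  | mul a b _ _ ha hb =>
    have : v ∘ ((a * b : Equiv.Perm (Fin (k + 1)))) = (v ∘ a) ∘ b := rfl
    rw [this, hb, ha]

end SymmetryOfDerivatives

section Mollification

open MeasureTheory

lemma iteratedDeriv_comp_line {E F : Type*} [NormedAddCommGroup E] [NormedSpace ℝ E]
    [NormedAddCommGroup F] [NormedSpace ℝ F] {w : E → F} (hw : ContDiff ℝ (⊤ : ℕ∞) w)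
    (x v : E) (k : ℕ) (s : ℝ) :
    iteratedDeriv k (fun σ : ℝ => w (x + σ • v)) s = iteratedFDeriv ℝ k w (x + s • v) fun _ => v := by
  have hw' : ContDiff ℝ (⊤ : ℕ∞) (fun y => w (x + y)) := hw.comp (contDiff_const.add contDiff_id)
  have h := ContinuousLinearMap.iteratedFDeriv_comp_right
    ((ContinuousLinearMap.id ℝ ℝ).smulRight v) hw' s (i := k) (by exact_mod_cast le_top)
  rw [iteratedDeriv_eq_iteratedFDeriv]
  have e : ((fun y => w (x + y)) ∘ ((ContinuousLinearMap.id ℝ ℝ).smulRight v)) =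
      fun σ : ℝ => w (x + σ • v) := by
    funext σ; simp
  rw [e] at h
  rw [h, iteratedFDeriv_comp_add_left']
  simp

/-- Finite difference bounds on lines bound the derivatives of a smooth function. -/
lemma norm_iteratedFDeriv_le_of_fwdDiff {E : Type*} [NormedAddCommGroup E] [NormedSpace ℝ E]
    {w : E → ℂ} (hw : ContDiff ℝ (⊤ : ℕ∞) w) {x : E} {k : ℕ} {A s₀ : ℝ} (hA : 0 ≤ A) (hs₀ : 0 < s₀)
    (h : ∀ v : E, ‖v‖ ≤ 1 → ∀ s : ℝ, 0 < s → s < s₀ →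
      ‖(fwdDiff s)^[k] (fun σ : ℝ => w (x + σ • v)) 0‖ ≤ A * s ^ k) :
    ‖iteratedFDeriv ℝ k w x‖ ≤ 6 ^ k * A := by
  refine norm_le_of_forall_diagonal _ (fun σ v => ?_) hA fun v hv => ?_
  · exact iteratedFDeriv_comp_perm hw σ x v
  · set l : ℝ → ℂ := fun σ : ℝ => w (x + σ • v) with hl
    have hlc : ContDiff ℝ (⊤ : ℕ∞) l := hw.comp (contDiff_const.add (contDiff_id.smul contDiff_const))
    have h0 := iteratedDeriv_comp_line hw x v k 0
    rw [zero_smul, add_zero] at h0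
    rw [← h0]
    change ‖iteratedDeriv k l 0‖ ≤ A
    refine le_of_forall_pos_le_add fun ε hε => ?_
    have hcont : Continuous (iteratedDeriv k l) := hlc.continuous_iteratedDeriv k (by exact_mod_cast le_top)
    obtain ⟨δ, hδ, hδ'⟩ := Metric.continuous_iff.mp hcont 0 ε hε
    obtain ⟨s, hs0, hs1, hs2⟩ : ∃ s : ℝ, 0 < s ∧ s < s₀ ∧ k * s < δ := by
      refine ⟨min (s₀ / 2) (δ / (2 * (k + 1))), by positivity, ?_, ?_⟩
      · exact lt_of_le_of_lt (min_le_left _ _) (by linarith)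
      · calc k * min (s₀ / 2) (δ / (2 * (k + 1))) ≤ k * (δ / (2 * (k + 1))) := by
              gcongr; exact min_le_right _ _
          _ < δ := by
            rw [← mul_div_assoc, div_lt_iff₀ (by positivity)]
            nlinarith [(Nat.cast_nonneg k : (0 : ℝ) ≤ k)]
    have hd := norm_fwdDiff_iter_sub_le hs0.le (k := k) (h := fun j => iteratedDeriv j l) (a := 0)
      (A := ε) (c := iteratedDeriv k l 0) ?_ ?_
    · have h1 := h v hv s hs0 hs1
      rw [iteratedDeriv_zero] at hd
      have h2 : ‖(s : ℂ) ^ k * iteratedDeriv k l 0‖ ≤ A * s ^ k + ε * s ^ k := by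
        have e : (s : ℂ) ^ k * iteratedDeriv k l 0 = (fwdDiff s)^[k] l 0 -
          ((fwdDiff s)^[k] l 0 - (s : ℂ) ^ k * iteratedDeriv k l 0) := by ring
        rw [e]
        exact (norm_sub_le _ _).trans (add_le_add h1 hd)
      rw [norm_mul, norm_pow, Complex.norm_real, Real.norm_of_nonneg hs0.le] at h2
      have hsk : 0 < s ^ k := by positivity
      refine le_of_mul_le_mul_left ?_ hsk
      linarith
    · intro j _ y _
      have hdj : Differentiable ℝ (iteratedDeriv j l) :=
        hlc.differentiable_iteratedDeriv j (by exact_mod_cast (ENat.natCast_lt_top j))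
      have := (hdj y).hasDerivAt
      rwa [← iteratedDeriv_succ] at this
    · intro y hy
      have := hδ' y (by
        rw [dist_zero_right, Real.norm_of_nonneg hy.1]
        linarith [hy.2])
      rw [dist_eq_norm] at this
      exact this.le

lemma norm_fwdDiff_iter_convolution_le {E : Type*} [NormedAddCommGroup E] [NormedSpace ℝ E]
    [FiniteDimensional ℝ E] [MeasurableSpace E] [BorelSpace E] [HasContDiffBump E]
    (μ : Measure E) [μ.IsAddHaarMeasure] {g : E → ℂ} (hg : Continuous g)
    (φ : ContDiffBump (0 : E)) {x v : E} {s B : ℝ} {k : ℕ}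
    (h : ∀ y ∈ ball x φ.rOut, ‖(fwdDiff s)^[k] (fun σ : ℝ => g (y + σ • v)) 0‖ ≤ B) :
    ‖(fwdDiff s)^[k] (fun σ : ℝ =>
      (convolution (φ.normed μ) g (ContinuousLinearMap.lsmul ℝ ℝ) μ) (x + σ • v)) 0‖ ≤ B := by
  have hInt : ∀ y : E, Integrable (fun t => φ.normed μ t • g (y - t)) μ := by
    intro y
    have hc : Continuous (fun t => φ.normed μ t • g (y - t)) :=
      φ.continuous_normed.smul (hg.comp (continuous_const.sub continuous_id))
    exact hc.integrable_of_hasCompactSupport (φ.hasCompactSupport_normed.smul_right)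
  have hφ : Integrable (φ.normed μ) μ := φ.integrable_normed
  have e : (fwdDiff s)^[k] (fun σ : ℝ =>
      (convolution (φ.normed μ) g (ContinuousLinearMap.lsmul ℝ ℝ) μ) (x + σ • v)) 0 =
      ∫ t, φ.normed μ t • (fwdDiff s)^[k] (fun σ : ℝ => g (x - t + σ • v)) 0 ∂μ := by
    simp only [fwdDiff_iter_eq_sum_shift, Finset.smul_sum]
    rw [integral_finsetSum]
    · refine Finset.sum_congr rfl fun i _ => ?_
      simp only [convolution_def, ContinuousLinearMap.lsmul_apply]
      rw [← Int.cast_smul_eq_zsmul ℝ, ← integral_smul]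
      refine integral_congr_ae (Eventually.of_forall fun t => ?_)
      simp only
      rw [Int.cast_smul_eq_zsmul, smul_comm, add_sub_right_comm]
    · intro i _
      have := (hInt (x + (0 + i • s) • v)).smul ((-1 : ℤ) ^ (k - i) * (k.choose i : ℤ))
      refine this.congr (Eventually.of_forall fun t => ?_)
      simp only [Pi.smul_apply]
      rw [smul_comm, add_sub_right_comm]
  rw [e]
  calc _ ≤ ∫ t, φ.normed μ t * B ∂μ := by
        refine norm_integral_le_of_norm_le (hφ.mul_const B) (Eventually.of_forall fun t => ?_)
        rw [norm_smul, Real.norm_of_nonneg (φ.nonneg_normed t)]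
        by_cases ht : t ∈ ball (0 : E) φ.rOut
        · gcongr
          · exact φ.nonneg_normed t
          · refine h _ ?_
            simpa [dist_eq_norm] using ht
        · have : φ.normed μ t = 0 := by
            rw [← Function.notMem_support, φ.support_normed_eq]
            exact ht
          simp [this]
    _ = B := by
        rw [integral_mul_const, φ.integral_normed, one_mul]

/-- A continuous function whose finite differences along lines are bounded like those of a smooth
function is smooth, with corresponding bounds on the derivatives. -/
theorem contDiffOn_of_fwdDiff {E : Type} [NormedAddCommGroup E] [NormedSpace ℝ E]
    [FiniteDimensional ℝ E] [MeasurableSpace E] [BorelSpace E] [HasContDiffBump E]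
    (μ : Measure E) [μ.IsAddHaarMeasure] {g : E → ℂ} (hg : Continuous g) {R : ℝ} (hR : 0 < R)
    {A : ℕ → ℝ} (hA : ∀ k, 0 ≤ A k)
    (h : ∀ k, ∃ s₀ : ℝ, 0 < s₀ ∧ ∀ x ∈ ball (0 : E) R, ∀ v : E, ‖v‖ ≤ 1 → ∀ s : ℝ, 0 < s → s < s₀ →
      ‖(fwdDiff s)^[k] (fun σ : ℝ => g (x + σ • v)) 0‖ ≤ A k * s ^ k) (k : ℕ) :
    ContDiffOn ℝ k g (ball 0 (R / 2)) ∧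
      ∀ x ∈ ball (0 : E) (R / 2), ‖iteratedFDeriv ℝ k g x‖ ≤ 6 ^ k * A k := by
  let φ : ℕ → ContDiffBump (0 : E) := fun n =>
    ⟨1 / (2 * (n + 1)), 1 / (n + 1), by positivity, by
      apply one_div_lt_one_div_of_lt <;> [positivity; linarith [(Nat.cast_nonneg n : (0 : ℝ) ≤ n)]]⟩
  have hφ : ∀ n, (φ n).rOut = 1 / ((n : ℝ) + 1) := fun n => rfl
  have hsmall : ∀ ε : ℝ, 0 < ε → ∀ᶠ n in atTop, (φ n).rOut < ε := by
    intro ε hε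
    simp only [hφ]
    exact (tendsto_one_div_add_atTop_nhds_zero_nat (𝕜 := ℝ)).eventually (gt_mem_nhds hε)
  have hli : LocallyIntegrable g μ := hg.locallyIntegrable
  refine contDiffOn_of_tendstoUniformlyOn k (F := ℂ) (A := fun k => 6 ^ k * A k)
    (w := fun n => convolution ((φ n).normed μ) g (ContinuousLinearMap.lsmul ℝ ℝ) μ)
    (fun n => ?_) (fun r hr => ?_) (fun j => ?_)
  · exact (φ n).hasCompactSupport_normed.contDiff_convolution_left _ (φ n).contDiff_normed hli
  · rw [Metric.tendstoUniformlyOn_iff]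
    intro ε hε
    have huc : UniformContinuousOn g (closedBall 0 R) :=
      (isCompact_closedBall 0 R).uniformContinuousOn_of_continuous hg.continuousOn
    obtain ⟨δ, hδ, hδ'⟩ := Metric.uniformContinuousOn_iff.mp huc (ε / 2) (by positivity)
    filter_upwards [hsmall δ hδ, hsmall (R / 2) (by positivity)] with n hn1 hn2 x hx
    have hx' : ‖x‖ < r := by simpa using hx
    have := (φ n).dist_normed_convolution_le (μ := μ) (g := g) (x₀ := x) (ε := ε / 2)
      hg.aestronglyMeasurable (fun y hy => by
        have h1 : ‖y - x‖ < (φ n).rOut := by simpa [dist_eq_norm] using hy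
        have h2 := norm_sub_norm_le y x
        refine (hδ' y ?_ x ?_ ?_).le
        · simp only [mem_closedBall_zero_iff]; linarith
        · simp only [mem_closedBall_zero_iff]; linarith
        · rw [dist_eq_norm]; linarith)
    rw [dist_comm]
    linarith
  · obtain ⟨s₀, hs₀, hs⟩ := h j
    filter_upwards [hsmall (R / 2) (by positivity)] with n hn x hx
    refine norm_iteratedFDeriv_le_of_fwdDiff ?_ (hA j) hs₀ fun v hv s hs0 hs1 => ?_
    · exact (φ n).hasCompactSupport_normed.contDiff_convolution_left _ (φ n).contDiff_normed hli
    · refine norm_fwdDiff_iter_convolution_le μ hg (φ n) fun y hy => hs y ?_ v hv s hs0 hs1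
      have h1 : ‖y - x‖ < (φ n).rOut := by simpa [dist_eq_norm] using hy
      have h2 := norm_sub_norm_le y x
      have h3 : ‖x‖ < R / 2 := by simpa using hx
      simp only [mem_ball_zero_iff]; linarith

end Mollification

section Lines

lemma exists_approx_of_inherits {ι : Type*} {Φ : ι → ℂ → ℂ} {N : ℕ} (hN : 1 ≤ N)
    (h₁ : Inherits Φ fun t => t ^ N) (h₂ : Inherits Φ fun t => t ^ (N + 1)) :
    ∃ κ : ℝ, 0 < κ ∧ ∀ C : ℝ, 1 ≤ C → ∃ B : ℝ, 0 < B ∧ ∀ (φ : ℝ → ℂ) (e : ℝ), 0 < e → e ≤ 1 →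
      C * e ^ (32 * N * (N + 1)) ≤ 1 → (∀ s, |s| < 1 → ‖φ s‖ ≤ κ) →
      (∀ i, Approx (fun s => Φ i (φ s)) κ (C * e ^ (32 * N * (N + 1)))) →
      ∃ F : ℂ → ℂ, DifferentiableOn ℂ F (ball 0 (1 / 16)) ∧
        (∀ z ∈ ball (0 : ℂ) (1 / 16), ‖F z‖ ≤ B) ∧
        ∀ s : ℝ, |s| < 1 / 16 → ‖F s - φ s‖ ≤ B * e ^ 4 := by
  obtain ⟨B₁, κ₁, hB₁, hκ₁, h₁⟩ := h₁
  obtain ⟨B₂, κ₂, hB₂, hκ₂, h₂⟩ := h₂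
  obtain ⟨C₀, hC₀, hcore⟩ := exists_holomorphic_of_pow hN
  refine ⟨min κ₁ κ₂, lt_min hκ₁ hκ₂, fun C hC => ?_⟩
  set c : ℝ := (B₁ + B₂) * C + 1 with hc
  have hc1 : 1 ≤ c := by
    have : 0 ≤ (B₁ + B₂) * C := by positivity
    linarith
  have hc0 : 0 < c := by linarith
  have hcN : ∀ M : ℕ, 1 ≤ M → c ≤ c ^ M := fun M hM => le_self_pow₀ hc1 (by omega)
  have hB₁c : B₁ * C ≤ c := by nlinarith
  have hB₂c : B₂ * C ≤ c := by nlinarith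
  refine ⟨c * C₀, by positivity, fun φ e he0 he1 hCe hφ hi => ?_⟩
  set P := e ^ (32 * N * (N + 1)) with hP
  have hP0 : 0 < P := by positivity
  have hCP0 : 0 ≤ C * P := by positivity
  obtain ⟨G, dG, bG, eG⟩ := h₁ φ _ hCP0 hCe (fun s hs => (hφ s hs).trans (min_le_left _ _))
    fun i => (hi i).mono (min_le_left _ _) le_rfl
  obtain ⟨H, dH, bH, eH⟩ := h₂ φ _ hCP0 hCe (fun s hs => (hφ s hs).trans (min_le_right _ _))
    fun i => (hi i).mono (min_le_right _ _) le_rfl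
  have hpow : (e ^ 4) ^ (8 * N * (N + 1)) = P := by rw [hP, ← pow_mul]; congr 1; ring
  have hn : ∀ (M : ℕ) (z : ℂ), ‖((c : ℂ) ^ M)⁻¹ * z‖ = (c ^ M)⁻¹ * ‖z‖ := by
    intro M z
    rw [norm_mul, norm_inv, norm_pow, Complex.norm_real, Real.norm_of_nonneg hc0.le]
  have hcC : (c : ℂ) ≠ 0 := by exact_mod_cast hc0.ne'
  have hbd : ∀ (M : ℕ) (B : ℝ) (z : ℂ), 1 ≤ M → 0 ≤ B → B * C ≤ c → ‖z‖ ≤ B →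
      ‖((c : ℂ) ^ M)⁻¹ * z‖ ≤ 1 := by
    intro M B z hM hB hBc hz
    rw [hn, inv_mul_le_iff₀ (by positivity)]
    nlinarith [hcN M hM]
  have her : ∀ (M : ℕ) (B : ℝ) (z w : ℂ), 1 ≤ M → B * C ≤ c → ‖z - w ^ M‖ ≤ B * (C * P) →
      ‖((c : ℂ) ^ M)⁻¹ * z - ((c : ℂ)⁻¹ * w) ^ M‖ ≤ P := by
    intro M B z w hM hBc hz
    rw [mul_pow, inv_pow, ← mul_sub, hn, inv_mul_le_iff₀ (by positivity)]
    nlinarith [hcN M hM]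
  obtain ⟨F, dF, bF, eF⟩ := hcore (e ^ 4) (fun s => (c : ℂ)⁻¹ * φ s)
    (fun z => ((c : ℂ) ^ N)⁻¹ * G z) (fun z => ((c : ℂ) ^ (N + 1))⁻¹ * H z) (by positivity)
    (pow_le_one₀ he0.le he1) (dG.const_mul _) (dH.const_mul _)
    (fun z hz => hbd N B₁ _ hN hB₁ hB₁c (bG z hz))
    (fun z hz => hbd (N + 1) B₂ _ (by omega) hB₂ hB₂c (bH z hz))
    (fun s hs => by rw [hpow]; exact her N B₁ _ _ hN hB₁c (eG s hs))
    (fun s hs => by rw [hpow]; exact her (N + 1) B₂ _ _ (by omega) hB₂c (eH s hs))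
  refine ⟨fun z => c * F z, dF.const_mul _, fun z hz => ?_, fun s hs => ?_⟩
  · rw [norm_mul, Complex.norm_real, Real.norm_of_nonneg hc0.le]
    exact mul_le_mul_of_nonneg_left (bF z hz) hc0.le
  · have : (c : ℂ) * F s - φ s = c * (F s - (c : ℂ)⁻¹ * φ s) := by
      rw [mul_sub, mul_inv_cancel_left₀ hcC]
    rw [this, norm_mul, Complex.norm_real, Real.norm_of_nonneg hc0.le, mul_assoc]
    exact mul_le_mul_of_nonneg_left (eF s hs) hc0.le

/-- The finite differences along lines of a function are controlled by the ultradifferentiable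
bounds of its composites. -/
theorem exists_fwdDiff_bound {ι : Type*} {Φ : ι → ℂ → ℂ} {N : ℕ} (hN : 1 ≤ N)
    (h₁ : Inherits Φ fun t => t ^ N) (h₂ : Inherits Φ fun t => t ^ (N + 1))
    {W : Set (ℕ → ℝ)} (hW : RAdmissible W) :
    ∃ κ : ℝ, 0 < κ ∧ ∀ {E : Type} [NormedAddCommGroup E] [NormedSpace ℝ E] (f : E → ℂ)
      (g : ι → E → ℂ) (R : ℝ) (M : ℕ → ℝ) (C ρ : ℝ), 0 < R → M ∈ W → 1 ≤ C → 0 < ρ →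
      (∀ i, ContDiff ℝ (⊤ : ℕ∞) (g i)) →
      (∀ y ∈ ball (0 : E) R, ‖f y‖ ≤ κ) →
      (∀ i, ∀ y ∈ ball (0 : E) R, g i y = Φ i (f y)) →
      (∀ i, ∀ y ∈ ball (0 : E) R, ‖g i y‖ ≤ κ / 2) →
      (∀ i j, ∀ y ∈ ball (0 : E) R, ‖iteratedFDeriv ℝ j (g i) y‖ ≤ C * ρ ^ j * M j) →
      ∃ L ∈ W, ∃ a b : ℝ, 0 < a ∧ 0 < b ∧ ∀ k : ℕ, ∃ s₀ : ℝ, 0 < s₀ ∧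
        ∀ x ∈ ball (0 : E) (R / 2), ∀ v : E, ‖v‖ ≤ 1 → ∀ s : ℝ, 0 < s → s < s₀ →
          ‖(fwdDiff s)^[k] (fun σ : ℝ => f (x + σ • v)) 0‖ ≤ a * b ^ k * L k * s ^ k := by
  obtain ⟨κ, hκ, happ⟩ := exists_approx_of_inherits hN h₁ h₂
  refine ⟨κ, hκ, ?_⟩
  intro E _ _ f g R M C ρ hR hM hC hρ hg hfκ hgf hgκ hgb
  obtain ⟨r, hrm, hrp, hru, hMr, hL⟩ := hW.exists_ratio hM
  obtain ⟨q, hq⟩ := pow_unbounded_of_one_lt (32 * N * (N + 1) : ℝ) (one_lt_two : (1 : ℝ) < 2)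
  have hq' : 32 * N * (N + 1) ≤ 2 ^ q := by exact_mod_cast hq.le
  obtain ⟨L, hLW, Cw, hCw, hLk⟩ := hL q
  obtain ⟨B, hB, happ⟩ := happ C hC
  have hL0 : ∀ k, 0 < L k := (hW.matrix.weight L hLW).pos
  have hr0 := hrp 0
  -- the largest admissible radius
  set δ₁ : ℝ := min (R / 4) (min (κ / 2 / (C * r 0 * (2 * ρ))) (1 / (C * r 0 * (2 * ρ)))) with hδ₁
  have hδ₁0 : 0 < δ₁ := by positivity
  set A : ℕ → ℝ := fun k => (Cw * (32 * ρ)) ^ (k + 1) * L k / k.factorial with hA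
  have hA0 : ∀ k, 0 ≤ A k := fun k => by
    have := (hL0 k).le
    positivity
  have hdisc : ∀ x ∈ ball (0 : E) (R / 2), ∀ v : E, ‖v‖ ≤ 1 → ∀ k : ℕ, ∀ δ : ℝ, 0 < δ →
      δ ≤ δ₁ / 16 → ∃ F : ℂ → ℂ, DifferentiableOn ℂ F (ball 0 δ) ∧
      (∀ z ∈ ball (0 : ℂ) δ, ‖F z‖ ≤ B) ∧ ∃ e : ℝ, 0 < e ∧ e ≤ 1 ∧ e ≤ A k * δ ^ (k + 1) ∧
        ∀ s : ℝ, |s| < δ → ‖F s - f (x + s • v)‖ ≤ B * e ^ 4 := by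
    intro x hx v hv k δ hδ hδ'
    set t : ℝ := 2 * ρ * (16 * δ) with ht
    have ht0 : 0 < t := by positivity
    have hδR : 16 * δ ≤ R / 4 := by linarith [min_le_left (R / 4) (min (κ / 2 / (C * r 0 * (2 * ρ)))
      (1 / (C * r 0 * (2 * ρ))))]
    have hCt : ∀ y : ℝ, δ₁ ≤ y / (C * r 0 * (2 * ρ)) → C * r 0 * t ≤ y := by
      intro y hy
      rw [le_div_iff₀ (by positivity)] at hy
      calc C * r 0 * t = 16 * δ * (C * r 0 * (2 * ρ)) := by rw [ht]; ring
        _ ≤ δ₁ * (C * r 0 * (2 * ρ)) := by gcongr; linarith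
        _ ≤ y := hy
    have hCtκ : C * r 0 * t ≤ κ / 2 := hCt _ ((min_le_right _ _).trans (min_le_left _ _))
    have hCt1 : C * r 0 * t ≤ 1 := hCt _ ((min_le_right _ _).trans (min_le_right _ _))
    obtain ⟨k₀, hk1, hk2⟩ := exists_switch_index hrm hru ht0
    set P := ∏ i ∈ Finset.range k₀, (r i * t) with hP
    have hP0 : 0 < P := Finset.prod_pos fun i _ => mul_pos (hrp i) ht0
    have hPle := prod_switch_le hrp ht0 hk1 hk2
    have hP1 : P ≤ 1 := by simpa using hPle 0
    have hPr : P ≤ r 0 * t := by simpa using hPle 1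
    set D : ℕ := 32 * N * (N + 1) with hD
    have hD0 : D ≠ 0 := by rw [hD]; positivity
    set e : ℝ := P ^ ((D : ℝ)⁻¹) with he
    have he0 : 0 < e := by positivity
    have heD : e ^ D = P := Real.rpow_inv_natCast_pow hP0.le hD0
    have he1 : e ≤ 1 := Real.rpow_le_one hP0.le hP1 (by positivity)
    have hmem : ∀ s : ℝ, |s| ≤ 1 → x + (s * (16 * δ)) • v ∈ ball (0 : E) R := by
      intro s hs
      have h1 : ‖x‖ < R / 2 := by simpa using hx
      have h2 : ‖(s * (16 * δ)) • v‖ ≤ 16 * δ := by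
        rw [norm_smul, Real.norm_eq_abs, abs_mul, abs_of_pos (by positivity : (0 : ℝ) < 16 * δ)]
        calc |s| * (16 * δ) * ‖v‖ ≤ 1 * (16 * δ) * 1 := by gcongr
          _ = _ := by ring
      have h3 := norm_add_le x ((s * (16 * δ)) • v)
      simp only [mem_ball_zero_iff]; linarith
    have hex := happ (fun s => f (x + (s * (16 * δ)) • v)) e he0 he1 ?_ ?_ ?_
    · obtain ⟨F, dF, bF, eF⟩ := hex
      have hsc : ∀ z : ℂ, ‖z‖ < δ → ‖((16 * δ : ℝ) : ℂ)⁻¹ * z‖ < 1 / 16 := by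
        intro z hz
        rw [norm_mul, norm_inv, Complex.norm_real, Real.norm_of_nonneg (by positivity),
          inv_mul_lt_iff₀ (by positivity)]
        linarith
      refine ⟨fun z => F (((16 * δ : ℝ) : ℂ)⁻¹ * z), ?_, ?_, e, he0, he1, ?_, ?_⟩
      · refine dF.comp (by fun_prop) fun z hz => ?_
        simpa using hsc z (by simpa using hz)
      · intro z hz
        exact bF _ (by simpa using hsc z (by simpa using hz))
      · refine le_of_pow_le_pow_left₀ (n := 2 ^ q) (by positivity) (by
          have := hA0 k
          positivity) ?_
        calc e ^ 2 ^ q ≤ e ^ D := pow_le_pow_of_le_one he0.le he1 hq'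
          _ = P := heD
          _ ≤ ∏ l ∈ Finset.range (2 ^ q * (k + 1)), (r l * t) := hPle _
          _ = (∏ l ∈ Finset.range (2 ^ q * (k + 1)), r l) * t ^ (2 ^ q * (k + 1)) := by
            rw [Finset.prod_mul_distrib]; simp
          _ ≤ (Cw ^ (k + 1) * L k / k.factorial) ^ 2 ^ q * t ^ (2 ^ q * (k + 1)) := by
            gcongr
            exact (hLk k).1
          _ = (A k * δ ^ (k + 1)) ^ 2 ^ q := by
            rw [mul_comm (2 ^ q) (k + 1), pow_mul, ← mul_pow]
            congr 1
            simp only [hA]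
            rw [ht, show 2 * ρ * (16 * δ) = 32 * ρ * δ by ring, mul_pow, mul_pow Cw]
            ring
      · intro s hs
        have h16 : |(16 * δ)⁻¹ * s| < 1 / 16 := by
          have := hsc s (by simpa using hs)
          rw [← Complex.ofReal_inv, ← Complex.ofReal_mul, Complex.norm_real] at this
          exact this
        have := eF _ h16
        rw [Complex.ofReal_mul, Complex.ofReal_inv] at this
        have e2 : (16 * δ)⁻¹ * s * (16 * δ) = s := by field_simp
        rwa [e2] at this
    · rw [heD]
      calc C * P ≤ C * (r 0 * t) := by gcongr
        _ ≤ 1 := by linarith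
    · intro s hs
      exact hfκ _ (hmem s hs.le)
    · intro i
      rw [heD]
      have hline : (fun s : ℝ => g i (x + (s * (16 * δ)) • v)) =
          fun s : ℝ => g i (x + s • ((16 * δ) • v)) := by
        funext s; rw [smul_smul]
      obtain ⟨G, dG, bG, eG⟩ := exists_taylor_approx hrp ht0 hk1 (by linarith : 0 ≤ C)
        (h := fun s : ℝ => g i (x + (s * (16 * δ)) • v)) (by
          rw [hline]
          exact (hg i).comp (contDiff_const.add (contDiff_id.smul contDiff_const))) (by
          intro j s hs
          rw [hline, iteratedDeriv_comp_line (hg i)]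
          refine (ContinuousMultilinearMap.le_opNorm _ _).trans ?_
          have hb := hgb i j _ (hmem s hs)
          rw [← smul_smul] at hb
          simp only [Finset.prod_const, Finset.card_univ, Fintype.card_fin]
          have hvn : ‖(16 * δ) • v‖ ≤ 16 * δ := by
            rw [norm_smul, Real.norm_of_nonneg (by positivity)]
            exact mul_le_of_le_one_right (by positivity) hv
          have hM0 : 0 ≤ M j := ((hW.matrix.weight M hM).pos j).le
          calc _ ≤ C * ρ ^ j * M j * (16 * δ) ^ j := by gcongr
            _ ≤ C * ρ ^ j * (j.factorial * ∏ i ∈ Finset.range j, r i) * (16 * δ) ^ j := by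
              gcongr
              exact hMr j
            _ = _ := by
              rw [ht, show 2 * ρ * (16 * δ) / 2 = ρ * (16 * δ) by ring, mul_pow]
              ring)
      refine ⟨G, dG.differentiableOn, fun z hz => (bG z hz).trans ?_, fun s hs => ?_⟩
      · have := hgκ i _ (hmem 0 (by simp))
        linarith
      · have := eG s hs
        rwa [hgf i _ (hmem s hs.le)] at this
  set δ₀ := δ₁ / 16 with hδ₀
  have hδ₀0 : 0 < δ₀ := by positivity
  refine ⟨L, hLW, 6 * B * (Cw * (32 * ρ) * δ₀ + Cw) + κ, 400 * (Cw * (32 * ρ) + δ₀⁻¹),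
    by positivity, by positivity, fun k => ⟨δ₀ / (32 * (k + 1)), by positivity, ?_⟩⟩
  intro x hx v hv s hs hs'
  have hsk : 0 < s ^ k := by positivity
  have hLk0 := hL0 k
  rcases Nat.eq_zero_or_pos k with rfl | hk
  · have h1 : ‖f x‖ ≤ κ := hfκ x (ball_subset_ball (by linarith) hx)
    have h2 : L 0 = 1 := (hW.matrix.weight L hLW).first
    have h3 : 0 ≤ 6 * B * (Cw * (32 * ρ) * δ₀ + Cw) := by positivity
    simp only [Function.iterate_zero, id, zero_smul, add_zero, pow_zero, mul_one, h2]
    linarith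
  · have hb := norm_fwdDiff_iter_le_of_approx hk hB (hA0 k) hδ₀0 (hdisc x hx v hv k) hs (by
      rw [lt_div_iff₀ (by positivity)] at hs'
      nlinarith)
    refine hb.trans (mul_le_mul_of_nonneg_right ?_ hsk.le)
    have hfac : (0 : ℝ) < k.factorial := by positivity
    set X := Cw * (32 * ρ) with hX
    have hX0 : 0 < X := by positivity
    have hkA : k.factorial * A k = X * X ^ k * L k := by
      rw [hA]; field_simp; ring
    have hkf := (hLk k).2
    have p1 : X ^ k ≤ (X + δ₀⁻¹) ^ k := by
      gcongr
      have := inv_pos.mpr hδ₀0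
      linarith
    have p2 : (δ₀ ^ k)⁻¹ ≤ (X + δ₀⁻¹) ^ k := by
      rw [← inv_pow]
      gcongr
      linarith
    calc 6 * 400 ^ k * k.factorial * B * (A k * δ₀ + (δ₀ ^ k)⁻¹)
        = 6 * B * 400 ^ k * (k.factorial * A k * δ₀ + k.factorial * (δ₀ ^ k)⁻¹) := by ring
      _ ≤ 6 * B * 400 ^ k * (X * (X + δ₀⁻¹) ^ k * L k * δ₀ + Cw * L k * (X + δ₀⁻¹) ^ k) := by
        rw [hkA]
        gcongr
      _ = 6 * B * (X * δ₀ + Cw) * (400 * (X + δ₀⁻¹)) ^ k * L k := by rw [mul_pow]; ring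
      _ ≤ (6 * B * (X * δ₀ + Cw) + κ) * (400 * (X + δ₀⁻¹)) ^ k * L k := by
        gcongr
        linarith

end Lines

section Regularity

open MeasureTheory

/-- A continuous germ is ultradifferentiable once sufficiently many of its composites are. -/
theorem exists_bound_of_inherits {ι : Type*} [Finite ι] {Φ : ι → ℂ → ℂ} {N : ℕ} (hN : 1 ≤ N)
    (h₁ : Inherits Φ fun t => t ^ N) (h₂ : Inherits Φ fun t => t ^ (N + 1))
    {W : Set (ℕ → ℝ)} (hW : RAdmissible W)
    {E : Type} [NormedAddCommGroup E] [NormedSpace ℝ E] [FiniteDimensional ℝ E]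
    [MeasurableSpace E] [BorelSpace E] [HasContDiffBump E] (μ : Measure E) [μ.IsAddHaarMeasure]
    {F : E → ℂ} {G : ι → E → ℂ} {U : Set E} (hU : IsOpen U) (h0 : (0 : E) ∈ U)
    (hF : ContinuousOn F U) (hF0 : F 0 = 0) (hG : ∀ i, ContDiffOn ℝ (⊤ : ℕ∞) (G i) U)
    (hG0 : ∀ i, G i 0 = 0) (hGF : ∀ i, ∀ᶠ y in 𝓝 0, G i y = Φ i (F y))
    {M : ℕ → ℝ} (hM : M ∈ W) {C ρ : ℝ} (hρ : 0 < ρ)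
    {r : ℝ} (hr : 0 < r)
    (hb : ∀ i j, ∀ y ∈ ball (0 : E) r, ‖iteratedFDeriv ℝ j (G i) y‖ ≤ C * ρ ^ j * M j) :
    ∃ r' : ℝ, 0 < r' ∧ ∃ L ∈ W, ∃ a b : ℝ, 0 < b ∧ ContDiffOn ℝ (⊤ : ℕ∞) F (ball 0 r') ∧
      ∀ k, ∀ x ∈ ball (0 : E) r', ‖iteratedFDeriv ℝ k F x‖ ≤ a * b ^ k * L k := by
  obtain ⟨κ, hκ, hfd⟩ := exists_fwdDiff_bound hN h₁ h₂ hW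
  have hUn : U ∈ 𝓝 (0 : E) := hU.mem_nhds h0
  have e1 : ∀ᶠ y in 𝓝 (0 : E), ‖F y‖ < κ := by
    have := (hF.continuousAt hUn).norm
    rw [ContinuousAt, hF0, norm_zero] at this
    exact this.eventually_lt_const hκ
  have e2 : ∀ᶠ y in 𝓝 (0 : E), ∀ i, ‖G i y‖ < κ / 2 := by
    refine eventually_all.2 fun i => ?_
    have := ((hG i).continuousOn.continuousAt hUn).norm
    rw [ContinuousAt, hG0, norm_zero] at this
    exact this.eventually_lt_const (by positivity)
  obtain ⟨R₁, hR₁, hsub⟩ := Metric.eventually_nhds_iff_ball.1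
    (e1.and (e2.and ((eventually_all.2 hGF).and
      ((hU.eventually_mem h0).and (ball_mem_nhds (0 : E) hr)))))
  let χ : ContDiffBump (0 : E) := ⟨R₁ / 4, R₁ / 2, by positivity, by linarith⟩
  have hχ : ∀ y ∈ tsupport (χ : E → ℝ), U ∈ 𝓝 y := by
    intro y hy
    rw [χ.tsupport_eq] at hy
    exact hU.mem_nhds (hsub y (closedBall_subset_ball (by change R₁ / 2 < R₁; linarith) hy)).2.2.2.1
  have hχ1 : ∀ {H : E → ℂ}, ∀ y ∈ ball (0 : E) (R₁ / 4), χ y • H y = H y := by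
    intro H y hy
    rw [χ.one_of_mem_closedBall (ball_subset_closedBall hy), one_smul]
  have hts : ∀ H : E → ℂ, tsupport (fun y => χ y • H y) ⊆ tsupport (χ : E → ℝ) := fun H =>
    tsupport_smul_subset_left _ _
  have hsub' : ball (0 : E) (R₁ / 4) ⊆ ball 0 R₁ := ball_subset_ball (by linarith)
  have hev : ∀ {H : E → ℂ}, ∀ y ∈ ball (0 : E) (R₁ / 4), (fun y => χ y • H y) =ᶠ[𝓝 y] H :=
    fun y hy => by
      filter_upwards [isOpen_ball.mem_nhds hy] with w hw using hχ1 w hw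
  have hFc : Continuous fun y => χ y • F y :=
    continuous_of_tsupport fun y hy =>
      χ.continuous.continuousAt.smul (hF.continuousAt (hχ y (hts _ hy)))
  have hGc : ∀ i, ContDiff ℝ (⊤ : ℕ∞) fun y => χ y • G i y := fun i =>
    contDiff_iff_contDiffAt.2 fun y => by
      by_cases hy : y ∈ tsupport (χ : E → ℝ)
      · exact χ.contDiff.contDiffAt.smul ((hG i).contDiffAt (hχ y hy))
      · have := notMem_tsupport_iff_eventuallyEq.1 fun h => hy (hts (G i) h)
        exact contDiffAt_const.congr_of_eventuallyEq this
  have hM0 := fun j => ((hW.matrix.weight M hM).pos j).le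
  obtain ⟨L, hL, a, b, ha, hb0, hk⟩ := hfd (fun y => χ y • F y) (fun i y => χ y • G i y) (R₁ / 4) M
    (max C 1) ρ (by positivity) hM (le_max_right _ _) hρ hGc
    (fun y hy => by rw [hχ1 y hy]; exact (hsub y (hsub' hy)).1.le)
    (fun i y hy => by rw [hχ1 y hy, hχ1 y hy]; exact (hsub y (hsub' hy)).2.2.1 i)
    (fun i y hy => by rw [hχ1 y hy]; exact ((hsub y (hsub' hy)).2.1 i).le)
    (fun i j y hy => by
      rw [(EventuallyEq.iteratedFDeriv ℝ (hev y hy) j).eq_of_nhds]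
      refine (hb i j y (hsub y (hsub' hy)).2.2.2.2).trans ?_
      have := hM0 j
      gcongr
      exact le_max_left _ _)
  have hfin := contDiffOn_of_fwdDiff μ hFc (by positivity : 0 < R₁ / 4 / 2)
    (A := fun k => a * b ^ k * L k)
    (fun k => by have := (hW.matrix.weight L hL).pos k; positivity) hk
  have hsmall : ball (0 : E) (R₁ / 4 / 2 / 2) ⊆ ball 0 (R₁ / 4) := ball_subset_ball (by linarith)
  refine ⟨R₁ / 4 / 2 / 2, by positivity, L, hL, a, 6 * b, by positivity, ?_, fun k x hx => ?_⟩
  · refine contDiffOn_infty.2 fun k => (hfin k).1.congr fun y hy => (hχ1 y (hsmall hy)).symm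
  · rw [← (EventuallyEq.iteratedFDeriv ℝ (hev x (hsmall hx)) k).eq_of_nhds]
    refine ((hfin k).2 x hx).trans_eq ?_
    rw [mul_pow]; ring

end Regularity

/-- The canonical embedding of `ℝ` or `ℂ` into `ℂ`. -/
def toComplex (K : Type*) [RCLike K] : K →ₗᵢ[ℝ] ℂ where
  toLinearMap := (RCLike.map K ℂ : K →ₗ[ℝ] ℂ)
  norm_map' z := by simp

theorem toComplex_apply {K : Type*} [RCLike K] (z : K) :
    toComplex K z = RCLike.re z + RCLike.im z * Complex.I := by
  change RCLike.map K ℂ z = _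
  simp

theorem toComplex_mul {K : Type*} [RCLike K] (z w : K) :
    toComplex K (z * w) = toComplex K z * toComplex K w := by
  simp only [toComplex_apply]
  apply Complex.ext <;> simp [RCLike.mul_re, RCLike.mul_im]

theorem toComplex_ofReal {K : Type*} [RCLike K] (r : ℝ) : toComplex K (r : K) = r := by
  simp [toComplex_apply]

theorem toComplex_pow {K : Type*} [RCLike K] (z : K) (k : ℕ) :
    toComplex K (z ^ k) = toComplex K z ^ k := by
  induction k with
  | zero => simpa using toComplex_ofReal (K := K) 1
  | succ k ih => rw [pow_succ, toComplex_mul, ih, pow_succ]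

theorem map_toComplex {K : Type*} [RCLike K] (z : K) : RCLike.map ℂ K (toComplex K z) = z := by
  rw [toComplex_apply]
  simp

/-- The complexification of a component of a power series. -/
def complexSeries {K : Type*} [RCLike K] {n : ℕ} (P : FormalMultilinearSeries K K (Fin n → K))
    (i : Fin n) : FormalMultilinearSeries ℂ ℂ ℂ :=
  FormalMultilinearSeries.ofScalars ℂ fun k => toComplex K (P.coeff k i)

theorem coeff_complexSeries {K : Type*} [RCLike K] {n : ℕ}
    (P : FormalMultilinearSeries K K (Fin n → K)) (i : Fin n) (k : ℕ) :
    (complexSeries P i).coeff k = toComplex K (P.coeff k i) := by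
  simp [complexSeries]

theorem hasFPowerSeriesAt_complexSeries {K : Type*} [RCLike K] {n : ℕ}
    {P : FormalMultilinearSeries K K (Fin n → K)} {Phi : K → Fin n → K}
    (hPhi : HasFPowerSeriesAt Phi P 0) (i : Fin n) :
    HasFPowerSeriesAt (complexSeries P i).sum (complexSeries P i) 0 := by
  have hle : P.radius ≤ (complexSeries P i).radius := by
    refine FormalMultilinearSeries.radius_le_of_le fun k => ?_
    rw [FormalMultilinearSeries.norm_apply_eq_norm_coef,
      FormalMultilinearSeries.norm_apply_eq_norm_coef, coeff_complexSeries,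
      LinearIsometry.norm_map]
    exact norm_le_pi_norm _ i
  exact ((complexSeries P i).hasFPowerSeriesOnBall
    (hPhi.radius_pos.trans_le hle)).hasFPowerSeriesAt

theorem eventually_toComplex_eq_sum {K : Type*} [RCLike K] {n : ℕ}
    {P : FormalMultilinearSeries K K (Fin n → K)} {Phi : K → Fin n → K}
    (hPhi : HasFPowerSeriesAt Phi P 0) (i : Fin n) :
    ∀ᶠ s in 𝓝 (0 : K), toComplex K (Phi s i) = (complexSeries P i).sum (toComplex K s) := by
  have h1 := hasFPowerSeriesAt_iff.1 hPhi
  have h2 := hasFPowerSeriesAt_iff.1 (hasFPowerSeriesAt_complexSeries hPhi i)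
  have ht : Tendsto (toComplex K) (𝓝 0) (𝓝 0) := by
    simpa using (toComplex K).continuous.tendsto 0
  filter_upwards [h1, ht.eventually h2] with s hs hs'
  rw [zero_add] at hs hs'
  have hs2 := (Pi.hasSum.1 hs i).map (toComplex K).toLinearMap.toAddMonoidHom
    (toComplex K).continuous
  refine HasSum.unique ?_ hs'
  convert! hs2 using 2 with k
  simp [coeff_complexSeries, toComplex_mul, toComplex_pow]

theorem eventually_sum_eq_pow {K : Type*} [RCLike K] {n : ℕ}
    {P : FormalMultilinearSeries K K (Fin n → K)} {Phi : K → Fin n → K}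
    (hPhi : HasFPowerSeriesAt Phi P 0) {i : Fin n} {p : ℕ}
    (h : ∀ᶠ t in 𝓝 (0 : K), Phi t i = t ^ p) :
    ∀ᶠ t in 𝓝 (0 : ℂ), (complexSeries P i).sum t = t ^ p := by
  refine (AnalyticAt.frequently_eq_iff_eventually_eq
    (hasFPowerSeriesAt_complexSeries hPhi i).analyticAt (by fun_prop)).1 ?_
  have ht : Tendsto (fun r : ℝ => (r : K)) (𝓝[>] 0) (𝓝 0) := by
    have := (RCLike.continuous_ofReal (K := K)).tendsto 0
    rw [RCLike.ofReal_zero] at this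
    exact this.mono_left nhdsWithin_le_nhds
  have ht' : Tendsto (fun r : ℝ => (r : ℂ)) (𝓝[>] 0) (𝓝[≠] 0) := by
    refine tendsto_nhdsWithin_iff.2 ⟨?_, ?_⟩
    · have := Complex.continuous_ofReal.tendsto 0
      rw [Complex.ofReal_zero] at this
      exact this.mono_left nhdsWithin_le_nhds
    · filter_upwards [self_mem_nhdsWithin] with r hr
      simpa using (ne_of_gt hr : r ≠ 0)
  refine ht'.frequently (Eventually.frequently ?_)
  filter_upwards [ht.eventually (h.and (eventually_toComplex_eq_sum hPhi i))] with r hr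
  rw [← toComplex_ofReal (K := K) r, ← hr.2, hr.1, toComplex_pow]

theorem exists_not_eventually_sum_mul_eq {K : Type*} [RCLike K] {n : ℕ}
    {P : FormalMultilinearSeries K K (Fin n → K)} {Phi : K → Fin n → K}
    (hPhi : HasFPowerSeriesAt Phi P 0)
    (hgcd : ∀ m : ℕ, (∀ k : ℕ, P.coeff k ≠ 0 → m ∣ k) → m = 1) {z : ℂ} (hz : z ≠ 1) :
    ∃ i, ¬ ∀ᶠ t in 𝓝 0, (complexSeries P i).sum (z * t) = (complexSeries P i).sum t := by
  by_contra! hcon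
  refine hz (orderOf_eq_one_iff.1 (hgcd _ fun k hk => ?_))
  obtain ⟨i, hi⟩ : ∃ i, P.coeff k i ≠ 0 := Function.ne_iff.1 hk
  have hser := hasFPowerSeriesAt_complexSeries hPhi i
  have hzser : HasFPowerSeriesAt (complexSeries P i).sum
      (FormalMultilinearSeries.ofScalars ℂ fun k => z ^ k * toComplex K (P.coeff k i)) 0 := by
    have ht : Tendsto (fun t : ℂ => z * t) (𝓝 0) (𝓝 0) := by
      simpa using (continuous_const_mul z).tendsto 0
    rw [hasFPowerSeriesAt_iff]
    filter_upwards [ht.eventually (hasFPowerSeriesAt_iff.1 hser), hcon i] with t h1 h2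
    rw [zero_add] at h1 ⊢
    rw [h2] at h1
    convert! h1 using 2 with k
    simp [coeff_complexSeries]
    ring
  have hc := congrArg (fun q => FormalMultilinearSeries.coeff q k)
    (hser.eq_formalMultilinearSeries hzser)
  simp only [coeff_complexSeries, FormalMultilinearSeries.coeff_ofScalars] at hc
  have hne : toComplex K (P.coeff k i) ≠ 0 := by
    rw [← norm_ne_zero_iff, LinearIsometry.norm_map]
    exact norm_ne_zero_iff.2 hi
  exact orderOf_dvd_of_pow_eq_one (mul_right_cancel₀ hne (by rw [one_mul]; exact hc.symm))

/-- Pseudo-immersive analytic germs: sufficiency of the gcd condition, Roumieu case. -/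
theorem statement16 {K : Type*} [RCLike K] {d n : ℕ} (hn : 0 < n)
    (p : ℕ) (hp : 1 ≤ p)
    (Phi : K → Fin n → K) (P : FormalMultilinearSeries K K (Fin n → K))
    (hPhi : HasFPowerSeriesAt Phi P 0) (hPhi0 : Phi 0 = 0)
    (hPhi1 : ∀ᶠ t in 𝓝 (0 : K), Phi t ⟨0, hn⟩ = t ^ p)
    (hgcd : ∀ m : ℕ, (∀ k : ℕ, P.coeff k ≠ 0 → m ∣ k) → m = 1)
    (W : Set (ℕ → ℝ)) (hW : RAdmissible W)
    (f : EuclideanSpace ℝ (Fin d) → K) (hf0 : f 0 = 0)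
    (U : Set (EuclideanSpace ℝ (Fin d))) (hUopen : IsOpen U) (hU0 : (0 : EuclideanSpace ℝ (Fin d)) ∈ U)
    (hfcont : ContinuousOn f U)
    (hcomp : Roumieu W U (fun x => Phi (f x))) :
    ∃ V : Set (EuclideanSpace ℝ (Fin d)), IsOpen V ∧ (0 : EuclideanSpace ℝ (Fin d)) ∈ V ∧
      Roumieu W V f := by
  obtain ⟨N, hN, hinh⟩ := exists_inherits_pow (Φ := fun i => (complexSeries P i).sum)
    (fun i => (hasFPowerSeriesAt_complexSeries hPhi i).analyticAt) hp
    (eventually_sum_eq_pow hPhi hPhi1)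
    (fun z _ hz => exists_not_eventually_sum_mul_eq hPhi hgcd hz)
  have hUn := hUopen.mem_nhds hU0
  obtain ⟨r, hr, hrU⟩ := nhds_basis_closedBall.mem_iff.1 hUn
  obtain ⟨hsm, hbd⟩ := hcomp
  obtain ⟨M, hM, ρ, hρ, C, hC⟩ := hbd _ hrU (isCompact_closedBall 0 r)
  have hfc : ContinuousAt f 0 := hfcont.continuousAt hUn
  rw [ContinuousAt, hf0] at hfc
  let A : Fin n → (Fin n → K) →L[ℝ] ℂ := fun i =>
    (toComplex K).toContinuousLinearMap.comp (ContinuousLinearMap.proj i)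
  have hA : ∀ i, ‖A i‖ ≤ 1 := fun i =>
    ContinuousLinearMap.opNorm_le_bound _ zero_le_one fun x => by
      change ‖toComplex K (x i)‖ ≤ _
      rw [LinearIsometry.norm_map, one_mul]
      exact norm_le_pi_norm x i
  obtain ⟨r', hr', L, hL, a, b, hb, hF, hFb⟩ := exists_bound_of_inherits hN (hinh N le_rfl)
    (hinh (N + 1) (by omega)) hW MeasureTheory.volume (F := fun x => toComplex K (f x))
    (G := fun i => A i ∘ fun x => Phi (f x)) hUopen hU0
    ((toComplex K).continuous.comp_continuousOn hfcont) (by simp [hf0])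
    (fun i => (A i).contDiff.comp_contDiffOn hsm) (fun i => by simp [hf0, hPhi0])
    (fun i => hfc.eventually (eventually_toComplex_eq_sum hPhi i)) hM hρ hr
    (fun i j y hy => by
      have hyU := hrU (ball_subset_closedBall hy)
      have h1 := (A i).norm_iteratedFDeriv_comp_left (hsm.contDiffAt (hUopen.mem_nhds hyU))
        (n := j) (by exact_mod_cast le_top)
      have h2 := hC y (ball_subset_closedBall hy) j
      rw [iteratedFDerivWithin_of_isOpen j hUopen hyU] at h2
      exact h1.trans ((mul_le_of_le_one_left (norm_nonneg _) (hA i)).trans h2))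
  have hfF : f = RCLike.map ℂ K ∘ fun x => toComplex K (f x) := by
    funext x
    exact (map_toComplex (f x)).symm
  have hfs : ContDiffOn ℝ (⊤ : ℕ∞) f (ball 0 r') := by
    rw [hfF]
    exact (RCLike.map ℂ K).contDiff.comp_contDiffOn hF
  refine ⟨ball 0 r', isOpen_ball, mem_ball_self hr', hfs, fun Q hQ _ => ⟨L, hL, b, hb, a, ?_⟩⟩
  intro x hx k
  rw [iteratedFDerivWithin_of_isOpen k isOpen_ball (hQ hx),
    ← (toComplex K).norm_iteratedFDeriv_comp_left
      (hfs.contDiffAt (isOpen_ball.mem_nhds (hQ hx))) (i := k) (by exact_mod_cast le_top)]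
  exact hFb k x (hQ hx)

end JorisPaper
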